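/- Uniformly on every compact subset of ℂ ∖ closure(𝔻), the monic orthogonal polynomials satisfy Φ_n(z) = z^n (D_e(W;z)/D_e(W;∞)) (1 + (1/n) Σ_{k=1}^m a_k β_k²/(a_k − z) + O(1/n²)) as n → ∞. -/

import Mathlib

open scoped Real
open Filter MeasureTheory Metric Set Polynomial

section

open scoped ComplexConjugate

/-- The coordinate function on the unit circle. -/
noncomputable def circleCoord : C(Circle, ℂ) := ⟨fun z => (z : ℂ), by fun_prop⟩

local notation "ζ" => circleCoord

/-- The restriction of a polynomial to the unit circle. -/
noncomputable def circleEval (P : ℂ[X]) : C(Circle, ℂ) := aeval ζ P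

@[simp] lemma circleCoord_apply (x : Circle) : ζ x = x := rfl

@[simp] lemma circleEval_apply (P : ℂ[X]) (x : Circle) : circleEval P x = P.eval (x : ℂ) := by
  unfold circleEval
  induction P using Polynomial.induction_on' with
  | add p q hp hq => simp [hp, hq]
  | monomial n a => simp [aeval_monomial]

lemma circleCoord_mul_star : ζ * star ζ = 1 := by
  ext x
  simp [Complex.mul_conj]

lemma circleEval_mul (P Q : ℂ[X]) : circleEval (P * Q) = circleEval P * circleEval Q := by
  simp [circleEval]

lemma circleEval_add (P Q : ℂ[X]) : circleEval (P + Q) = circleEval P + circleEval Q := by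
  simp [circleEval]

lemma circleEval_sub (P Q : ℂ[X]) : circleEval (P - Q) = circleEval P - circleEval Q := by
  simp [circleEval]

lemma circleEval_X_pow (n : ℕ) : circleEval (X ^ n) = ζ ^ n := by
  simp [circleEval]

lemma circleEval_X : circleEval X = ζ := by
  simp [circleEval]

lemma circleEval_C_mul (c : ℂ) (P : ℂ[X]) : circleEval (C c * P) = c • circleEval P := by
  simp [circleEval, Algebra.smul_def]

/-- The reversed polynomial `z ^ n * conj (P (1 / conj z))`. -/
noncomputable def conjReverse (n : ℕ) (P : ℂ[X]) : ℂ[X] := (P.map conj).reflect n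

lemma natDegree_conjReverse_le (n : ℕ) (P : ℂ[X]) (h : P.natDegree ≤ n) :
    (conjReverse n P).natDegree ≤ n := by
  unfold conjReverse
  rw [Polynomial.natDegree_le_iff_coeff_eq_zero]
  intro N hN
  rw [coeff_reflect, revAt_eq_self_of_lt hN]
  apply coeff_eq_zero_of_natDegree_lt
  exact lt_of_le_of_lt natDegree_map_le (by omega)

lemma coeff_conjReverse (n i : ℕ) (P : ℂ[X]) (h : i ≤ n) :
    (conjReverse n P).coeff i = conj (P.coeff (n - i)) := by
  simp [conjReverse, coeff_reflect, revAt_le h]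

lemma eval_conjReverse (n : ℕ) (P : ℂ[X]) (h : P.natDegree ≤ n) (x : ℂ) (hx : x ≠ 0) :
    (conjReverse n P).eval x = x ^ n * conj (P.eval (conj x)⁻¹) := by
  let i : Invertible x⁻¹ := invertibleOfNonzero (inv_ne_zero hx)
  have h1 := eval₂_reflect_mul_pow (RingHom.id ℂ) x⁻¹ n (P.map conj)
    (natDegree_map_le.trans h)
  rw [invOf_eq_inv, inv_inv] at h1
  have h3 : conj (P.eval (conj x)⁻¹) = eval₂ (RingHom.id ℂ) x⁻¹ (P.map conj) := by
    rw [eval₂_id, eval_map, eval, hom_eval₂, map_inv₀, Complex.conj_conj, RingHom.comp_id]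
  rw [h3, ← h1, eval₂_id, inv_pow, conjReverse]
  field_simp

lemma eval_conjReverse_of_norm_eq_one (n : ℕ) (P : ℂ[X]) (h : P.natDegree ≤ n) (x : ℂ)
    (hx : ‖x‖ = 1) : (conjReverse n P).eval x = x ^ n * conj (P.eval x) := by
  have h0 : x ≠ 0 := by rintro rfl; simp at hx
  have h1 : (conj x)⁻¹ = x := by
    rw [inv_eq_iff_eq_inv]
    refine eq_inv_of_mul_eq_one_left ?_
    rw [mul_comm, Complex.mul_conj, Complex.normSq_eq_norm_sq, hx]; simp
  rw [eval_conjReverse n P h x h0, h1]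

lemma circleEval_conjReverse (n : ℕ) (P : ℂ[X]) (h : P.natDegree ≤ n) :
    circleEval (conjReverse n P) = ζ ^ n * star (circleEval P) := by
  ext x
  simp [eval_conjReverse_of_norm_eq_one n P h x (Circle.norm_coe x)]

lemma eq_of_eval_circle_eq {P Q : ℂ[X]}
    (h : ∀ x : Circle, P.eval (x : ℂ) = Q.eval (x : ℂ)) : P = Q := by
  refine Polynomial.eq_of_infinite_eval_eq P Q (Set.Infinite.mono (s := sphere (0 : ℂ) 1) ?_ ?_)
  · intro x hx
    exact h ⟨x, hx⟩
  · exact (IsPreconnected.infinite_of_nontrivial (isPreconnected_sphere (by simp [Complex.rank_real_complex]) 0 1) ⟨1, by simp, -1, by simp, by norm_num⟩)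

/-- A positive linear functional on the continuous functions on the unit circle, together with its
monic orthogonal polynomials. -/
structure OrthoSystem where
  Λ : C(Circle, ℂ) →ₗ[ℂ] ℂ
  bd : ℝ
  norm_le : ∀ f, ‖Λ f‖ ≤ bd * ‖f‖
  map_star : ∀ f, Λ (star f) = conj (Λ f)
  nonneg : ∀ f, 0 ≤ (Λ (f * star f)).re
  pos : ∀ P : ℂ[X], P ≠ 0 → 0 < (Λ (circleEval P * star (circleEval P))).re
  Φ : ℕ → ℂ[X]
  monic : ∀ n, (Φ n).Monic
  natDegree_eq : ∀ n, (Φ n).natDegree = n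
  orth : ∀ n, ∀ j < n, Λ (circleEval (Φ n) * star (ζ ^ j)) = 0

lemma degree_C_mul_le' (c : ℂ) (P : ℂ[X]) : (C c * P).degree ≤ P.degree := by
  rw [← smul_eq_C_mul]
  exact degree_smul_le c P

namespace OrthoSystem

variable (S : OrthoSystem)

/-- The sesquilinear form of the functional. -/
noncomputable def ip (f g : C(Circle, ℂ)) : ℂ := S.Λ (f * star g)

lemma conj_ip (f g : C(Circle, ℂ)) : conj (S.ip f g) = S.ip g f := by
  simp [ip, ← S.map_star, mul_comm]

lemma ip_add_left (f g h : C(Circle, ℂ)) : S.ip (f + g) h = S.ip f h + S.ip g h := by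
  simp [ip, add_mul]

lemma ip_sub_left (f g h : C(Circle, ℂ)) : S.ip (f - g) h = S.ip f h - S.ip g h := by
  simp [ip, sub_mul]

lemma ip_smul_left (c : ℂ) (f h : C(Circle, ℂ)) : S.ip (c • f) h = c * S.ip f h := by
  simp [ip]

lemma ip_add_right (f g h : C(Circle, ℂ)) : S.ip f (g + h) = S.ip f g + S.ip f h := by
  simp [ip, mul_add]

lemma ip_smul_right (c : ℂ) (f h : C(Circle, ℂ)) : S.ip f (c • h) = conj c * S.ip f h := by
  simp [ip]

lemma ip_zero_right (f : C(Circle, ℂ)) : S.ip f 0 = 0 := by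
  simp [ip]

lemma ip_sum_right {ι : Type*} (s : Finset ι) (f : ι → C(Circle, ℂ)) (h : C(Circle, ℂ)) :
    S.ip h (∑ i ∈ s, f i) = ∑ i ∈ s, S.ip h (f i) := by
  simp [ip, Finset.mul_sum]

/-- The seminorm of the sesquilinear form. -/
noncomputable def nrm (f : C(Circle, ℂ)) : ℝ := √(S.ip f f).re

lemma nrm_nonneg (f : C(Circle, ℂ)) : 0 ≤ S.nrm f := Real.sqrt_nonneg _

lemma sq_nrm (f : C(Circle, ℂ)) : S.nrm f ^ 2 = (S.ip f f).re :=
  Real.sq_sqrt (S.nonneg f)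

lemma ip_self (f : C(Circle, ℂ)) : S.ip f f = ((S.nrm f ^ 2 : ℝ) : ℂ) := by
  rw [sq_nrm]
  exact (Complex.conj_eq_iff_re.mp (S.conj_ip f f)).symm

/-- The pre-inner product structure on the continuous functions. -/
@[reducible] noncomputable def core : PreInnerProductSpace.Core ℂ C(Circle, ℂ) where
  inner f g := S.ip g f
  conj_inner_symm f g := S.conj_ip f g
  re_inner_nonneg f := S.nonneg f
  add_left f g h := by simp [ip_add_right]
  smul_left f g c := by simp [ip_smul_right]

lemma norm_ip_le (f g : C(Circle, ℂ)) : ‖S.ip f g‖ ≤ S.nrm f * S.nrm g := by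
  have := @InnerProductSpace.Core.norm_inner_le_norm ℂ C(Circle, ℂ) _ _ _ S.core g f
  rw [mul_comm]
  exact this

lemma bd_nonneg : 0 ≤ S.bd := by
  have := S.norm_le 1
  simp only [norm_one, mul_one] at this
  exact (norm_nonneg _).trans this

lemma nrm_le (f : C(Circle, ℂ)) : S.nrm f ≤ √S.bd * ‖f‖ := by
  unfold nrm
  rw [← Real.sqrt_sq (norm_nonneg f), ← Real.sqrt_mul S.bd_nonneg]
  apply Real.sqrt_le_sqrt
  refine (Complex.re_le_norm _).trans ((S.norm_le _).trans ?_)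
  gcongr
  · exact S.bd_nonneg
  · rw [sq]
    refine (norm_mul_le _ _).trans ?_
    rw [norm_star]

/-- The squared norms of the orthogonal polynomials. -/
noncomputable def N (n : ℕ) : ℝ := (S.ip (circleEval (S.Φ n)) (circleEval (S.Φ n))).re

/-- The reversed orthogonal polynomials. -/
noncomputable def Φs (n : ℕ) : ℂ[X] := conjReverse n (S.Φ n)

lemma N_pos (n : ℕ) : 0 < S.N n := S.pos _ (S.monic n).ne_zero

lemma ip_Φ_self (n : ℕ) : S.ip (circleEval (S.Φ n)) (circleEval (S.Φ n)) = S.N n := by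
  rw [ip_self, sq_nrm, N]

lemma sq_nrm_Φ (n : ℕ) : S.nrm (circleEval (S.Φ n)) ^ 2 = S.N n := by
  rw [sq_nrm, N]

lemma natDegree_Φs_le (n : ℕ) : (S.Φs n).natDegree ≤ n :=
  natDegree_conjReverse_le _ _ (S.natDegree_eq n).le

lemma circleEval_Φs (n : ℕ) : circleEval (S.Φs n) = ζ ^ n * star (circleEval (S.Φ n)) :=
  circleEval_conjReverse _ _ (S.natDegree_eq n).le

lemma circleCoord_pow_mul_star (n : ℕ) : ζ ^ n * star (ζ ^ n) = 1 := by
  rw [star_pow, ← mul_pow, circleCoord_mul_star, one_pow]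

lemma star_circleEval_Φs (n : ℕ) :
    circleEval (S.Φ n) = ζ ^ n * star (circleEval (S.Φs n)) := by
  rw [circleEval_Φs, star_mul, star_star, mul_comm (circleEval _), ← mul_assoc,
    circleCoord_pow_mul_star, one_mul]

lemma Φs_coeff_zero (n : ℕ) : (S.Φs n).coeff 0 = 1 := by
  rw [Φs, coeff_conjReverse _ _ _ (Nat.zero_le n)]
  have := (S.monic n).coeff_natDegree
  rw [S.natDegree_eq] at this
  simp [this]

lemma orth_of_degree_lt (n : ℕ) (Q : ℂ[X]) (hQ : Q.degree < n) :
    S.ip (circleEval (S.Φ n)) (circleEval Q) = 0 := by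
  have h : circleEval Q = ∑ i ∈ Q.support, Q.coeff i • ζ ^ i := by
    conv_lhs => rw [Q.as_sum_support_C_mul_X_pow]
    simp only [circleEval, map_sum, map_mul, aeval_C, map_pow, aeval_X, Algebra.smul_def]
  rw [h, ip_sum_right]
  refine Finset.sum_eq_zero fun i hi => ?_
  rw [ip_smul_right]
  have : i < n := by
    have := (le_degree_of_mem_supp i hi).trans_lt hQ
    exact_mod_cast this
  rw [ip, S.orth n i this, mul_zero]

lemma ip_ζ_mul (f g : C(Circle, ℂ)) : S.ip (ζ * f) (ζ * g) = S.ip f g := by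
  unfold ip
  congr 1
  rw [star_mul, show ζ * f * (star g * star ζ) = (ζ * star ζ) * (f * star g) by ring,
    circleCoord_mul_star, one_mul]

lemma ip_ζ_pow_mul (n : ℕ) (f g : C(Circle, ℂ)) : S.ip (ζ ^ n * f) (ζ ^ n * g) = S.ip f g := by
  unfold ip
  congr 1
  rw [star_mul, show ζ ^ n * f * (star g * star (ζ ^ n)) = (ζ ^ n * star (ζ ^ n)) * (f * star g)
    by ring, circleCoord_pow_mul_star, one_mul]

lemma ip_star (f g : C(Circle, ℂ)) : S.ip (star f) (star g) = S.ip g f := by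
  simp [ip, mul_comm]

lemma orth_Φs (n : ℕ) (Q : ℂ[X]) (hQ : Q.degree < n) :
    S.ip (circleEval (S.Φs n)) (ζ * circleEval Q) = 0 := by
  rcases n with _ | n
  · have : Q = 0 := by simpa using hQ
    simp [this, circleEval, ip_zero_right]
  have hQ' : Q.natDegree ≤ n := by
    rw [natDegree_le_iff_degree_le]
    exact Order.le_of_lt_succ (by exact_mod_cast hQ)
  have h1 : ζ * circleEval Q = ζ ^ (n + 1) * star (circleEval (conjReverse n Q)) := by
    rw [circleEval_conjReverse n Q hQ', star_mul, star_star, pow_succ,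
      show ζ ^ n * ζ * (circleEval Q * star (ζ ^ n)) = ζ * circleEval Q * (ζ ^ n * star (ζ ^ n))
      by ring, circleCoord_pow_mul_star, mul_one]
  rw [h1, circleEval_Φs, ip_ζ_pow_mul, ip_star, ← conj_ip, orth_of_degree_lt, map_zero]
  refine (degree_le_of_natDegree_le (natDegree_conjReverse_le n Q hQ')).trans_lt ?_
  exact_mod_cast Nat.lt_succ_self n

/-- The Verblunsky parameters, with the sign and conjugation of `Φ (n + 1) 0`. -/
noncomputable def b (n : ℕ) : ℂ := (S.Φ (n + 1)).eval 0

lemma eq_zero_of_ip_self (P : ℂ[X]) (h : S.ip (circleEval P) (circleEval P) = 0) : P = 0 := by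
  by_contra hP
  have := S.pos P hP
  have h2 : (S.ip (circleEval P) (circleEval P)).re = 0 := by rw [h]; rfl
  rw [ip] at h2
  linarith

/-- The Szegő recursion. -/
lemma Φ_succ (n : ℕ) : S.Φ (n + 1) = X * S.Φ n + C (S.b n) * S.Φs n := by
  set R := S.Φ (n + 1) - X * S.Φ n - C (S.b n) * S.Φs n with hR
  have hR0 : R.coeff 0 = 0 := by
    rw [hR, coeff_sub, coeff_sub, mul_coeff_zero, mul_coeff_zero, Φs_coeff_zero, b,
      ← coeff_zero_eq_eval_zero]
    simp
  have hdeg : R.degree < (n + 1 : ℕ) := by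
    refine (degree_sub_le _ _).trans_lt (max_lt ?_ ?_)
    · have h1 : (S.Φ (n + 1)).degree = ((n + 1 : ℕ) : WithBot ℕ) := by
        rw [degree_eq_natDegree (S.monic _).ne_zero, S.natDegree_eq]
      have h2 : (X * S.Φ n).degree = ((n + 1 : ℕ) : WithBot ℕ) := by
        rw [degree_eq_natDegree (monic_X.mul (S.monic _)).ne_zero,
          monic_X.natDegree_mul (S.monic n), S.natDegree_eq, natDegree_X, add_comm]
      rw [← h1]
      refine degree_sub_lt_left (by rw [h1, h2]) (S.monic _).ne_zero ?_
      rw [(S.monic _).leadingCoeff, (monic_X.mul (S.monic _)).leadingCoeff]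
    · refine (degree_C_mul_le' _ _).trans_lt
        ((degree_le_of_natDegree_le (S.natDegree_Φs_le n)).trans_lt ?_)
      exact_mod_cast Nat.lt_succ_self n
  obtain ⟨Q, hQ⟩ := X_dvd_iff.mpr hR0
  have hQdeg : Q.degree < n := by
    by_cases h0 : Q = 0
    · rw [h0, degree_zero]; exact WithBot.bot_lt_coe n
    rw [hQ, degree_eq_natDegree (mul_ne_zero X_ne_zero h0), natDegree_X_mul h0] at hdeg
    rw [degree_eq_natDegree h0]
    have : Q.natDegree + 1 < n + 1 := by exact_mod_cast hdeg
    exact_mod_cast Nat.lt_of_succ_lt_succ this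
  have h0 : R = 0 := by
    refine S.eq_zero_of_ip_self R ?_
    have hz : circleEval R = ζ * circleEval Q := by rw [hQ, circleEval_mul, circleEval_X]
    have gen : ∀ g, S.ip (circleEval R) g = S.ip (circleEval (S.Φ (n + 1))) g -
        S.ip (ζ * circleEval (S.Φ n)) g - S.b n * S.ip (circleEval (S.Φs n)) g := by
      intro g
      rw [hR, circleEval_sub, circleEval_sub, ip_sub_left, ip_sub_left, circleEval_C_mul,
        ip_smul_left, circleEval_mul, circleEval_X]
    rw [gen, S.orth_of_degree_lt _ _ hdeg, hz, orth_Φs _ _ _ hQdeg, ip_ζ_mul,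
      orth_of_degree_lt _ _ _ hQdeg]
    simp
  have := sub_eq_zero.mp h0
  rw [← this]; ring

lemma Φs_succ (n : ℕ) : S.Φs (n + 1) = S.Φs n + C (conj (S.b n)) * (X * S.Φ n) := by
  apply eq_of_eval_circle_eq
  intro x
  simp only [← circleEval_apply]
  have key : circleEval (S.Φs (n + 1)) =
      circleEval (S.Φs n + C (conj (S.b n)) * (X * S.Φ n)) := by
    have h2 := circleCoord_mul_star
    have hf := S.star_circleEval_Φs n
    have hg := S.circleEval_Φs n
    rw [circleEval_Φs, Φ_succ, circleEval_add, circleEval_add, circleEval_C_mul,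
      circleEval_C_mul, circleEval_mul, circleEval_X]
    generalize circleEval (S.Φ n) = f at *
    generalize circleEval (S.Φs n) = g at *
    rw [star_add, star_smul, mul_add, star_mul, mul_smul_comm]
    congr 1
    · linear_combination (ζ ^ n * star f) * h2 - hg
    · congr 1
      linear_combination - ζ * hf
  rw [key]

lemma N_succ (n : ℕ) : S.N (n + 1) = S.N n * (1 - ‖S.b n‖ ^ 2) := by
  have h1 : circleEval (X * S.Φ n) = circleEval (S.Φ (n + 1)) - S.b n • circleEval (S.Φs n) := by
    rw [Φ_succ, circleEval_add, circleEval_C_mul]; simp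
  have h2 : S.ip (circleEval (X * S.Φ n)) (circleEval (X * S.Φ n)) = S.N n := by
    rw [circleEval_mul, circleEval_X, ip_ζ_mul, ip_Φ_self]
  have h3 : S.ip (circleEval (S.Φ (n + 1))) (circleEval (S.Φs n)) = 0 := by
    apply orth_of_degree_lt
    refine (degree_le_of_natDegree_le (S.natDegree_Φs_le n)).trans_lt ?_
    exact_mod_cast Nat.lt_succ_self n
  have h3' : S.ip (circleEval (S.Φs n)) (circleEval (S.Φ (n + 1))) = 0 := by
    rw [← conj_ip, h3, map_zero]
  have h4 : S.ip (circleEval (S.Φs n)) (circleEval (S.Φs n)) = S.N n := by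
    rw [circleEval_Φs, ip_ζ_pow_mul, ip_star, ip_Φ_self]
  rw [h1] at h2
  have h5 : ∀ f g : C(Circle, ℂ), S.ip (f - S.b n • g) (f - S.b n • g) =
      S.ip f f - S.b n * S.ip g f - conj (S.b n) * S.ip f g
        + S.b n * conj (S.b n) * S.ip g g := by
    intro f g
    have : f - S.b n • g = f + (-S.b n) • g := by rw [neg_smul, sub_eq_add_neg]
    rw [this]
    simp only [ip_add_left, ip_add_right, ip_smul_left, ip_smul_right, map_neg]
    ring
  rw [h5, h3, h3', h4, ip_Φ_self, Complex.mul_conj, Complex.normSq_eq_norm_sq] at h2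
  have h6 : S.N (n + 1) + ‖S.b n‖ ^ 2 * S.N n = S.N n := by
    have : ((S.N (n + 1) + ‖S.b n‖ ^ 2 * S.N n : ℝ) : ℂ) = (S.N n : ℝ) := by
      rw [← h2]; push_cast; ring
    exact_mod_cast this
  linarith

lemma norm_b_lt_one (n : ℕ) : ‖S.b n‖ < 1 := by
  have h1 := S.N_pos (n + 1)
  rw [N_succ] at h1
  have h2 := pos_of_mul_pos_right h1 (S.N_pos n).le
  nlinarith [norm_nonneg (S.b n)]

lemma N_antitone : Antitone S.N := by
  refine antitone_nat_of_succ_le fun n => ?_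
  rw [N_succ]
  nlinarith [S.N_pos n, sq_nonneg ‖S.b n‖]

/-- The reproducing kernel of the polynomials of degree less than `n`. -/
noncomputable def K (n : ℕ) (z : ℂ) : ℂ[X] :=
  ∑ j ∈ Finset.range n, C (conj ((S.Φ j).eval z) / S.N j) * S.Φ j

lemma K_succ (n : ℕ) (z : ℂ) :
    S.K (n + 1) z = S.K n z + C (conj ((S.Φ n).eval z) / S.N n) * S.Φ n := by
  simp [K, Finset.sum_range_succ]

lemma degree_K_lt (n : ℕ) (z : ℂ) : (S.K n z).degree < n := by
  unfold K
  refine (degree_sum_le _ _).trans_lt ((Finset.sup_lt_iff (WithBot.bot_lt_coe n)).mpr ?_)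
  intro j hj
  refine (degree_C_mul_le' _ _).trans_lt ?_
  rw [degree_eq_natDegree (S.monic _).ne_zero, S.natDegree_eq]
  exact WithBot.coe_lt_coe.mpr (Finset.mem_range.mp hj)

lemma christoffel_darboux (n : ℕ) (x z : ℂ) :
    (S.N n : ℂ) * (1 - x * conj z) * (S.K n z).eval x =
      (S.Φs n).eval x * conj ((S.Φs n).eval z) - (S.Φ n).eval x * conj ((S.Φ n).eval z) := by
  induction n with
  | zero =>
    have h0 : S.Φ 0 = 1 := (S.monic 0).natDegree_eq_zero.mp (S.natDegree_eq 0)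
    have h1 : S.Φs 0 = 1 := by
      rw [Φs, h0]; simp [conjReverse]
    simp [K, h0, h1]
  | succ n ih =>
    rw [K_succ, N_succ, Φs_succ, Φ_succ]
    simp only [eval_add, eval_mul, eval_C, eval_X, map_add, map_mul, Complex.conj_conj]
    have hN : (S.N n : ℂ) ≠ 0 := by exact_mod_cast (S.N_pos n).ne'
    have hb : ((‖S.b n‖ : ℝ) : ℂ) ^ 2 = S.b n * conj (S.b n) := by
      rw [Complex.mul_conj, Complex.normSq_eq_norm_sq]; push_cast; rfl
    push_cast
    rw [hb]
    have h2 : (S.N n : ℂ) * (1 - x * conj z) * (conj (eval z (S.Φ n)) / S.N n * eval x (S.Φ n))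
      = (1 - x * conj z) * conj (eval z (S.Φ n)) * eval x (S.Φ n) := by
      field_simp
    linear_combination (1 - S.b n * conj (S.b n)) * ih + (1 - S.b n * conj (S.b n)) * h2

lemma ip_K (n : ℕ) (z : ℂ) (P : ℂ[X]) (hP : P.degree < n) :
    S.ip (circleEval P) (circleEval (S.K n z)) = P.eval z := by
  induction n generalizing P with
  | zero =>
    have : P = 0 := by simpa using hP
    simp [this, ip, circleEval]
  | succ n ih =>
    set Q := P - C (P.coeff n) * S.Φ n with hQ
    have hP' : P.natDegree ≤ n := by
      rw [natDegree_le_iff_degree_le]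
      exact Order.le_of_lt_succ (by exact_mod_cast hP)
    have hQd : Q.degree < n := by
      rw [degree_lt_iff_coeff_zero]
      intro k hk
      rcases hk.eq_or_lt with rfl | hk
      · have := (S.monic n).coeff_natDegree
        rw [S.natDegree_eq] at this
        simp [hQ, this]
      · rw [hQ, coeff_sub, coeff_C_mul, coeff_eq_zero_of_natDegree_lt (hP'.trans_lt hk),
          coeff_eq_zero_of_natDegree_lt (p := S.Φ n) (by rw [S.natDegree_eq]; exact hk)]
        simp
    have hPQ : P = Q + C (P.coeff n) * S.Φ n := by rw [hQ]; ring
    have h1 : S.ip (circleEval Q) (circleEval (S.Φ n)) = 0 := by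
      rw [← conj_ip, S.orth_of_degree_lt n Q hQd, map_zero]
    have hN : (S.N n : ℂ) ≠ 0 := by exact_mod_cast (S.N_pos n).ne'
    rw [hPQ, K_succ]
    simp only [circleEval_add, circleEval_C_mul, ip_add_left, ip_add_right, ip_smul_left,
      ip_smul_right, h1, ih Q hQd, S.orth_of_degree_lt n _ (S.degree_K_lt n z), ip_Φ_self,
      eval_add, eval_mul, eval_C, map_div₀, Complex.conj_conj, Complex.conj_ofReal]
    field_simp
    ring

lemma sq_nrm_K (n : ℕ) (z : ℂ) :
    S.N n * (1 - ‖z‖ ^ 2) * S.nrm (circleEval (S.K n z)) ^ 2 =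
      ‖(S.Φs n).eval z‖ ^ 2 - ‖(S.Φ n).eval z‖ ^ 2 := by
  have h := S.christoffel_darboux n z z
  have h1 := S.ip_K n z (S.K n z) (S.degree_K_lt n z)
  rw [ip_self] at h1
  rw [← h1] at h
  simp only [Complex.mul_conj, Complex.normSq_eq_norm_sq] at h
  exact_mod_cast h

/-- On the unit circle the orthogonal polynomials and their reversals have the same modulus. -/
lemma eval_Φs_circle (n : ℕ) (x : ℂ) (hx : ‖x‖ = 1) :
    (S.Φs n).eval x = x ^ n * conj ((S.Φ n).eval x) :=
  eval_conjReverse_of_norm_eq_one _ _ (S.natDegree_eq n).le x hx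

lemma eval_Φs_ne_zero (n : ℕ) (x : ℂ) (hx : ‖x‖ = 1) : (S.Φs n).eval x ≠ 0 := by
  induction n with
  | zero =>
    have h0 : S.Φ 0 = 1 := (S.monic 0).natDegree_eq_zero.mp (S.natDegree_eq 0)
    have h1 : S.Φs 0 = 1 := by
      rw [Φs, h0]; simp [conjReverse]
    simp [h1]
  | succ n ih =>
    have hn : ‖(S.Φ n).eval x‖ = ‖(S.Φs n).eval x‖ := by
      rw [eval_Φs_circle _ _ _ hx]; simp [hx]
    rw [Φs_succ]
    intro h
    simp only [eval_add, eval_mul, eval_C, eval_X] at h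
    have h1 : ‖(S.Φs n).eval x‖ = ‖S.b n‖ * ‖(S.Φs n).eval x‖ := by
      conv_lhs => rw [eq_neg_of_add_eq_zero_left h]
      simp [hx, hn]
    have h2 := norm_pos_iff.mpr ih
    nlinarith [S.norm_b_lt_one n]

end OrthoSystem

/-- Cauchy's estimate for the coefficients of a polynomial. -/
lemma Polynomial.norm_coeff_le_of_sphere (P : ℂ[X]) {q M : ℝ} (hq : 0 < q)
    (hM : ∀ x : ℂ, ‖x‖ = q → ‖P.eval x‖ ≤ M) (i : ℕ) : ‖P.coeff i‖ ≤ M / q ^ i := by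
  have h1 : ∀ k, iteratedDeriv k (fun x => P.eval x) = fun x => (derivative^[k] P).eval x := by
    intro k
    induction k with
    | zero => simp
    | succ k ih =>
      rw [iteratedDeriv_succ, ih, Function.iterate_succ_apply']
      ext x
      simp [Polynomial.deriv]
  have h2 := Complex.norm_iteratedDeriv_le_of_forall_mem_sphere_norm_le (c := 0) (C := M) i hq
    (f := fun x => P.eval x) P.differentiable.diffContOnCl (fun x hx => hM x (by simpa using hx))
  rw [h1] at h2
  simp only at h2
  rw [← coeff_zero_eq_eval_zero, coeff_iterate_derivative] at h2
  simp only [zero_add, Nat.descFactorial_self, nsmul_eq_mul, norm_mul, Complex.norm_natCast] at h2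
  rw [mul_div_assoc] at h2
  exact le_of_mul_le_mul_left h2 (by exact_mod_cast Nat.factorial_pos i)

namespace OrthoSystem

variable (S : OrthoSystem)

lemma norm_ip_div_le {ν : ℝ} (hν : 0 < ν) (hN : ∀ n, ν ≤ S.N n) (f : C(Circle, ℂ))
    (hf : S.nrm f ^ 2 ≤ S.N 0) (j : ℕ) :
    ‖S.ip f (circleEval (S.Φ j)) / S.N j‖ ≤ S.N 0 / ν := by
  rw [norm_div, Complex.norm_real, Real.norm_of_nonneg (S.N_pos j).le]
  gcongr
  · exact (S.N_pos 0).le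
  · have h1 := S.norm_ip_le f (circleEval (S.Φ j))
    have h2 := S.sq_nrm_Φ j
    have h3 := S.N_antitone (Nat.zero_le j)
    have h4 := S.nrm_nonneg f
    have h5 := S.nrm_nonneg (circleEval (S.Φ j))
    nlinarith [sq_nonneg (S.nrm f - S.nrm (circleEval (S.Φ j)))]
  · exact hN j

/-- Compressed multiplication by a nonnegative power of the coordinate is multiplication, up to
values of orthogonal polynomials of large degree. -/
lemma norm_ip_pow_mul_K_sub_le {ν : ℝ} (hν : 0 < ν) (hN : ∀ n, ν ≤ S.N n) (n m : ℕ) (P : ℂ[X])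
    (hP : P.natDegree ≤ n) (hP2 : S.nrm (circleEval P) ^ 2 ≤ S.N 0) (z : ℂ) {M : ℝ}
    (hM : ∀ j ≥ n, ‖(S.Φ j).eval z‖ ≤ M) :
    ‖S.ip (ζ ^ m * circleEval P) (circleEval (S.K n z)) - z ^ m * P.eval z‖ ≤
      (m + 1) * (S.N 0 / ν * M) := by
  have h1 : circleEval (S.K (n + (m + 1)) z) = circleEval (S.K n z) +
      ∑ j ∈ Finset.range (m + 1), (conj ((S.Φ (n + j)).eval z) / S.N (n + j)) •
        circleEval (S.Φ (n + j)) := by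
    unfold K
    rw [Finset.sum_range_add]
    simp only [circleEval, map_add, map_sum, map_mul, aeval_C, Algebra.smul_def]
  have h2 := S.ip_K (n + (m + 1)) z (X ^ m * P) (by
    refine lt_of_le_of_lt (degree_le_of_natDegree_le (n := n + m) ?_) ?_
    · refine natDegree_mul_le.trans ?_
      rw [natDegree_X_pow]; omega
    · exact_mod_cast (by omega : n + m < n + (m + 1)))
  rw [h1, circleEval_mul, circleEval_X_pow, ip_add_right, ip_sum_right, eval_mul, eval_pow,
    eval_X] at h2
  rw [← h2, sub_add_cancel_left, norm_neg]
  refine (norm_sum_le _ _).trans ?_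
  calc _ ≤ ∑ j ∈ Finset.range (m + 1), S.N 0 / ν * M := by
        refine Finset.sum_le_sum fun j _ => ?_
        rw [ip_smul_right, map_div₀, Complex.conj_conj, Complex.conj_ofReal, div_mul_comm, norm_mul]
        have hf : S.nrm (ζ ^ m * circleEval P) ^ 2 ≤ S.N 0 := by
          rw [sq_nrm, ip_ζ_pow_mul, ← sq_nrm]; exact hP2
        gcongr
        · exact div_nonneg (S.N_pos 0).le hν.le
        · exact S.norm_ip_div_le hν hN _ hf _
        · exact hM _ (by omega)
    _ = _ := by simp

/-- Splitting off the Taylor polynomial of order `m`. -/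
lemma exists_head_tail (P : ℂ[X]) (m : ℕ) : ∃ T R : ℂ[X], P = T + X ^ m * R ∧
    T = ∑ i ∈ Finset.range m, C (P.coeff i) * X ^ i ∧ ∀ i, R.coeff i = P.coeff (i + m) := by
  set T := ∑ i ∈ Finset.range m, C (P.coeff i) * X ^ i with hT
  have hTc : ∀ i, T.coeff i = if i < m then P.coeff i else 0 := by
    intro i
    simp [hT, finsetSum_coeff, coeff_C_mul, coeff_X_pow]
  obtain ⟨R, hR⟩ : X ^ m ∣ P - T := by
    rw [X_pow_dvd_iff]
    intro d hd
    simp [hTc, hd]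
  refine ⟨T, R, by rw [← hR]; ring, rfl, fun i => ?_⟩
  have := congrArg (fun p => p.coeff (i + m)) hR
  simp only [coeff_X_pow_mul, coeff_sub, hTc] at this
  simpa using this.symm

lemma norm_head_le (P : ℂ[X]) (m : ℕ) {q M : ℝ} (hq : 0 < q) (hq1 : q ≤ 1)
    (hM : ∀ x : ℂ, ‖x‖ = q → ‖P.eval x‖ ≤ M) :
    ‖circleEval (∑ i ∈ Finset.range m, C (P.coeff i) * X ^ i)‖ ≤ m * (M / q ^ m) := by
  have hM0 : 0 ≤ M := (norm_nonneg _).trans (hM q (by simp [abs_of_pos hq]))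
  rw [ContinuousMap.norm_le _ (by positivity)]
  intro x
  rw [circleEval_apply, eval_finsetSum]
  refine (norm_sum_le _ _).trans ?_
  calc _ ≤ ∑ i ∈ Finset.range m, M / q ^ m := by
        refine Finset.sum_le_sum fun i hi => ?_
        simp only [eval_mul, eval_C, eval_pow, eval_X, norm_mul, norm_pow, Circle.norm_coe,
          one_pow, mul_one]
        refine (P.norm_coeff_le_of_sphere hq hM i).trans ?_
        exact div_le_div_of_nonneg_left hM0 (by positivity)
          (pow_le_pow_of_le_one hq.le hq1 (Finset.mem_range.mp hi).le)
    _ = _ := by simp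

lemma norm_tail_eval_le (P R : ℂ[X]) (m : ℕ) {q r M : ℝ} (hq : 0 < q)
    (hr : 0 ≤ r) (hrq : r < q) (hM : ∀ x : ℂ, ‖x‖ = q → ‖P.eval x‖ ≤ M)
    (hR : ∀ i, R.coeff i = P.coeff (i + m)) (z : ℂ) (hz : ‖z‖ ≤ r) :
    ‖R.eval z‖ ≤ M / q ^ m * (1 - r / q)⁻¹ := by
  have hM0 : 0 ≤ M := (norm_nonneg _).trans (hM q (by simp [abs_of_pos hq]))
  rw [eval_eq_sum_range]
  refine (norm_sum_le _ _).trans ?_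
  calc _ ≤ ∑ i ∈ Finset.range (R.natDegree + 1), M / q ^ m * (r / q) ^ i := by
        refine Finset.sum_le_sum fun i _ => ?_
        rw [norm_mul, norm_pow, hR]
        calc _ ≤ M / q ^ (i + m) * r ^ i := by
              gcongr
              exact P.norm_coeff_le_of_sphere hq hM _
          _ = _ := by rw [pow_add, div_pow]; field_simp
    _ = M / q ^ m * ∑ i ∈ Finset.range (R.natDegree + 1), (r / q) ^ i := by
        rw [Finset.mul_sum]
    _ ≤ _ := by
        have h0 : 0 ≤ r / q := by positivity
        have h1 : r / q < 1 := (div_lt_one hq).mpr hrq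
        gcongr
        rw [← tsum_geometric_of_lt_one h0 h1]
        exact (summable_geometric_of_lt_one h0 h1).sum_le_tsum _ fun _ _ => by positivity

lemma star_pow_mul_eq (m : ℕ) (P T R : ℂ[X]) (h : P = T + X ^ m * R) :
    star (ζ ^ m) * circleEval P = star (ζ ^ m) * circleEval T + circleEval R := by
  rw [h, circleEval_add, circleEval_mul, circleEval_X_pow]
  linear_combination circleEval R * circleCoord_pow_mul_star m

lemma norm_star_pow_mul_le (m : ℕ) (f : C(Circle, ℂ)) : ‖star (ζ ^ m) * f‖ ≤ ‖f‖ := by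
  rw [ContinuousMap.norm_le _ (norm_nonneg _)]
  intro x
  simp only [ContinuousMap.mul_apply, ContinuousMap.star_apply, ContinuousMap.pow_apply,
    circleCoord_apply, norm_mul, norm_star, norm_pow, Circle.norm_coe, one_pow, one_mul]
  exact f.norm_coe_le_norm x

lemma norm_ip_star_pow_head_le (P : ℂ[X]) (m : ℕ) {q M : ℝ} (hq : 0 < q) (hq1 : q ≤ 1)
    (hM : ∀ x : ℂ, ‖x‖ = q → ‖P.eval x‖ ≤ M) (g : C(Circle, ℂ)) :
    ‖S.ip (star (ζ ^ m) * circleEval (∑ i ∈ Finset.range m, C (P.coeff i) * X ^ i)) g‖ ≤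
      √S.bd * (m * (M / q ^ m)) * S.nrm g := by
  refine (S.norm_ip_le _ _).trans (mul_le_mul_of_nonneg_right ?_ (S.nrm_nonneg g))
  refine (S.nrm_le _).trans (mul_le_mul_of_nonneg_left ?_ (Real.sqrt_nonneg _))
  exact (norm_star_pow_mul_le _ _).trans (norm_head_le P m hq hq1 hM)

/-- The pairing with an antisymmetric Laurent series, term by term. -/
lemma norm_ip_laurent_sub_le {c : ℕ → ℂ} {v : C(Circle, ℂ)}
    (hv : HasSum (fun m : ℕ => c m • ζ ^ (m + 1) - conj (c m) • star (ζ ^ (m + 1))) v)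
    {Cv s q κ M : ℝ} (hq : 0 < q) (hs : 0 ≤ s) (hsq : s < q)
    (hc : ∀ m, ‖c m‖ ≤ Cv * s ^ m) (f g : C(Circle, ℂ)) {y : ℕ → ℂ} {p : ℂ}
    (hy : HasSum (fun m => c m * y m) p)
    (h1 : ∀ m : ℕ, ‖S.ip (ζ ^ (m + 1) * f) g - y m‖ ≤ (m + 2) * (κ * M / q ^ (m + 1)))
    (h2 : ∀ m : ℕ, ‖S.ip (star (ζ ^ (m + 1)) * f) g‖ ≤ (m + 2) * (κ * M / q ^ (m + 1))) :
    ‖S.ip (v * f) g - p‖ ≤ 2 * Cv * (κ * M / q) * ∑' m : ℕ, (m + 2) * (s / q) ^ m := by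
  let L : C(Circle, ℂ) →ₗ[ℂ] ℂ :=
    { toFun := fun u => S.ip (u * f) g
      map_add' := fun u w => by rw [add_mul, ip_add_left]
      map_smul' := fun c u => by rw [smul_mul_assoc, ip_smul_left]; rfl }
  have hL : ∀ u, ‖L u‖ ≤ (S.bd * (‖f‖ * ‖g‖)) * ‖u‖ := by
    intro u
    change ‖S.Λ (u * f * star g)‖ ≤ _
    refine (S.norm_le _).trans ?_
    rw [mul_assoc S.bd, mul_comm (‖f‖ * ‖g‖)]
    refine mul_le_mul_of_nonneg_left ?_ S.bd_nonneg
    rw [mul_assoc]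
    refine (norm_mul_le _ _).trans (mul_le_mul_of_nonneg_left ?_ (norm_nonneg _))
    refine (norm_mul_le _ _).trans ?_
    rw [norm_star]
  have hsum := ((L.mkContinuous _ hL).hasSum hv).sub hy
  have hCv : 0 ≤ Cv := by
    have := (norm_nonneg _).trans (hc 0)
    simpa using this
  have hr : ‖s / q‖ < 1 := by
    rw [Real.norm_of_nonneg (by positivity)]; exact (div_lt_one hq).mpr hsq
  have hsm : Summable fun m : ℕ => ((m : ℝ) + 2) * (s / q) ^ m := by
    have ha := summable_pow_mul_geometric_of_norm_lt_one 1 hr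
    have hb := (summable_geometric_of_norm_lt_one hr).mul_left 2
    refine (ha.add hb).congr fun m => ?_
    simp; ring
  have hq' := hq.ne'
  change ‖L.mkContinuous _ hL v - p‖ ≤ _
  rw [← hsum.tsum_eq]
  refine tsum_of_norm_bounded (hsm.hasSum.mul_left _) fun m => ?_
  have hLm : L (c m • ζ ^ (m + 1) - conj (c m) • star (ζ ^ (m + 1))) =
      c m * S.ip (ζ ^ (m + 1) * f) g - conj (c m) * S.ip (star (ζ ^ (m + 1)) * f) g := by
    rw [map_sub, map_smul, map_smul]; rfl
  have e1 : L.mkContinuous _ hL (c m • ζ ^ (m + 1) - conj (c m) • star (ζ ^ (m + 1))) - c m * y m =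
      c m * (S.ip (ζ ^ (m + 1) * f) g - y m) - conj (c m) * S.ip (star (ζ ^ (m + 1)) * f) g := by
    rw [LinearMap.mkContinuous_apply, hLm]; ring
  rw [e1]
  refine (norm_sub_le _ _).trans ?_
  rw [norm_mul, norm_mul, Complex.norm_conj]
  have hb := hc m
  have e2 : 2 * Cv * (κ * M / q) * (((m : ℝ) + 2) * (s / q) ^ m) =
      Cv * s ^ m * ((m + 2) * (κ * M / q ^ (m + 1))) +
      Cv * s ^ m * ((m + 2) * (κ * M / q ^ (m + 1))) := by
    rw [div_pow, pow_succ]; field_simp; ring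
  rw [e2]
  have hb0 : 0 ≤ Cv * s ^ m := by positivity
  exact add_le_add (mul_le_mul hb (h1 m) (norm_nonneg _) hb0)
    (mul_le_mul hb (h2 m) (norm_nonneg _) hb0)

end OrthoSystem

namespace OrthoSystem

variable (S : OrthoSystem)

lemma nrm_K_le {ν S0 r : ℝ} (hν : 0 < ν) (n : ℕ) (hN : ν ≤ S.N n) (hr1 : r < 1) (z : ℂ)
    (hz : ‖z‖ ≤ r) (hS : ‖(S.Φs n).eval z‖ ≤ S0) :
    S.nrm (circleEval (S.K n z)) ≤ S0 / √(ν * (1 - r ^ 2)) := by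
  have hS0 : 0 ≤ S0 := (norm_nonneg _).trans hS
  have hr0 : 0 ≤ r := (norm_nonneg _).trans hz
  have hr2 : 0 < 1 - r ^ 2 := by nlinarith
  have h := S.sq_nrm_K n z
  have hz2 : ‖z‖ ^ 2 ≤ r ^ 2 := pow_le_pow_left₀ (norm_nonneg _) hz 2
  have h1 : ν * (1 - r ^ 2) ≤ S.N n * (1 - ‖z‖ ^ 2) :=
    mul_le_mul hN (by linarith) hr2.le (S.N_pos n).le
  have h2 : ν * (1 - r ^ 2) * S.nrm (circleEval (S.K n z)) ^ 2 ≤ S0 ^ 2 := by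
    have h3 := mul_le_mul_of_nonneg_right h1 (sq_nonneg (S.nrm (circleEval (S.K n z))))
    have h4 := pow_le_pow_left₀ (norm_nonneg _) hS 2
    nlinarith [sq_nonneg ‖(S.Φ n).eval z‖]
  rw [le_div_iff₀ (by positivity)]
  refine (pow_le_pow_iff_left₀ (mul_nonneg (S.nrm_nonneg _) (Real.sqrt_nonneg _)) hS0
    two_ne_zero).mp ?_
  rw [mul_pow, Real.sq_sqrt (by positivity)]
  linarith

lemma degree_lt_of_shift {P R : ℂ[X]} {n m : ℕ} (hP : P.natDegree ≤ n + m)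
    (hR : ∀ i, R.coeff i = P.coeff (i + (m + 1))) : R.degree < n := by
  rw [degree_lt_iff_coeff_zero]
  intro i hi
  rw [hR]
  exact coeff_eq_zero_of_natDegree_lt (by omega)

/-- The compression of the logarithmic derivative of the weight applied to `Φ n` is controlled by
the orthogonal polynomials of degree at least `n`. -/
lemma norm_ip_v_Φ_le {c : ℕ → ℂ} {v : C(Circle, ℂ)}
    (hv : HasSum (fun m : ℕ => c m • ζ ^ (m + 1) - conj (c m) • star (ζ ^ (m + 1))) v)
    {Cv s q r ν S0 M : ℝ} (hs : 0 ≤ s) (hsq : s < q) (hq1 : q < 1) (hrq : r < q)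
    (hc : ∀ m, ‖c m‖ ≤ Cv * s ^ m) (hν : 0 < ν) (hN : ∀ n, ν ≤ S.N n) (n : ℕ)
    (hS : ∀ x : ℂ, ‖x‖ ≤ q → ‖(S.Φs n).eval x‖ ≤ S0)
    (hM : ∀ j ≥ n, ∀ x : ℂ, ‖x‖ ≤ q → ‖(S.Φ j).eval x‖ ≤ M) (z : ℂ) (hz : ‖z‖ ≤ r) :
    ‖S.ip (v * circleEval (S.Φ n)) (circleEval (S.K n z))‖ ≤
      2 * Cv * ((S.N 0 / ν + 1 + √S.bd * (S0 / √(ν * (1 - r ^ 2))) + (1 - r / q)⁻¹) * M / q) *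
        ∑' m : ℕ, (m + 2) * (s / q) ^ m := by
  have hq : 0 < q := hs.trans_lt hsq
  have hr0 : 0 ≤ r := (norm_nonneg _).trans hz
  have hM0 : 0 ≤ M := (norm_nonneg _).trans (hM n le_rfl z (hz.trans hrq.le))
  have hS0 : 0 ≤ S0 := (norm_nonneg _).trans (hS z (hz.trans hrq.le))
  have hκ := S.nrm_K_le hν n (hN n) (hrq.trans hq1) z hz (hS z (hz.trans hrq.le))
  have hrq1 : 0 < 1 - r / q := by rw [sub_pos]; exact (div_lt_one hq).mpr hrq
  have hN0 : 0 ≤ S.N 0 / ν := div_nonneg (S.N_pos 0).le hν.le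
  have key := S.norm_ip_laurent_sub_le hv hq hs hsq hc (circleEval (S.Φ n))
    (circleEval (S.K n z)) (y := 0) (p := 0) (M := M)
    (κ := S.N 0 / ν + 1 + √S.bd * (S0 / √(ν * (1 - r ^ 2))) + (1 - r / q)⁻¹)
    (by simp) ?_ ?_
  · simpa using key
  · intro m
    have h1 := S.norm_ip_pow_mul_K_sub_le hν hN n (m + 1) (S.Φ n) (S.natDegree_eq n).le
      (by rw [sq_nrm_Φ]; exact S.N_antitone (Nat.zero_le n)) z
      (fun j hj => hM j hj z (hz.trans hrq.le))
    have h2 : ‖z ^ (m + 1) * (S.Φ n).eval z‖ ≤ M := by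
      rw [norm_mul, norm_pow]
      have h3 : ‖z‖ ^ (m + 1) ≤ 1 := pow_le_one₀ (norm_nonneg _) (by linarith)
      have h4 := hM n le_rfl z (hz.trans hrq.le)
      nlinarith [norm_nonneg ((S.Φ n).eval z), norm_nonneg z]
    have h5 : ‖S.ip (ζ ^ (m + 1) * circleEval (S.Φ n)) (circleEval (S.K n z))‖ ≤
        (m + 2) * ((S.N 0 / ν + 1) * M) := by
      have := norm_add_le (S.ip (ζ ^ (m + 1) * circleEval (S.Φ n)) (circleEval (S.K n z)) -
        z ^ (m + 1) * (S.Φ n).eval z) (z ^ (m + 1) * (S.Φ n).eval z)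
      rw [sub_add_cancel] at this
      push_cast at h1
      have hm : (0 : ℝ) ≤ m := Nat.cast_nonneg m
      nlinarith
    rw [Pi.zero_apply, sub_zero]
    refine h5.trans (mul_le_mul_of_nonneg_left ?_ (by positivity))
    have hqm : q ^ (m + 1) ≤ 1 := pow_le_one₀ hq.le hq1.le
    rw [le_div_iff₀ (by positivity)]
    have h6 : 0 ≤ √S.bd * (S0 / √(ν * (1 - r ^ 2))) + (1 - r / q)⁻¹ := by positivity
    have h7 : (S.N 0 / ν + 1) * M * q ^ (m + 1) ≤ (S.N 0 / ν + 1) * M :=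
      mul_le_of_le_one_right (by positivity) hqm
    nlinarith
  · intro m
    obtain ⟨T, R, hTR, hT, hR⟩ := exists_head_tail (S.Φ n) (m + 1)
    have hMq : ∀ x : ℂ, ‖x‖ = q → ‖(S.Φ n).eval x‖ ≤ M := fun x hx => hM n le_rfl x hx.le
    rw [star_pow_mul_eq _ _ _ _ hTR, ip_add_left,
      S.ip_K n z R (degree_lt_of_shift (n := n) (by rw [S.natDegree_eq]; omega) hR)]
    have h1 := S.norm_ip_star_pow_head_le (S.Φ n) (m + 1) hq hq1.le hMq (circleEval (S.K n z))
    rw [← hT] at h1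
    have h2 := norm_tail_eval_le (S.Φ n) R (m + 1) hq hr0 hrq hMq hR z hz
    refine (norm_add_le _ _).trans ((add_le_add h1 h2).trans ?_)
    have h3 : √S.bd * (((m + 1 : ℕ) : ℝ) * (M / q ^ (m + 1))) * S.nrm (circleEval (S.K n z)) ≤
        √S.bd * (((m + 1 : ℕ) : ℝ) * (M / q ^ (m + 1))) * (S0 / √(ν * (1 - r ^ 2))) :=
      mul_le_mul_of_nonneg_left hκ (by positivity)
    refine (add_le_add_left h3 _).trans ?_
    set A := M / q ^ (m + 1) with hA
    have hA0 : 0 ≤ A := by positivity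
    set B := √S.bd * (S0 / √(ν * (1 - r ^ 2))) with hB
    have hB0 : 0 ≤ B := by positivity
    have e : (S.N 0 / ν + 1 + B + (1 - r / q)⁻¹) * M / q ^ (m + 1) =
      (S.N 0 / ν + 1 + B + (1 - r / q)⁻¹) * A := by rw [hA]; ring
    rw [e]
    have hm : (0 : ℝ) ≤ m := Nat.cast_nonneg m
    have hi : 0 ≤ (1 - r / q)⁻¹ := by positivity
    push_cast
    have e2 : √S.bd * (((m : ℝ) + 1) * A) * (S0 / √(ν * (1 - r ^ 2))) = (m + 1) * (A * B) := by
      rw [hB]; ring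
    rw [e2]
    nlinarith [mul_nonneg hA0 hB0, mul_nonneg hA0 hi, mul_nonneg hm (mul_nonneg hA0 hB0),
      mul_nonneg hm (mul_nonneg hA0 hi), mul_nonneg hA0 hN0, mul_nonneg hm (mul_nonneg hA0 hN0),
      mul_nonneg hm hA0]

/-- The reversed kernel polynomial. -/
lemma eval_conjReverse_K (n : ℕ) (hn : 0 < n) (x z : ℂ) (hx : x ≠ 0) :
    (S.N n : ℂ) * (x - z) * (conjReverse (n - 1) (S.K n z)).eval x =
      (S.Φ n).eval x * (S.Φs n).eval z - (S.Φs n).eval x * (S.Φ n).eval z := by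
  have hdeg : (S.K n z).natDegree ≤ n - 1 := by
    have := S.degree_K_lt n z
    by_cases h : S.K n z = 0
    · simp [h]
    · have := (natDegree_lt_iff_degree_lt h).mpr this
      omega
  have hcx : conj x ≠ 0 := by simpa using hx
  have hcd := congrArg conj (S.christoffel_darboux n (conj x)⁻¹ z)
  have h1 := eval_conjReverse n (S.Φ n) (S.natDegree_eq n).le x hx
  have h2 := eval_conjReverse n (S.Φ n) (S.natDegree_eq n).le (conj x)⁻¹ (inv_ne_zero hcx)
  rw [eval_conjReverse _ _ hdeg x hx]
  simp only [map_mul, map_sub, map_one, map_inv₀, Complex.conj_conj, Complex.conj_ofReal, inv_inv]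
    at hcd h2
  change (S.Φs n).eval x = _ at h1
  change (S.Φs n).eval (conj x)⁻¹ = _ at h2
  rw [h2] at hcd
  simp only [map_mul, map_pow, map_inv₀, Complex.conj_conj] at hcd
  rw [h1]
  have hxn : x ^ n * x⁻¹ ^ n = 1 := by rw [← mul_pow, mul_inv_cancel₀ hx, one_pow]
  obtain ⟨k, rfl⟩ : ∃ k, n = k + 1 := ⟨n - 1, by omega⟩
  simp only [Nat.add_sub_cancel]
  have hxx : x * x⁻¹ = 1 := mul_inv_cancel₀ hx
  linear_combination x ^ (k + 1) * hcd + hxn * (S.Φ (k + 1)).eval x * (S.Φs (k + 1)).eval z +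
    hxx * (-(S.N (k+1) : ℂ) * (-z) * x ^ k *
      conj ((S.K (k + 1) z).eval (conj x)⁻¹))

lemma norm_ip_v_Φs_sub_le {c : ℕ → ℂ} {v : C(Circle, ℂ)}
    (hv : HasSum (fun m : ℕ => c m • ζ ^ (m + 1) - conj (c m) • star (ζ ^ (m + 1))) v)
    {Cv s q r ν S0 M : ℝ} (hs : 0 ≤ s) (hsq : s < q) (hq1 : q < 1) (hrq : r < q)
    (hc : ∀ m, ‖c m‖ ≤ Cv * s ^ m) (hν : 0 < ν) (hN : ∀ n, ν ≤ S.N n) (n : ℕ) (hn : 0 < n)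
    (hS : ∀ x : ℂ, ‖x‖ ≤ q → ‖(S.Φs n).eval x‖ ≤ S0)
    (hM : ∀ j ≥ n, ∀ x : ℂ, ‖x‖ ≤ q → ‖(S.Φ j).eval x‖ ≤ M) (z : ℂ) (hz : ‖z‖ ≤ r) {p : ℂ}
    (hp : HasSum (fun m => c m * z ^ m) p) :
    ‖S.ip (v * (star ζ * circleEval (S.Φs n))) (circleEval (S.K n z)) -
        p * (S.Φs n).eval z‖ ≤
      2 * Cv * ((S.N 0 / ν + √S.bd * √(S.N 0) * (2 * S0 / (ν * (q - r)))) * M / q) *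
        ∑' m : ℕ, (m + 2) * (s / q) ^ m := by
  have hq : 0 < q := hs.trans_lt hsq
  have hr0 : 0 ≤ r := (norm_nonneg _).trans hz
  have hM0 : 0 ≤ M := (norm_nonneg _).trans (hM n le_rfl z (hz.trans hrq.le))
  have hS0 : 0 ≤ S0 := (norm_nonneg _).trans (hS z (hz.trans hrq.le))
  have hN0 : 0 ≤ S.N 0 / ν := div_nonneg (S.N_pos 0).le hν.le
  have hqr : 0 < q - r := sub_pos.mpr hrq
  have hNn : S.N n ≤ S.N 0 := S.N_antitone (Nat.zero_le n)
  have hss : star ζ * ζ = 1 := by rw [mul_comm, circleCoord_mul_star]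
  set B := √S.bd * √(S.N 0) * (2 * S0 / (ν * (q - r))) with hB
  have hB0 : 0 ≤ B := by positivity
  refine S.norm_ip_laurent_sub_le hv hq hs hsq hc _ _ (y := fun m => z ^ m * (S.Φs n).eval z)
    (M := M) (κ := S.N 0 / ν + B) ?_ ?_ ?_
  · simpa [mul_assoc] using hp.mul_right ((S.Φs n).eval z)
  · intro m
    have h0 : S.nrm (circleEval (S.Φs n)) ^ 2 ≤ S.N 0 := by
      rw [sq_nrm, circleEval_Φs, ip_ζ_pow_mul, ip_star, ← sq_nrm, sq_nrm_Φ]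
      exact hNn
    have h1 := S.norm_ip_pow_mul_K_sub_le hν hN n m (S.Φs n) (S.natDegree_Φs_le n) h0 z
      (fun j hj => hM j hj z (hz.trans hrq.le))
    have e : ζ ^ (m + 1) * (star ζ * circleEval (S.Φs n)) = ζ ^ m * circleEval (S.Φs n) := by
      linear_combination ζ ^ m * circleEval (S.Φs n) * hss
    rw [e]
    refine h1.trans (mul_le_mul (by linarith) ?_ (by positivity) (by positivity))
    have hqm : q ^ (m + 1) ≤ 1 := pow_le_one₀ hq.le hq1.le
    rw [le_div_iff₀ (by positivity)]
    have h7 : S.N 0 / ν * M * q ^ (m + 1) ≤ S.N 0 / ν * M :=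
      mul_le_of_le_one_right (by positivity) hqm
    nlinarith
  · intro m
    set Kr := conjReverse (n - 1) (S.K n z) with hKr
    have hdeg : (S.K n z).natDegree ≤ n - 1 := by
      by_cases h : S.K n z = 0
      · simp [h]
      · have := (natDegree_lt_iff_degree_lt h).mpr (S.degree_K_lt n z)
        omega
    have hKr_bound : ∀ x : ℂ, ‖x‖ = q → ‖Kr.eval x‖ ≤ 2 * S0 / (ν * (q - r)) * M := by
      intro x hx
      have hx0 : x ≠ 0 := by rw [← norm_pos_iff, hx]; exact hq
      have h1 := S.eval_conjReverse_K n hn x z hx0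
      have h2 : ‖(S.Φ n).eval x * (S.Φs n).eval z - (S.Φs n).eval x * (S.Φ n).eval z‖ ≤
          M * S0 + S0 * M := by
        refine (norm_sub_le _ _).trans ?_
        rw [norm_mul, norm_mul]
        exact add_le_add
          (mul_le_mul (hM n le_rfl x hx.le) (hS z (hz.trans hrq.le)) (norm_nonneg _) hM0)
          (mul_le_mul (hS x hx.le) (hM n le_rfl z (hz.trans hrq.le)) (norm_nonneg _) hS0)
      rw [← h1, norm_mul, norm_mul, Complex.norm_real, Real.norm_of_nonneg (S.N_pos n).le] at h2
      have h3 : q - r ≤ ‖x - z‖ := by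
        have := norm_sub_norm_le x z
        linarith
      have h4 : ν * (q - r) * ‖Kr.eval x‖ ≤ S.N n * ‖x - z‖ * ‖Kr.eval x‖ :=
        mul_le_mul_of_nonneg_right (mul_le_mul (hN n) h3 hqr.le (S.N_pos n).le) (norm_nonneg _)
      rw [div_mul_eq_mul_div, le_div_iff₀ (by positivity)]
      linarith
    obtain ⟨T, R, hTR, hT, hR⟩ := exists_head_tail Kr (m + 1)
    have hRd : R.degree < n := by
      refine degree_lt_of_shift (m := m) ?_ hR
      exact (natDegree_conjReverse_le _ _ hdeg).trans (by omega)
    have e : S.ip (star (ζ ^ (m + 1)) * (star ζ * circleEval (S.Φs n))) (circleEval (S.K n z)) =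
        S.ip (star (ζ ^ (m + 1)) * circleEval T) (circleEval (S.Φ n)) := by
      have h1 : S.ip (circleEval R) (circleEval (S.Φ n)) = 0 := by
        rw [← conj_ip, S.orth_of_degree_lt n R hRd, map_zero]
      have h2 : S.ip (star (ζ ^ (m + 1)) * circleEval Kr) (circleEval (S.Φ n)) =
          S.ip (star (ζ ^ (m + 1)) * circleEval T) (circleEval (S.Φ n)) := by
        rw [star_pow_mul_eq _ _ _ _ hTR, ip_add_left, h1, add_zero]
      rw [← h2, hKr, circleEval_conjReverse _ _ hdeg, circleEval_Φs]
      unfold ip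
      congr 1
      obtain ⟨k, rfl⟩ : ∃ k, n = k + 1 := ⟨n - 1, by omega⟩
      simp only [Nat.add_sub_cancel]
      linear_combination star (ζ ^ (m + 1)) * ζ ^ k * star (circleEval (S.Φ (k + 1))) *
        star (circleEval (S.K (k + 1) z)) * hss
    have h1 := S.norm_ip_star_pow_head_le Kr (m + 1) hq hq1.le hKr_bound (circleEval (S.Φ n))
    rw [← hT] at h1
    rw [e]
    refine h1.trans ?_
    have h2 : S.nrm (circleEval (S.Φ n)) ≤ √(S.N 0) := by
      apply Real.le_sqrt_of_sq_le
      rw [sq_nrm_Φ]; exact hNn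
    calc _ ≤ √S.bd * (((m + 1 : ℕ) : ℝ) * (2 * S0 / (ν * (q - r)) * M / q ^ (m + 1))) *
            √(S.N 0) := mul_le_mul_of_nonneg_left h2 (by positivity)
      _ = ((m + 1 : ℕ) : ℝ) * (B * M / q ^ (m + 1)) := by rw [hB]; ring
      _ ≤ _ := by
        push_cast
        refine mul_le_mul (by linarith) ?_ (by positivity) (by positivity)
        gcongr
        linarith

end OrthoSystem

lemma circleEval_derivative_conjReverse (n : ℕ) (P : ℂ[X]) (hP : P.natDegree ≤ n) (hn : 0 < n) :
    circleEval (derivative (conjReverse n P)) =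
      -(ζ ^ (n - 1) * star (ζ * circleEval (derivative P) - (n : ℂ) • circleEval P)) := by
  have hmain : ∀ x : Circle, (derivative (conjReverse n P)).eval (x : ℂ) =
      -((x : ℂ) ^ (n - 1) * conj ((x : ℂ) * (derivative P).eval (x : ℂ) - n * P.eval (x : ℂ))) := by
    intro x
    set y : ℂ := (x : ℂ) with hy
    have hy0 : y ≠ 0 := Circle.coe_ne_zero x
    have hyc : y * conj y = 1 := by
      rw [Complex.mul_conj, Complex.normSq_eq_norm_sq, hy, Circle.norm_coe]; simp
    have h1 : conjReverse n P = ∑ j ∈ Finset.range (n + 1), C (conj (P.coeff j)) * X ^ (n - j) := by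
      rw [(conjReverse n P).as_sum_range' (n + 1)
        (Nat.lt_succ_of_le (natDegree_conjReverse_le n P hP)), ← Finset.sum_range_reflect]
      refine Finset.sum_congr rfl fun j hj => ?_
      have hj' := Finset.mem_range.mp hj
      rw [show n + 1 - 1 - j = n - j by omega, coeff_conjReverse _ _ _ (by omega),
        show n - (n - j) = j by omega, C_mul_X_pow_eq_monomial]
    have h2 : P = ∑ j ∈ Finset.range (n + 1), C (P.coeff j) * X ^ j := by
      conv_lhs => rw [P.as_sum_range' (n + 1) (Nat.lt_succ_of_le hP)]
      simp only [C_mul_X_pow_eq_monomial]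
    have h3 : P.eval y = ∑ j ∈ Finset.range (n + 1), P.coeff j * y ^ j := by
      conv_lhs => rw [h2]
      simp [eval_finsetSum]
    have h4 : (derivative P).eval y =
        ∑ j ∈ Finset.range (n + 1), P.coeff j * (j * y ^ (j - 1)) := by
      conv_lhs => rw [h2]
      simp [eval_finsetSum, derivative_X_pow]
    rw [h1, h3, h4]
    simp only [map_sum, eval_finsetSum, derivative_mul, derivative_C, zero_mul, zero_add,
      derivative_X_pow, eval_mul, eval_C, eval_natCast, eval_pow, eval_X, map_sub, map_mul,
      map_sum, map_natCast, map_pow, Finset.mul_sum, ← Finset.sum_sub_distrib]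
    rw [← Finset.sum_neg_distrib]
    refine Finset.sum_congr rfl fun j hj => ?_
    have hj' : j ≤ n := Nat.lt_succ_iff.mp (Finset.mem_range.mp hj)
    have h5 : conj y * ((j : ℂ) * conj y ^ (j - 1)) = j * conj y ^ j := by
      rcases j with _ | j
      · simp
      · simp only [Nat.add_sub_cancel, pow_succ]; ring
    rcases hj'.lt_or_eq with h | rfl
    · have h6 : y ^ (n - 1) * conj y ^ j = y ^ (n - j - 1) := by
        rw [show n - 1 = (n - j - 1) + j by omega, pow_add, mul_assoc, ← mul_pow, hyc, one_pow,
          mul_one]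
      rw [Nat.cast_sub hj', ← h6]
      linear_combination y ^ (n - 1) * conj (P.coeff j) * h5
    · simp only [Nat.sub_self, Nat.cast_zero, zero_mul, mul_zero]
      linear_combination y ^ (j - 1) * conj (P.coeff j) * h5
  ext x
  simp only [circleEval_apply, ContinuousMap.neg_apply, ContinuousMap.mul_apply,
    ContinuousMap.pow_apply, circleCoord_apply, ContinuousMap.star_apply, ContinuousMap.sub_apply,
    ContinuousMap.smul_apply, smul_eq_mul]
  exact hmain x

namespace OrthoSystem

variable (S : OrthoSystem)

/-- The quotient of an orthogonal polynomial and its reversed polynomial. -/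
noncomputable def u (n : ℕ) (x : ℂ) : ℂ := (S.Φ n).eval x / (S.Φs n).eval x

lemma ip_sub_right (f g h : C(Circle, ℂ)) : S.ip f (g - h) = S.ip f g - S.ip f h := by
  simp [ip, mul_sub]

lemma degree_mul_derivative_sub_lt (n : ℕ) :
    (X * derivative (S.Φ n) - C (n : ℂ) * S.Φ n).degree < (n : WithBot ℕ) := by
  rw [degree_lt_iff_coeff_zero]
  intro i hi
  rw [coeff_sub, coeff_C_mul]
  rcases i with _ | i
  · simp [show n = 0 by omega]
  · rw [coeff_X_mul, coeff_derivative]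
    rcases hi.lt_or_eq with h | h
    · rw [coeff_eq_zero_of_natDegree_lt (by rw [S.natDegree_eq]; omega)]; simp
    · rw [h]; push_cast; ring

lemma exists_functional {m : ℕ} (a : Fin m → ℂ) (ha' : Function.Injective a) (f : C(Circle, ℂ))
    {n : ℕ} (hmn : m ≤ n)
    (h : ∀ Q : ℂ[X], Q.degree < n → (∀ k, Q.eval (a k) = 0) → S.ip f (circleEval Q) = 0) :
    ∃ c : Fin m → ℂ, ∀ Q : ℂ[X], Q.degree < n →
      S.ip f (circleEval Q) = ∑ k, c k * conj (Q.eval (a k)) := by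
  refine ⟨fun k => S.ip f (circleEval (Lagrange.basis Finset.univ a k)), fun Q hQ => ?_⟩
  have h1 := h (Q - Lagrange.interpolate Finset.univ a (fun k => Q.eval (a k))) ?_ ?_
  · rw [Lagrange.interpolate_apply, circleEval_sub, ip_sub_right, sub_eq_zero] at h1
    rw [h1]
    have h2 : circleEval (∑ k, C (Q.eval (a k)) * Lagrange.basis Finset.univ a k) =
        ∑ k, Q.eval (a k) • circleEval (Lagrange.basis Finset.univ a k) := by
      simp only [circleEval, map_sum, map_mul, aeval_C, Algebra.smul_def]
    rw [h2, ip_sum_right]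
    exact Finset.sum_congr rfl fun k _ => by rw [ip_smul_right, mul_comm]
  · refine lt_of_le_of_lt (degree_sub_le _ _) (max_lt hQ ?_)
    refine (Lagrange.degree_interpolate_lt _ (ha'.injOn)).trans_le ?_
    simpa using hmn
  · intro k
    rw [eval_sub, Lagrange.eval_interpolate_at_node _ ha'.injOn (Finset.mem_univ k), sub_self]

lemma conj_eval_K {n : ℕ} {z x : ℂ} (hz : ‖z‖ < 1) (hx : ‖x‖ = 1) :
    conj ((S.K n z).eval x) = conj ((S.Φs n).eval x) / S.N n *
      (((S.Φs n).eval z - conj (S.u n x) * (S.Φ n).eval z) / (1 - z * conj x)) := by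
  have hd : 1 - z * conj x ≠ 0 := by
    intro h
    have := congrArg norm (sub_eq_zero.mp h)
    rw [norm_one, norm_mul, Complex.norm_conj, hx, mul_one] at this
    linarith
  have hN : (S.N n : ℂ) ≠ 0 := by exact_mod_cast (S.N_pos n).ne'
  have hs : conj ((S.Φs n).eval x) ≠ 0 := by simpa using S.eval_Φs_ne_zero n x hx
  have h := congrArg conj (S.christoffel_darboux n x z)
  simp only [map_mul, map_sub, map_one, Complex.conj_conj, Complex.conj_ofReal] at h
  rw [u, map_div₀]
  field_simp
  linear_combination h

/-- The differential relations satisfied by an orthogonal polynomial and its reversed polynomial. -/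
lemma exists_structure_relation {m : ℕ} (a : Fin m → ℂ) (ha : ∀ k, ‖a k‖ = 1)
    (ha' : Function.Injective a) (v : C(Circle, ℂ)) (hv : star v = -v) {n : ℕ} (hn : 0 < n)
    (hmn : m ≤ n)
    (hibp : ∀ Q : ℂ[X], Q.degree < n → (∀ k, Q.eval (a k) = 0) →
      S.ip (ζ * circleEval (derivative (S.Φ n)) + v * circleEval (S.Φ n)) (circleEval Q) = 0) :
    ∃ x : Fin m → ℂ, ∀ z : ℂ, ‖z‖ < 1 →
      (derivative (S.Φs n)).eval z +
          S.ip (v * (star ζ * circleEval (S.Φs n))) (circleEval (S.K n z)) =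
        ∑ k, x k * (((S.Φs n).eval z - conj (S.u n (a k)) * (S.Φ n).eval z) /
          (1 - z * conj (a k))) ∧
      n * (S.Φ n).eval z = z * (derivative (S.Φ n)).eval z +
        S.ip (v * circleEval (S.Φ n)) (circleEval (S.K n z)) +
        ∑ k, conj (x k) * (conj (a k) * S.u n (a k)) *
          (((S.Φs n).eval z - conj (S.u n (a k)) * (S.Φ n).eval z) / (1 - z * conj (a k))) := by
  obtain ⟨c, hc⟩ := S.exists_functional a ha' _ hmn hibp
  have hN : (S.N n : ℂ) ≠ 0 := by exact_mod_cast (S.N_pos n).ne'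
  have hsx : ∀ k, conj ((S.Φs n).eval (a k)) ≠ 0 :=
    fun k => by simpa using S.eval_Φs_ne_zero n (a k) (ha k)
  have haa : ∀ k, a k * conj (a k) = 1 := fun k => by
    rw [Complex.mul_conj, Complex.normSq_eq_norm_sq, ha]; simp
  have hΦ : circleEval (X * derivative (S.Φ n) - C (n : ℂ) * S.Φ n) =
      ζ * circleEval (derivative (S.Φ n)) - (n : ℂ) • circleEval (S.Φ n) := by
    rw [circleEval_sub, circleEval_mul, circleEval_X, circleEval_C_mul]
  have hf : ∀ Q : ℂ[X], Q.degree < n →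
      S.ip (circleEval (X * derivative (S.Φ n) - C (n : ℂ) * S.Φ n)) (circleEval Q) +
        S.ip (v * circleEval (S.Φ n)) (circleEval Q) = ∑ k, c k * conj (Q.eval (a k)) := by
    intro Q hQ
    rw [← hc Q hQ, hΦ, ip_sub_left, ip_smul_left, S.orth_of_degree_lt n Q hQ, mul_zero, sub_zero,
      ip_add_left]
  obtain ⟨k, rfl⟩ : ∃ k, n = k + 1 := ⟨n - 1, by omega⟩
  refine ⟨fun j => -(conj (c j) * a j ^ k * (conj ((S.Φs (k + 1)).eval (a j)) / S.N (k + 1))),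
    fun z hz => ⟨?_, ?_⟩⟩
  · have hdK : (S.K (k + 1) z).natDegree ≤ k := by
      by_cases h : S.K (k + 1) z = 0
      · simp [h]
      · have := (natDegree_lt_iff_degree_lt h).mpr (S.degree_K_lt (k + 1) z)
        omega
    have h1 := hf (conjReverse k (S.K (k + 1) z)) (by
      refine lt_of_le_of_lt (degree_le_of_natDegree_le (natDegree_conjReverse_le _ _ hdK)) ?_
      exact_mod_cast Nat.lt_succ_self k)
    have h2 := circleEval_derivative_conjReverse (k + 1) (S.Φ (k + 1)) (S.natDegree_eq _).le hn
    change circleEval (derivative (S.Φs (k + 1))) = _ at h2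
    have hdeg : (derivative (S.Φs (k + 1))).degree < (k + 1 : ℕ) := by
      rw [degree_lt_iff_coeff_zero]
      intro i hi
      rw [coeff_derivative, coeff_eq_zero_of_natDegree_lt, zero_mul]
      have := S.natDegree_Φs_le (k + 1)
      omega
    have h3 := S.ip_K (k + 1) z _ hdeg
    rw [← h3]
    have h4 : conj (S.ip (circleEval (X * derivative (S.Φ (k + 1)) - C ((k + 1 : ℕ) : ℂ) *
        S.Φ (k + 1))) (circleEval (conjReverse k (S.K (k + 1) z)))) =
        -S.ip (circleEval (derivative (S.Φs (k + 1)))) (circleEval (S.K (k + 1) z)) := by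
      rw [conj_ip, h2, circleEval_conjReverse _ _ hdK, hΦ, Nat.add_sub_cancel]
      unfold ip
      rw [neg_mul, map_neg, neg_neg]
      congr 1
      ring
    have h5 : conj (S.ip (v * circleEval (S.Φ (k + 1)))
        (circleEval (conjReverse k (S.K (k + 1) z)))) =
        -S.ip (v * (star ζ * circleEval (S.Φs (k + 1)))) (circleEval (S.K (k + 1) z)) := by
      rw [conj_ip, circleEval_conjReverse _ _ hdK, circleEval_Φs]
      unfold ip
      rw [← map_neg, star_mul, hv]
      congr 1
      have hss : star ζ * ζ = 1 := by rw [mul_comm, circleCoord_mul_star]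
      linear_combination v * ζ ^ k * star (circleEval (S.Φ (k + 1))) *
        star (circleEval (S.K (k + 1) z)) * hss
    have h6 := congrArg conj h1
    rw [map_add, h4, h5] at h6
    rw [← neg_inj, neg_add, h6, map_sum, ← Finset.sum_neg_distrib]
    refine Finset.sum_congr rfl fun j _ => ?_
    have h7 := eval_conjReverse_of_norm_eq_one k _ hdK (a j) (ha j)
    rw [map_mul, Complex.conj_conj, h7, S.conj_eval_K hz (ha j)]
    ring
  · have h1 := hf (S.K (k + 1) z) (S.degree_K_lt _ z)
    rw [S.ip_K (k + 1) z _ (S.degree_mul_derivative_sub_lt (k + 1))] at h1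
    simp only [eval_sub, eval_mul, eval_X, eval_C] at h1
    have h2 : ∑ j, c j * conj ((S.K (k + 1) z).eval (a j)) = -∑ j,
        conj (-(conj (c j) * a j ^ k * (conj ((S.Φs (k + 1)).eval (a j)) / S.N (k + 1)))) *
          (conj (a j) * S.u (k + 1) (a j)) *
          (((S.Φs (k + 1)).eval z - conj (S.u (k + 1) (a j)) * (S.Φ (k + 1)).eval z) /
            (1 - z * conj (a j))) := by
      rw [← Finset.sum_neg_distrib]
      refine Finset.sum_congr rfl fun j _ => ?_
      rw [S.conj_eval_K hz (ha j)]
      have h3 := congrArg conj (S.eval_Φs_circle (k + 1) (a j) (ha j))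
      simp only [map_neg, map_mul, map_pow, map_div₀, Complex.conj_conj, Complex.conj_ofReal]
        at h3 ⊢
      have hne := S.eval_Φs_ne_zero (k + 1) (a j) (ha j)
      have h5 : (S.Φs (k + 1)).eval (a j) * S.u (k + 1) (a j) = (S.Φ (k + 1)).eval (a j) := by
        rw [u, mul_div_cancel₀ _ hne]
      rw [h3]
      linear_combination (-(c j) * conj (a j) ^ k * conj (a j) / S.N (k + 1) *
        (((S.Φs (k + 1)).eval z - conj (S.u (k + 1) (a j)) * (S.Φ (k + 1)).eval z) /
            (1 - z * conj (a j)))) * h5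
    rw [h2] at h1
    linear_combination -h1

end OrthoSystem

/-- The bound `g n z = O(n⁻ᵏ)`, uniformly for `z` in compact subsets of the open unit disk. -/
def UBigO (k : ℕ) (g : ℕ → ℂ → ℂ) : Prop :=
  ∀ r < (1 : ℝ), ∃ C, 0 ≤ C ∧ ∀ᶠ n : ℕ in atTop, ∀ z : ℂ, ‖z‖ ≤ r → ‖g n z‖ ≤ C * ((n : ℝ) ^ k)⁻¹

namespace UBigO

variable {k l : ℕ} {g h : ℕ → ℂ → ℂ}

lemma congr' (hg : UBigO k g) (e : ∀ᶠ n : ℕ in atTop, ∀ z : ℂ, ‖z‖ < 1 → h n z = g n z) :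
    UBigO k h := by
  intro r hr
  obtain ⟨C, hC, H⟩ := hg r hr
  refine ⟨C, hC, ?_⟩
  filter_upwards [H, e] with n h1 h2 z hz
  rw [h2 z (hz.trans_lt hr)]
  exact h1 z hz

lemma congr (hg : UBigO k g) (e : ∀ n, ∀ z : ℂ, ‖z‖ < 1 → h n z = g n z) : UBigO k h :=
  hg.congr' (Eventually.of_forall e)

lemma of_norm_le (hg : UBigO k g)
    (e : ∀ᶠ n : ℕ in atTop, ∀ z : ℂ, ‖z‖ < 1 → ‖h n z‖ ≤ ‖g n z‖) : UBigO k h := by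
  intro r hr
  obtain ⟨C, hC, H⟩ := hg r hr
  refine ⟨C, hC, ?_⟩
  filter_upwards [H, e] with n h1 h2 z hz
  exact (h2 z (hz.trans_lt hr)).trans (h1 z hz)

lemma add (hg : UBigO k g) (hh : UBigO k h) : UBigO k fun n z => g n z + h n z := by
  intro r hr
  obtain ⟨C, hC, H⟩ := hg r hr
  obtain ⟨D, hD, H'⟩ := hh r hr
  refine ⟨C + D, by positivity, ?_⟩
  filter_upwards [H, H'] with n h1 h2 z hz
  rw [add_mul]
  exact (norm_add_le _ _).trans (add_le_add (h1 z hz) (h2 z hz))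

lemma neg (hg : UBigO k g) : UBigO k fun n z => -g n z :=
  hg.of_norm_le (Eventually.of_forall fun n z _ => by rw [norm_neg])

lemma sub (hg : UBigO k g) (hh : UBigO k h) : UBigO k fun n z => g n z - h n z :=
  (hg.add hh.neg).congr fun n z _ => by ring

lemma mul (hg : UBigO k g) (hh : UBigO l h) : UBigO (k + l) fun n z => g n z * h n z := by
  intro r hr
  obtain ⟨C, hC, H⟩ := hg r hr
  obtain ⟨D, hD, H'⟩ := hh r hr
  refine ⟨C * D, by positivity, ?_⟩
  filter_upwards [H, H'] with n h1 h2 z hz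
  rw [norm_mul, pow_add, mul_inv, show C * D * (((n : ℝ) ^ k)⁻¹ * ((n : ℝ) ^ l)⁻¹) =
    (C * ((n : ℝ) ^ k)⁻¹) * (D * ((n : ℝ) ^ l)⁻¹) by ring]
  exact mul_le_mul (h1 z hz) (h2 z hz) (norm_nonneg _) (by positivity)

lemma mono (hg : UBigO k g) (hlk : l ≤ k) : UBigO l g := by
  intro r hr
  obtain ⟨C, hC, H⟩ := hg r hr
  refine ⟨C, hC, ?_⟩
  filter_upwards [H, eventually_ge_atTop 1] with n h1 hn z hz
  refine (h1 z hz).trans (mul_le_mul_of_nonneg_left ?_ hC)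
  have hn' : (1 : ℝ) ≤ n := by exact_mod_cast hn
  exact inv_anti₀ (by positivity) (pow_le_pow_right₀ hn' hlk)

lemma zero : UBigO k fun _ _ => 0 := fun r _ => ⟨0, le_rfl, by simp⟩

lemma sum {ι : Type*} (s : Finset ι) {g : ι → ℕ → ℂ → ℂ} (h : ∀ i ∈ s, UBigO k (g i)) :
    UBigO k fun n z => ∑ i ∈ s, g i n z := by
  classical
  induction s using Finset.induction_on with
  | empty => simpa using zero
  | insert i s hi ih =>
    simp only [Finset.sum_insert hi]
    exact (h i (Finset.mem_insert_self i s)).add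
      (ih fun j hj => h j (Finset.mem_insert_of_mem hj))

lemma of_continuousOn {f : ℂ → ℂ} (hf : ContinuousOn f (ball 0 1)) : UBigO 0 fun _ z => f z := by
  intro r hr
  obtain ⟨C, hC⟩ := (isCompact_closedBall (0 : ℂ) r).exists_bound_of_continuousOn
    (hf.mono (closedBall_subset_ball hr))
  refine ⟨|C|, abs_nonneg _, Eventually.of_forall fun n z hz => ?_⟩
  simpa using (hC z (by simpa using hz)).trans (le_abs_self C)

lemma const (c : ℂ) : UBigO 0 fun _ _ => c := of_continuousOn continuousOn_const

lemma of_bounded {x : ℕ → ℂ} {C : ℝ} (hC : ∀ᶠ n in atTop, ‖x n‖ ≤ C * ((n : ℝ) ^ k)⁻¹) :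
    UBigO k fun n _ => x n := by
  intro r _
  refine ⟨|C|, abs_nonneg _, ?_⟩
  filter_upwards [hC] with n hn z _
  exact hn.trans (mul_le_mul_of_nonneg_right (le_abs_self C) (by positivity))

lemma inv_natCast : UBigO 1 fun n _ => (n : ℂ)⁻¹ :=
  of_bounded (C := 1) (Eventually.of_forall fun n => by simp)

lemma inv_natCast_pow (k : ℕ) : UBigO k fun n _ => ((n : ℂ) ^ k)⁻¹ :=
  of_bounded (C := 1) (Eventually.of_forall fun n => by simp)

lemma const_mul (hg : UBigO k g) (c : ℂ) : UBigO k fun n z => c * g n z := by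
  simpa using (const c).mul hg

lemma fun_mul (hg : UBigO k g) {f : ℂ → ℂ} (hf : ContinuousOn f (ball 0 1)) :
    UBigO k fun n z => f z * g n z := by
  simpa using (of_continuousOn hf).mul hg

lemma eval (hg : UBigO k g) {w : ℂ} (hw : ‖w‖ < 1) : UBigO k fun n _ => g n w := by
  intro r _
  obtain ⟨C, hC, H⟩ := hg ‖w‖ hw
  exact ⟨C, hC, by filter_upwards [H] with n h z _ using h w le_rfl⟩

lemma exists_scalar {x : ℕ → ℂ} (hx : UBigO k fun n _ => x n) :
    ∃ C, 0 ≤ C ∧ ∀ᶠ n : ℕ in atTop, ‖x n‖ ≤ C * ((n : ℝ) ^ k)⁻¹ := by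
  obtain ⟨C, hC, H⟩ := hx 0 zero_lt_one
  exact ⟨C, hC, by filter_upwards [H] with n h using h 0 (by simp)⟩

lemma conj_scalar {x : ℕ → ℂ} (hx : UBigO k fun n _ => x n) :
    UBigO k fun n _ => (starRingEnd ℂ) (x n) :=
  hx.of_norm_le (Eventually.of_forall fun n z _ => by rw [Complex.norm_conj])

lemma succ (hg : UBigO k g) : UBigO k fun n z => g (n + 1) z := by
  intro r hr
  obtain ⟨C, hC, H⟩ := hg r hr
  refine ⟨C, hC, ?_⟩
  filter_upwards [(tendsto_add_atTop_nat 1).eventually H, eventually_ge_atTop 1] with n h hn z hz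
  refine (h z hz).trans (mul_le_mul_of_nonneg_left ?_ hC)
  have hn' : (1 : ℝ) ≤ n := by exact_mod_cast hn
  refine inv_anti₀ (by positivity) (pow_le_pow_left₀ (by positivity) ?_ _)
  push_cast; linarith

lemma deriv (hg : UBigO k g) (hd : ∀ n, DifferentiableOn ℂ (g n) (ball 0 1)) :
    UBigO k fun n z => deriv (g n) z := by
  intro r hr
  obtain ⟨q, hrq, hq⟩ := exists_between hr
  obtain ⟨C, hC, H⟩ := hg q hq
  have hqr : 0 < q - r := sub_pos.mpr hrq
  refine ⟨C / (q - r), by positivity, ?_⟩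
  filter_upwards [H] with n h z hz
  have hsub : closedBall z (q - r) ⊆ ball 0 1 := by
    intro y hy
    rw [mem_closedBall, dist_eq_norm] at hy
    rw [mem_ball_zero_iff]
    have := norm_add_le (y - z) z
    rw [sub_add_cancel] at this
    linarith
  have := Complex.norm_deriv_le_of_forall_mem_sphere_norm_le (f := g n) (c := z)
    (C := C * ((n : ℝ) ^ k)⁻¹) hqr
    ((hd n).mono (closure_ball_subset_closedBall.trans hsub)).diffContOnCl (fun y hy => by
      apply h
      rw [mem_sphere, dist_eq_norm] at hy
      have := norm_add_le (y - z) z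
      rw [sub_add_cancel] at this
      linarith)
  rw [div_mul_eq_mul_div]
  exact this

/-- Summing the increments of a convergent sequence of functions. -/
lemma of_increment {F : ℂ → ℂ} (hF : ∀ z : ℂ, ‖z‖ < 1 → Tendsto (fun n => g n z) atTop (nhds (F z)))
    (hg : UBigO (k + 2) fun n z => g (n + 1) z - g n z) : UBigO (k + 1) fun n z => g n z - F z := by
  intro r hr
  obtain ⟨C, hC, H⟩ := hg r hr
  obtain ⟨n₀, H⟩ := eventually_atTop.mp H
  refine ⟨2 * C, by positivity, ?_⟩
  filter_upwards [eventually_ge_atTop (max n₀ 1)] with n hn z hz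
  have hstep : ∀ j ≥ n, ‖g (j + 1) z - g j z‖ ≤
      2 * C * (((j : ℝ) ^ (k + 1))⁻¹ - (((j + 1 : ℕ) : ℝ) ^ (k + 1))⁻¹) := by
    intro j hj
    have hj1 : (1 : ℝ) ≤ j := by
      exact_mod_cast (le_max_right n₀ 1).trans (hn.trans hj)
    refine (H j ((le_max_left n₀ 1).trans (hn.trans hj)) z hz).trans ?_
    rw [mul_comm 2 C, mul_assoc]
    refine mul_le_mul_of_nonneg_left ?_ hC
    push_cast
    have h1 : (((j : ℝ) + 1) ^ (k + 1))⁻¹ ≤ ((j : ℝ) ^ k)⁻¹ * ((j : ℝ) + 1)⁻¹ := by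
      rw [pow_succ, mul_inv]
      refine mul_le_mul_of_nonneg_right ?_ (by positivity)
      exact inv_anti₀ (by positivity) (pow_le_pow_left₀ (by positivity) (by linarith) _)
    have h2 : ((j : ℝ) ^ (k + 1))⁻¹ = ((j : ℝ) ^ k)⁻¹ * (j : ℝ)⁻¹ := by rw [pow_succ, mul_inv]
    have h3 : ((j : ℝ) ^ (k + 2))⁻¹ = ((j : ℝ) ^ k)⁻¹ * ((j : ℝ)⁻¹ * (j : ℝ)⁻¹) := by
      rw [pow_add, mul_inv, pow_two, mul_inv]
    have h4 : (j : ℝ)⁻¹ * (j : ℝ)⁻¹ ≤ 2 * ((j : ℝ)⁻¹ - ((j : ℝ) + 1)⁻¹) := by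
      rw [← sub_nonneg]
      have : 2 * ((j : ℝ)⁻¹ - ((j : ℝ) + 1)⁻¹) - (j : ℝ)⁻¹ * (j : ℝ)⁻¹ =
          (j - 1) / (j ^ 2 * (j + 1)) := by field_simp; ring
      rw [this]
      exact div_nonneg (by linarith) (by positivity)
    have h5 : 0 ≤ ((j : ℝ) ^ k)⁻¹ := by positivity
    nlinarith [mul_le_mul_of_nonneg_left h4 h5]
  have hsum : ∀ j, ‖g (n + j) z - g n z‖ ≤
      2 * C * (((n : ℝ) ^ (k + 1))⁻¹ - (((n + j : ℕ) : ℝ) ^ (k + 1))⁻¹) := by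
    intro j
    induction j with
    | zero => simp
    | succ j ih =>
      have h1 := hstep (n + j) (by omega)
      have h2 := norm_add_le (g (n + j + 1) z - g (n + j) z) (g (n + j) z - g n z)
      rw [sub_add_sub_cancel] at h2
      rw [← add_assoc]
      linarith
  have hlim : Tendsto (fun j => ‖g (n + j) z - g n z‖) atTop (nhds ‖F z - g n z‖) := by
    have h1 := (tendsto_add_atTop_iff_nat n).mpr (hF z (hz.trans_lt hr))
    simp only [add_comm _ n] at h1
    exact (h1.sub_const _).norm
  rw [norm_sub_rev]
  refine le_of_tendsto hlim (Eventually.of_forall fun j => (hsum j).trans ?_)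
  have : 0 ≤ (((n + j : ℕ) : ℝ) ^ (k + 1))⁻¹ := by positivity
  exact mul_le_mul_of_nonneg_left (by linarith) (by positivity)

end UBigO

/-- Simple fractions with distinct poles on the unit circle are determined by their values at
suitable points of the disk. -/
lemma exists_inverse_simple_fractions {m : ℕ} (a : Fin m → ℂ) (ha : ∀ k, ‖a k‖ = 1)
    (ha' : Function.Injective a) :
    ∃ (t : Fin m → ℂ) (B : Matrix (Fin m) (Fin m) ℂ), (∀ i, ‖t i‖ < 1) ∧
      ∀ (x : Fin m → ℂ) (k : Fin m), ∑ i, B k i * ∑ j, x j / (1 - t i * conj (a j)) = x k := by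
  have haa : ∀ k, a k * conj (a k) = 1 := fun k => by
    rw [Complex.mul_conj, Complex.normSq_eq_norm_sq, ha]; simp
  let t : Fin m → ℂ := fun i => (((i : ℕ) : ℝ) / (m : ℝ) : ℝ)
  have ht : ∀ i, ‖t i‖ < 1 := by
    intro i
    have hm : (0 : ℝ) < m := by exact_mod_cast i.pos
    rw [Complex.norm_real, Real.norm_of_nonneg (by positivity), div_lt_one hm]
    exact_mod_cast i.isLt
  have htinj : Function.Injective t := by
    intro i j hij
    have hm : (m : ℝ) ≠ 0 := by exact_mod_cast i.pos.ne'
    have h1 : ((i : ℕ) : ℝ) / (m : ℝ) = ((j : ℕ) : ℝ) / (m : ℝ) := Complex.ofReal_injective hij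
    rw [div_left_inj' hm] at h1
    exact Fin.ext (by exact_mod_cast h1)
  have hd : ∀ i k, 1 - t i * conj (a k) ≠ 0 := by
    intro i k h
    have := congrArg norm (sub_eq_zero.mp h)
    rw [norm_one, norm_mul, Complex.norm_conj, ha, mul_one] at this
    linarith [ht i]
  let A : Matrix (Fin m) (Fin m) ℂ := Matrix.of fun i k => (1 - t i * conj (a k))⁻¹
  have hinj : Function.Injective A.mulVec := by
    rw [← Matrix.coe_mulVecLin, injective_iff_map_eq_zero]
    intro x hx
    let P : ℂ[X] := ∑ k, C (x k) * ∏ l ∈ Finset.univ.erase k, (1 - C (conj (a l)) * X)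
    have hPe : ∀ y, P.eval y = ∑ k, x k * ∏ l ∈ Finset.univ.erase k, (1 - conj (a l) * y) := by
      intro y
      simp [P, eval_finsetSum, eval_prod]
    have hP0 : P = 0 := by
      rcases Nat.eq_zero_or_pos m with rfl | hm
      · simp [P]
      refine eq_zero_of_natDegree_lt_card_of_eval_eq_zero P htinj (fun i => ?_) ?_
      · have h1 := congrFun hx i
        simp only [Matrix.coe_mulVecLin, Matrix.mulVec, dotProduct, A, Matrix.of_apply,
          Pi.zero_apply] at h1
        rw [hPe]
        have h2 : ∑ k, x k * ∏ l ∈ Finset.univ.erase k, (1 - conj (a l) * t i) =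
            (∏ l, (1 - conj (a l) * t i)) * ∑ k, (1 - t i * conj (a k))⁻¹ * x k := by
          rw [Finset.mul_sum]
          refine Finset.sum_congr rfl fun k _ => ?_
          rw [← Finset.mul_prod_erase _ _ (Finset.mem_univ k)]
          have := hd i k
          field_simp
          simp only [mul_comm (t i)]
        rw [h2, h1, mul_zero]
      · have hdeg : P.natDegree ≤ m - 1 := by
          refine natDegree_sum_le_of_forall_le _ _ fun k _ => ?_
          refine (natDegree_C_mul_le _ _).trans ((natDegree_prod_le _ _).trans ?_)
          calc _ ≤ ∑ l ∈ Finset.univ.erase k, 1 := by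
                refine Finset.sum_le_sum fun l _ => ?_
                refine (natDegree_sub_le _ _).trans ?_
                simp only [natDegree_one, zero_max]
                exact (natDegree_C_mul_le _ _).trans natDegree_X_le
            _ = m - 1 := by simp [Finset.card_erase_of_mem]
        rw [Fintype.card_fin]; omega
    ext k
    have h1 : P.eval (a k) = 0 := by rw [hP0, eval_zero]
    rw [hPe, Finset.sum_eq_single k] at h1
    · refine (mul_eq_zero.mp h1).resolve_right ?_
      refine Finset.prod_ne_zero_iff.mpr ?_
      intro l hl h
      have h2 : a l = a k := by linear_combination a l * h + a k * haa l
      exact (Finset.mem_erase.mp hl).1 (ha' h2)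
    · intro j _ hj
      rw [Finset.prod_eq_zero (i := k), mul_zero]
      · exact Finset.mem_erase.mpr ⟨hj.symm, Finset.mem_univ _⟩
      · rw [mul_comm, haa, sub_self]
    · simp
  have hu := Matrix.mulVec_injective_iff_isUnit.mp hinj
  refine ⟨t, A⁻¹, ht, fun x k => ?_⟩
  have h1 : A⁻¹.mulVec (A.mulVec x) = x := by
    rw [Matrix.mulVec_mulVec, Matrix.nonsing_inv_mul _ ((Matrix.isUnit_iff_isUnit_det A).mp hu),
      Matrix.one_mulVec]
  have h2 := congrFun h1 k
  rw [← h2]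
  simp only [Matrix.mulVec, dotProduct, A, Matrix.of_apply]
  simp [div_eq_mul_inv, mul_comm]

/-- Orthogonal polynomials on the circle for a weight with finitely many algebraic singularities,
whose reversed polynomials converge in the disk. -/
structure SingularSystem (m : ℕ) extends OrthoSystem where
  a : Fin m → ℂ
  norm_a : ∀ k, ‖a k‖ = 1
  a_inj : Function.Injective a
  β : Fin m → ℝ
  ν : ℝ
  ν_pos : 0 < ν
  ν_le : ∀ n, ν ≤ toOrthoSystem.N n
  F : ℂ → ℂ
  F_diff : DifferentiableOn ℂ F (ball 0 1)
  F_ne : ∀ z : ℂ, ‖z‖ < 1 → F z ≠ 0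
  F_lim : ∀ r < (1 : ℝ), TendstoUniformlyOn (fun n z => (toOrthoSystem.Φs n).eval z) F atTop
    (closedBall 0 r)
  c : ℕ → ℂ
  v : C(Circle, ℂ)
  hasSum_v : HasSum (fun m : ℕ => c m • ζ ^ (m + 1) - conj (c m) • star (ζ ^ (m + 1))) v
  star_v : star v = -v
  Cv : ℝ
  s : ℝ
  s_nonneg : 0 ≤ s
  s_lt : s < 1
  c_le : ∀ m, ‖c m‖ ≤ Cv * s ^ m
  p : ℂ → ℂ
  p_cont : ContinuousOn p (ball 0 1)
  hasSum_p : ∀ z : ℂ, ‖z‖ < 1 → HasSum (fun m => c m * z ^ m) (p z)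
  deriv_F : ∀ z : ℂ, ‖z‖ < 1 →
    deriv F z = F z * (-p z + ∑ k, β k * conj (a k) / (1 - z * conj (a k)))
  ibp : ∀ (n : ℕ) (Q : ℂ[X]), Q.degree < n → (∀ k, Q.eval (a k) = 0) →
    toOrthoSystem.ip (ζ * circleEval (derivative (Φ n)) + v * circleEval (Φ n)) (circleEval Q) = 0

namespace SingularSystem

variable {m : ℕ} (S : SingularSystem m)

lemma isO_Φs : UBigO 0 fun n z => (S.Φs n).eval z := by
  intro r hr
  obtain ⟨C, hC⟩ := (isCompact_closedBall (0 : ℂ) r).exists_bound_of_continuousOn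
    (S.F_diff.continuousOn.mono (closedBall_subset_ball hr))
  refine ⟨|C| + 1, by positivity, ?_⟩
  filter_upwards [Metric.tendstoUniformlyOn_iff.mp (S.F_lim r hr) 1 zero_lt_one] with n hn z hz
  have hz' : z ∈ closedBall (0 : ℂ) r := by simpa using hz
  have h1 := hn z hz'
  rw [dist_eq_norm] at h1
  have h2 := hC z hz'
  have h3 := norm_sub_norm_le ((S.Φs n).eval z) (F S z)
  rw [norm_sub_rev] at h3
  simp only [pow_zero, inv_one, mul_one]
  linarith [le_abs_self C]

lemma norm_Φ_le (n : ℕ) {z : ℂ} (hz : ‖z‖ < 1) : ‖(S.Φ n).eval z‖ ≤ ‖(S.Φs n).eval z‖ := by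
  have h := S.sq_nrm_K n z
  have h1 : 0 ≤ 1 - ‖z‖ ^ 2 := by nlinarith [norm_nonneg z]
  refine (pow_le_pow_iff_left₀ (norm_nonneg _) (norm_nonneg _) two_ne_zero).mp ?_
  have h2 := mul_nonneg (mul_nonneg (S.N_pos n).le h1) (sq_nonneg (S.nrm (circleEval (S.K n z))))
  linarith

lemma isO_Φ_zero : UBigO 0 fun n z => (S.Φ n).eval z :=
  S.isO_Φs.of_norm_le (Eventually.of_forall fun n _ hz => S.norm_Φ_le n hz)

lemma tendsto_Φs {z : ℂ} (hz : ‖z‖ < 1) :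
    Tendsto (fun n => (S.Φs n).eval z) atTop (nhds (S.F z)) :=
  (S.F_lim ‖z‖ hz).tendsto_at (by simp)

lemma tendsto_Φ {z : ℂ} (hz : ‖z‖ < 1) : Tendsto (fun n => (S.Φ n).eval z) atTop (nhds 0) := by
  have hz1 : 0 < 1 - ‖z‖ ^ 2 := by nlinarith [norm_nonneg z]
  obtain ⟨C, hC, H⟩ := S.isO_Φs ‖z‖ hz
  obtain ⟨n₀, H⟩ := eventually_atTop.mp H
  have hK : ∀ n, ((S.K n z).eval z).re = ∑ j ∈ Finset.range n, ‖(S.Φ j).eval z‖ ^ 2 / S.N j := by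
    intro n
    rw [OrthoSystem.K, eval_finsetSum, Complex.re_sum]
    refine Finset.sum_congr rfl fun j _ => ?_
    rw [eval_mul, eval_C, div_mul_eq_mul_div, mul_comm, Complex.mul_conj, Complex.normSq_eq_norm_sq,
      ← Complex.ofReal_div, Complex.ofReal_re]
  have hsum : Summable fun j => ‖(S.Φ j).eval z‖ ^ 2 / S.N j := by
    refine summable_of_sum_range_le (c := C ^ 2 / (S.ν * (1 - ‖z‖ ^ 2)))
      (fun j => div_nonneg (sq_nonneg _) (S.N_pos j).le) fun n => ?_
    have h0 : ∑ j ∈ Finset.range n, ‖(S.Φ j).eval z‖ ^ 2 / S.N j ≤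
        ∑ j ∈ Finset.range (n + n₀), ‖(S.Φ j).eval z‖ ^ 2 / S.N j :=
      Finset.sum_le_sum_of_subset_of_nonneg (Finset.range_mono (by omega))
        fun j _ _ => div_nonneg (sq_nonneg _) (S.N_pos j).le
    refine h0.trans ?_
    rw [← hK]
    have h1 := S.christoffel_darboux (n + n₀) z z
    have h2 := congrArg Complex.re h1
    rw [Complex.mul_conj, Complex.mul_conj, Complex.mul_conj, Complex.normSq_eq_norm_sq,
      Complex.normSq_eq_norm_sq, Complex.normSq_eq_norm_sq, ← Complex.ofReal_one,
      ← Complex.ofReal_sub, ← Complex.ofReal_mul, Complex.re_ofReal_mul, ← Complex.ofReal_sub,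
      Complex.ofReal_re] at h2
    have h3 := H (n + n₀) (by omega) z le_rfl
    simp only [pow_zero, inv_one, mul_one] at h3
    have h4 := pow_le_pow_left₀ (norm_nonneg _) h3 2
    rw [le_div_iff₀ (mul_pos S.ν_pos hz1)]
    have h5 : 0 ≤ ((S.K (n + n₀) z).eval z).re := by
      rw [hK]
      exact Finset.sum_nonneg fun j _ => div_nonneg (sq_nonneg _) (S.N_pos j).le
    have h6 := mul_le_mul_of_nonneg_right
      (mul_le_mul_of_nonneg_right (S.ν_le (n + n₀)) hz1.le) h5
    nlinarith [sq_nonneg ‖(S.Φ (n + n₀)).eval z‖]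
  have hlim := hsum.tendsto_atTop_zero
  have h2 : Tendsto (fun j => ‖(S.Φ j).eval z‖ ^ 2) atTop (nhds 0) := by
    refine squeeze_zero (fun _ => sq_nonneg _) (fun j => ?_)
      (by simpa using hlim.const_mul (S.N 0))
    rw [mul_div_assoc', le_div_iff₀ (S.N_pos j), mul_comm]
    exact mul_le_mul_of_nonneg_right (S.N_antitone (Nat.zero_le j)) (sq_nonneg _)
  have h3 := h2.sqrt
  simp only [Real.sqrt_sq (norm_nonneg _), Real.sqrt_zero] at h3
  exact tendsto_zero_iff_norm_tendsto_zero.mpr h3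

/-- The compressed product of the logarithmic derivative of the regular part of the weight with
the orthogonal polynomial. -/
noncomputable def V (n : ℕ) (z : ℂ) : ℂ :=
  S.ip (S.v * circleEval (S.Φ n)) (circleEval (S.K n z))

/-- The compressed product of the logarithmic derivative of the regular part of the weight with
the reversed orthogonal polynomial. -/
noncomputable def U (n : ℕ) (z : ℂ) : ℂ :=
  S.ip (S.v * (star ζ * circleEval (S.Φs n))) (circleEval (S.K n z))

lemma exists_uniform_bounds {k : ℕ} (h : UBigO k fun n z => (S.Φ n).eval z) {r : ℝ} (hr : r < 1) :
    ∃ q S0 M : ℝ, S.s < q ∧ q < 1 ∧ r < q ∧ 0 ≤ S0 ∧ 0 ≤ M ∧ ∀ᶠ n : ℕ in atTop, 0 < n ∧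
      (∀ x : ℂ, ‖x‖ ≤ q → ‖(S.Φs n).eval x‖ ≤ S0) ∧
      (∀ j ≥ n, ∀ x : ℂ, ‖x‖ ≤ q → ‖(S.Φ j).eval x‖ ≤ M * ((n : ℝ) ^ k)⁻¹) := by
  obtain ⟨q, hq, hq1⟩ := exists_between (max_lt S.s_lt hr)
  obtain ⟨S0, hS0, H⟩ := S.isO_Φs q hq1
  obtain ⟨M, hM, H'⟩ := h q hq1
  obtain ⟨n₀, H'⟩ := eventually_atTop.mp H'
  refine ⟨q, S0, M, (le_max_left _ _).trans_lt hq, hq1, (le_max_right _ _).trans_lt hq, hS0, hM, ?_⟩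
  filter_upwards [H, eventually_ge_atTop n₀, eventually_gt_atTop 0] with n h1 h2 h3
  refine ⟨h3, fun x hx => by simpa using h1 x hx, fun j hj x hx => ?_⟩
  refine (H' j (h2.trans hj) x hx).trans (mul_le_mul_of_nonneg_left ?_ hM)
  have hn' : (0 : ℝ) < n := by exact_mod_cast h3
  exact inv_anti₀ (by positivity) (pow_le_pow_left₀ hn'.le (by exact_mod_cast hj) _)

lemma isO_V {k : ℕ} (h : UBigO k fun n z => (S.Φ n).eval z) : UBigO k S.V := by
  intro r hr
  obtain ⟨q, S0, M, hsq, hq1, hrq, hS0, hM, H⟩ := S.exists_uniform_bounds h hr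
  refine ⟨|2 * S.Cv * ((S.N 0 / S.ν + 1 + √S.bd * (S0 / √(S.ν * (1 - r ^ 2))) + (1 - r / q)⁻¹) *
    M / q) * ∑' m : ℕ, (m + 2) * (S.s / q) ^ m|, abs_nonneg _, ?_⟩
  filter_upwards [H] with n hn z hz
  refine (S.norm_ip_v_Φ_le S.hasSum_v S.s_nonneg hsq hq1 hrq S.c_le S.ν_pos S.ν_le n hn.2.1
    hn.2.2 z hz).trans ?_
  refine le_trans (le_of_eq ?_) (mul_le_mul_of_nonneg_right (le_abs_self _) (by positivity))
  ring

lemma isO_U_sub {k : ℕ} (h : UBigO k fun n z => (S.Φ n).eval z) :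
    UBigO k fun n z => S.U n z - S.p z * (S.Φs n).eval z := by
  intro r hr
  obtain ⟨q, S0, M, hsq, hq1, hrq, hS0, hM, H⟩ := S.exists_uniform_bounds h hr
  refine ⟨|2 * S.Cv * ((S.N 0 / S.ν + √S.bd * √(S.N 0) * (2 * S0 / (S.ν * (q - r)))) * M / q) *
        ∑' m : ℕ, (m + 2) * (S.s / q) ^ m|, abs_nonneg _, ?_⟩
  filter_upwards [H] with n hn z hz
  refine (S.norm_ip_v_Φs_sub_le S.hasSum_v S.s_nonneg hsq hq1 hrq S.c_le S.ν_pos S.ν_le n hn.1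
    hn.2.1 hn.2.2 z hz (S.hasSum_p z (hz.trans_lt hr))).trans ?_
  refine le_trans (le_of_eq ?_) (mul_le_mul_of_nonneg_right (le_abs_self _) (by positivity))
  ring

lemma isO_deriv {k : ℕ} {P : ℕ → ℂ[X]} (h : UBigO k fun n z => (P n).eval z) :
    UBigO k fun n z => (derivative (P n)).eval z :=
  (h.deriv fun n => (P n).differentiable.differentiableOn).congr fun n z _ => by
    simp [Polynomial.deriv]

lemma one_sub_ne (k : Fin m) {z : ℂ} (hz : ‖z‖ < 1) : 1 - z * conj (S.a k) ≠ 0 := by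
  intro h
  have := congrArg norm (sub_eq_zero.mp h)
  rw [norm_one, norm_mul, Complex.norm_conj, S.norm_a, mul_one] at this
  linarith

lemma continuousOn_pole (k : Fin m) :
    ContinuousOn (fun z => (1 - z * conj (S.a k))⁻¹) (ball 0 1) :=
  ContinuousOn.inv₀ (by fun_prop) fun z hz => S.one_sub_ne k (by simpa using hz)

lemma norm_u (n : ℕ) {x : ℂ} (hx : ‖x‖ = 1) : ‖S.u n x‖ = 1 := by
  have h := S.eval_Φs_circle n x hx
  have h0 := S.eval_Φs_ne_zero n x hx
  have h1 : ‖(S.Φs n).eval x‖ = ‖(S.Φ n).eval x‖ := by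
    rw [h, norm_mul, norm_pow, hx, Complex.norm_conj]; simp
  rw [OrthoSystem.u, norm_div, ← h1, div_self (norm_ne_zero_iff.mpr h0)]

lemma isO_u (k : Fin m) : UBigO 0 fun n _ => S.u n (S.a k) :=
  UBigO.of_bounded (C := 1) (Eventually.of_forall fun n => by simp [S.norm_u n (S.norm_a k)])

/-- The residues in the differential relations. -/
lemma exists_residues : ∃ x : ℕ → Fin m → ℂ, ∀ᶠ n : ℕ in atTop, ∀ z : ℂ, ‖z‖ < 1 →
    (derivative (S.Φs n)).eval z + S.U n z =
        ∑ k, x n k * (((S.Φs n).eval z - conj (S.u n (S.a k)) * (S.Φ n).eval z) *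
          (1 - z * conj (S.a k))⁻¹) ∧
      n * (S.Φ n).eval z = z * (derivative (S.Φ n)).eval z + S.V n z +
        ∑ k, conj (x n k) * (conj (S.a k) * S.u n (S.a k)) *
          (((S.Φs n).eval z - conj (S.u n (S.a k)) * (S.Φ n).eval z) *
            (1 - z * conj (S.a k))⁻¹) := by
  have h : ∀ n : ℕ, ∃ x : Fin m → ℂ, 0 < n → m ≤ n → ∀ z : ℂ, ‖z‖ < 1 → _ := fun n => by
    by_cases hn : 0 < n ∧ m ≤ n
    · obtain ⟨x, hx⟩ := S.exists_structure_relation S.a S.norm_a S.a_inj S.v S.star_v hn.1 hn.2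
        (S.ibp n)
      exact ⟨x, fun _ _ => hx⟩
    · exact ⟨0, fun h1 h2 => (hn ⟨h1, h2⟩).elim⟩
  choose x hx using h
  refine ⟨x, ?_⟩
  filter_upwards [eventually_gt_atTop 0, eventually_ge_atTop m] with n h1 h2 z hz
  have h := hx n h1 h2 z hz
  simp only [div_eq_mul_inv] at h
  exact h

end SingularSystem

/-- Bounded solutions of a convergent family of linear systems. -/
lemma bounded_of_perturbed {m : ℕ} (B A : Matrix (Fin m) (Fin m) ℂ)
    (hB : ∀ (x : Fin m → ℂ) (k : Fin m), ∑ i, B k i * ∑ j, A i j * x j = x k)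
    (x : ℕ → Fin m → ℂ) (E : ℕ → Fin m → Fin m → ℂ)
    (hE : ∀ i j, Tendsto (fun n => E n i j) atTop (nhds 0)) {D : ℝ}
    (hD : ∀ᶠ n in atTop, ∀ i, ‖∑ j, (A i j + E n i j) * x n j‖ ≤ D) :
    ∃ C, ∀ᶠ n in atTop, ∀ k, ‖x n k‖ ≤ C := by
  have hlim : Tendsto (fun n => ∑ k, ∑ i, ‖B k i‖ * ∑ j, ‖E n i j‖) atTop (nhds 0) := by
    have : Tendsto (fun n => ∑ k, ∑ i, ‖B k i‖ * ∑ j, ‖E n i j‖) atTop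
        (nhds (∑ k : Fin m, ∑ i : Fin m, ‖B k i‖ * ∑ _j : Fin m, ‖(0 : ℂ)‖)) :=
      tendsto_finsetSum _ fun k _ => tendsto_finsetSum _ fun i _ =>
        (tendsto_finsetSum _ fun j _ => (hE i j).norm).const_mul _
    simpa using this
  refine ⟨2 * ∑ k, ∑ i, ‖B k i‖ * D, ?_⟩
  filter_upwards [hD, hlim.eventually (gt_mem_nhds (show (0 : ℝ) < 1 / 2 by norm_num))]
    with n h1 h2
  set X := ∑ k, ‖x n k‖ with hX
  have hXle : ∀ k, ‖x n k‖ ≤ X := fun k =>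
    Finset.single_le_sum (fun j _ => norm_nonneg (x n j)) (Finset.mem_univ k)
  have hX0 : 0 ≤ X := Finset.sum_nonneg fun j _ => norm_nonneg _
  have hk : ∀ k, ‖x n k‖ ≤ ∑ i, ‖B k i‖ * D + (∑ i, ‖B k i‖ * ∑ j, ‖E n i j‖) * X := by
    intro k
    rw [← hB (x n) k, Finset.sum_mul, ← Finset.sum_add_distrib]
    refine (norm_sum_le _ _).trans (Finset.sum_le_sum fun i _ => ?_)
    rw [norm_mul, mul_assoc, ← mul_add]
    refine mul_le_mul_of_nonneg_left ?_ (norm_nonneg _)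
    have e : ∑ j, A i j * x n j = ∑ j, (A i j + E n i j) * x n j - ∑ j, E n i j * x n j := by
      rw [← Finset.sum_sub_distrib]
      exact Finset.sum_congr rfl fun j _ => by ring
    rw [e]
    refine (norm_sub_le _ _).trans (add_le_add (h1 i) ?_)
    rw [Finset.sum_mul]
    refine (norm_sum_le _ _).trans (Finset.sum_le_sum fun j _ => ?_)
    rw [norm_mul]
    exact mul_le_mul_of_nonneg_left (hXle j) (norm_nonneg _)
  have hXs : X ≤ ∑ k, ∑ i, ‖B k i‖ * D + (∑ k, ∑ i, ‖B k i‖ * ∑ j, ‖E n i j‖) * X := by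
    rw [Finset.sum_mul, ← Finset.sum_add_distrib]
    exact Finset.sum_le_sum fun k _ => hk k
  intro k
  refine (hXle k).trans ?_
  nlinarith

namespace SingularSystem

variable {m : ℕ} (S : SingularSystem m)

lemma isO_U_zero : UBigO 0 S.U :=
  ((S.isO_U_sub S.isO_Φ_zero).add (S.isO_Φs.fun_mul S.p_cont)).congr fun n z _ => by ring

lemma isO_residues_zero {x : ℕ → Fin m → ℂ}
    (hx : ∀ᶠ n : ℕ in atTop, ∀ z : ℂ, ‖z‖ < 1 → (derivative (S.Φs n)).eval z + S.U n z =
        ∑ k, x n k * (((S.Φs n).eval z - conj (S.u n (S.a k)) * (S.Φ n).eval z) *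
          (1 - z * conj (S.a k))⁻¹)) (k : Fin m) : UBigO 0 fun n _ => x n k := by
  obtain ⟨t, B, ht, hB⟩ := exists_inverse_simple_fractions S.a S.norm_a S.a_inj
  have hR : UBigO 0 fun n z => (derivative (S.Φs n)).eval z + S.U n z :=
    (isO_deriv S.isO_Φs).add S.isO_U_zero
  have hR' : ∀ i, ∃ D, ∀ᶠ n in atTop,
      ‖(S.F (t i))⁻¹ * ((derivative (S.Φs n)).eval (t i) + S.U n (t i))‖ ≤ D := by
    intro i
    obtain ⟨D, _, hD⟩ := ((hR.eval (ht i)).const_mul (S.F (t i))⁻¹).exists_scalar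
    exact ⟨D, by simpa using hD⟩
  choose D hD using hR'
  have hE : ∀ i j, Tendsto (fun n => ((S.F (t i))⁻¹ * ((S.Φs n).eval (t i) - S.F (t i)) -
      (S.F (t i))⁻¹ * (conj (S.u n (S.a j)) * (S.Φ n).eval (t i))) * (1 - t i * conj (S.a j))⁻¹)
      atTop (nhds 0) := by
    intro i j
    have h1 : Tendsto (fun n => (S.F (t i))⁻¹ * ((S.Φs n).eval (t i) - S.F (t i))) atTop
        (nhds 0) := by
      simpa using ((S.tendsto_Φs (ht i)).sub_const (S.F (t i))).const_mul (S.F (t i))⁻¹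
    have h2 : Tendsto (fun n => conj (S.u n (S.a j)) * (S.Φ n).eval (t i)) atTop (nhds 0) := by
      rw [tendsto_zero_iff_norm_tendsto_zero]
      simp only [norm_mul, Complex.norm_conj, S.norm_u _ (S.norm_a j), one_mul]
      exact tendsto_zero_iff_norm_tendsto_zero.mp (S.tendsto_Φ (ht i))
    simpa using (h1.sub (h2.const_mul (S.F (t i))⁻¹)).mul_const (1 - t i * conj (S.a j))⁻¹
  have hDs : ∀ᶠ n in atTop, ∀ i, ‖∑ j, ((1 - t i * conj (S.a j))⁻¹ +
      ((S.F (t i))⁻¹ * ((S.Φs n).eval (t i) - S.F (t i)) -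
      (S.F (t i))⁻¹ * (conj (S.u n (S.a j)) * (S.Φ n).eval (t i))) *
        (1 - t i * conj (S.a j))⁻¹) * x n j‖ ≤ ∑ i, |D i| := by
    have hDa : ∀ᶠ n in atTop, ∀ i,
        ‖(S.F (t i))⁻¹ * ((derivative (S.Φs n)).eval (t i) + S.U n (t i))‖ ≤ D i :=
      eventually_all.mpr hD
    filter_upwards [hDa, hx] with n h1 h2 i
    have h3 := h1 i
    rw [h2 (t i) (ht i), Finset.mul_sum] at h3
    have h4 : D i ≤ ∑ i, |D i| := (le_abs_self _).trans
      (Finset.single_le_sum (fun j _ => abs_nonneg (D j)) (Finset.mem_univ i))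
    refine le_trans (le_of_eq ?_) (h3.trans h4)
    congr 1
    refine Finset.sum_congr rfl fun j _ => ?_
    have hF := S.F_ne (t i) (ht i)
    field_simp
    ring
  obtain ⟨C, hC⟩ := bounded_of_perturbed B
    (Matrix.of fun i j => (1 - t i * conj (S.a j))⁻¹)
    (fun y k => by simpa [div_eq_mul_inv, mul_comm] using hB y k) x _ hE hDs
  exact UBigO.of_bounded (C := C) (by filter_upwards [hC] with n h; simpa using h k)

lemma isO_difference {k : ℕ} (hs : UBigO k fun n z => (S.Φs n).eval z - S.F z)
    (h : UBigO k fun n z => (S.Φ n).eval z) (j : Fin m) :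
    UBigO k fun n z => ((S.Φs n).eval z - conj (S.u n (S.a j)) * (S.Φ n).eval z - S.F z) *
      (1 - z * conj (S.a j))⁻¹ := by
  have h1 : UBigO k fun n z => conj (S.u n (S.a j)) * (S.Φ n).eval z := by
    simpa using (S.isO_u j).conj_scalar.mul h
  exact ((hs.sub h1).fun_mul (S.continuousOn_pole j)).congr fun n z _ => by ring

lemma isO_Φs_sub_zero : UBigO 0 fun n z => (S.Φs n).eval z - S.F z :=
  S.isO_Φs.sub (UBigO.of_continuousOn S.F_diff.continuousOn)

lemma isO_one_of_natCast_mul {k : ℕ} {g : ℕ → ℂ → ℂ} (h : UBigO k fun n z => (n : ℂ) * g n z) :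
    UBigO (k + 1) g := by
  refine ((h.mul UBigO.inv_natCast).congr' ?_)
  filter_upwards [eventually_gt_atTop 0] with n hn z _
  have : (n : ℂ) ≠ 0 := by exact_mod_cast hn.ne'
  field_simp

lemma isO_Φ : UBigO 1 fun n z => (S.Φ n).eval z := by
  obtain ⟨x, hx⟩ := S.exists_residues
  have hx0 := S.isO_residues_zero (x := x) (by
    filter_upwards [hx] with n h z hz using (h z hz).1)
  refine isO_one_of_natCast_mul (k := 0) ?_
  have h1 : UBigO 0 fun n z => z * (derivative (S.Φ n)).eval z :=
    (isO_deriv S.isO_Φ_zero).fun_mul continuousOn_id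
  have h2 : UBigO 0 fun n z => ∑ k, conj (x n k) * (conj (S.a k) * S.u n (S.a k)) *
      (((S.Φs n).eval z - conj (S.u n (S.a k)) * (S.Φ n).eval z) *
        (1 - z * conj (S.a k))⁻¹) := by
    refine UBigO.sum _ fun k _ => ?_
    have h3 : UBigO 0 fun n z => ((S.Φs n).eval z - conj (S.u n (S.a k)) * (S.Φ n).eval z) *
        (1 - z * conj (S.a k))⁻¹ := by
      refine ((S.isO_difference S.isO_Φs_sub_zero S.isO_Φ_zero k).add
        (UBigO.of_continuousOn (S.F_diff.continuousOn.mul (S.continuousOn_pole k)))).congr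
          fun n z _ => ?_
      simp only [Pi.mul_apply]
      ring
    exact ((hx0 k).conj_scalar.mul ((S.isO_u k).const_mul (conj (S.a k)))).mul h3
  refine ((h1.add (S.isO_V S.isO_Φ_zero)).add h2).congr' ?_
  filter_upwards [hx] with n h z hz using (h z hz).2

lemma isO_b : UBigO 1 fun n _ => S.b n :=
  S.isO_Φ.succ.eval (w := 0) (by simp)

lemma isO_increment : UBigO 2 fun n z => (S.Φs (n + 1)).eval z - (S.Φs n).eval z := by
  have h1 : UBigO 1 fun n z => z * (S.Φ n).eval z := S.isO_Φ.fun_mul continuousOn_id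
  refine (S.isO_b.conj_scalar.mul h1).congr fun n z _ => ?_
  rw [S.Φs_succ]
  simp

lemma isO_Φs_sub : UBigO 1 fun n z => (S.Φs n).eval z - S.F z :=
  UBigO.of_increment (k := 0) (fun _ hz => S.tendsto_Φs hz) S.isO_increment

lemma isO_residues_sub {x : ℕ → Fin m → ℂ}
    (hx : ∀ᶠ n : ℕ in atTop, ∀ z : ℂ, ‖z‖ < 1 → (derivative (S.Φs n)).eval z + S.U n z =
        ∑ k, x n k * (((S.Φs n).eval z - conj (S.u n (S.a k)) * (S.Φ n).eval z) *
          (1 - z * conj (S.a k))⁻¹)) (k : Fin m) :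
    UBigO 1 fun n _ => x n k - S.β k * conj (S.a k) := by
  obtain ⟨t, B, ht, hB⟩ := exists_inverse_simple_fractions S.a S.norm_a S.a_inj
  have hx0 := S.isO_residues_zero hx
  have h1 : UBigO 1 fun n z => (derivative (S.Φs n)).eval z - deriv S.F z := by
    refine (S.isO_Φs_sub.deriv fun n => ?_).congr fun n z hz => ?_
    · exact (S.Φs n).differentiable.differentiableOn.sub S.F_diff
    · have hz' : z ∈ ball (0 : ℂ) 1 := by simpa using hz
      rw [deriv_fun_sub (S.Φs n).differentiableAt
        (S.F_diff.differentiableAt (isOpen_ball.mem_nhds hz')), Polynomial.deriv]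
  have h2 : UBigO 1 fun n z => S.U n z - S.p z * S.F z :=
    ((S.isO_U_sub S.isO_Φ).add (S.isO_Φs_sub.fun_mul S.p_cont)).congr fun n z _ => by ring
  have h3 : UBigO 1 fun n z => ∑ k, x n k *
      (((S.Φs n).eval z - conj (S.u n (S.a k)) * (S.Φ n).eval z - S.F z) *
        (1 - z * conj (S.a k))⁻¹) :=
    UBigO.sum _ fun k _ => by
      simpa using (hx0 k).mul (S.isO_difference S.isO_Φs_sub S.isO_Φ k)
  have h4 : UBigO 1 fun n z => S.F z *
      ∑ k, (x n k - S.β k * conj (S.a k)) / (1 - z * conj (S.a k)) := by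
    refine ((h1.add h2).sub h3).congr' ?_
    filter_upwards [hx] with n hn z hz
    have e1 := hn z hz
    rw [S.deriv_F z hz]
    have e2 : ∑ k, x n k *
        (((S.Φs n).eval z - conj (S.u n (S.a k)) * (S.Φ n).eval z - S.F z) *
          (1 - z * conj (S.a k))⁻¹) = ∑ k, x n k *
        (((S.Φs n).eval z - conj (S.u n (S.a k)) * (S.Φ n).eval z) *
          (1 - z * conj (S.a k))⁻¹) - S.F z * ∑ k, x n k / (1 - z * conj (S.a k)) := by
      rw [Finset.mul_sum, ← Finset.sum_sub_distrib]
      exact Finset.sum_congr rfl fun k _ => by ring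
    rw [e2, ← e1]
    simp only [sub_div, Finset.sum_sub_distrib]
    ring
  have h5 : UBigO 1 fun n _ => ∑ i, B k i * ((S.F (t i))⁻¹ * (S.F (t i) *
      ∑ j, (x n j - S.β j * conj (S.a j)) / (1 - t i * conj (S.a j)))) :=
    UBigO.sum _ fun i _ => ((h4.eval (ht i)).const_mul _).const_mul _
  refine h5.congr fun n _ _ => ?_
  rw [← hB (fun j => x n j - S.β j * conj (S.a j)) k]
  refine Finset.sum_congr rfl fun i _ => ?_
  rw [inv_mul_cancel_left₀ (S.F_ne _ (ht i))]

/-- The leading asymptotics of the orthogonal polynomials inside the disk. -/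
lemma isO_natCast_mul_Φ_sub : UBigO 1 fun n z => n * (S.Φ n).eval z -
    S.F z * ∑ k, S.β k * S.u n (S.a k) * (1 - z * conj (S.a k))⁻¹ := by
  obtain ⟨x, hx⟩ := S.exists_residues
  have hx1 : ∀ᶠ n : ℕ in atTop, ∀ z : ℂ, ‖z‖ < 1 → (derivative (S.Φs n)).eval z + S.U n z =
        ∑ k, x n k * (((S.Φs n).eval z - conj (S.u n (S.a k)) * (S.Φ n).eval z) *
          (1 - z * conj (S.a k))⁻¹) := by
    filter_upwards [hx] with n h z hz using (h z hz).1
  have hx0 := S.isO_residues_zero hx1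
  have hxs := S.isO_residues_sub hx1
  have h1 : UBigO 1 fun n z => z * (derivative (S.Φ n)).eval z :=
    (isO_deriv S.isO_Φ).fun_mul continuousOn_id
  have h2 : UBigO 1 fun n z => ∑ k, conj (x n k) * (conj (S.a k) * S.u n (S.a k)) *
      (((S.Φs n).eval z - conj (S.u n (S.a k)) * (S.Φ n).eval z - S.F z) *
        (1 - z * conj (S.a k))⁻¹) := by
    refine UBigO.sum _ fun k _ => ?_
    have := ((hx0 k).conj_scalar.mul ((S.isO_u k).const_mul (conj (S.a k)))).mul
      (S.isO_difference S.isO_Φs_sub S.isO_Φ k)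
    simpa using this
  have h3 : UBigO 1 fun n z => ∑ k, conj (x n k - S.β k * conj (S.a k)) *
      (conj (S.a k) * S.u n (S.a k)) * (S.F z * (1 - z * conj (S.a k))⁻¹) := by
    refine UBigO.sum _ fun k _ => ?_
    have := ((hxs k).conj_scalar.mul ((S.isO_u k).const_mul (conj (S.a k)))).mul
      (UBigO.of_continuousOn (S.F_diff.continuousOn.mul (S.continuousOn_pole k)))
    simpa using this
  refine (((h1.add (S.isO_V S.isO_Φ)).add h2).add h3).congr' ?_
  filter_upwards [hx] with n hn z hz
  rw [(hn z hz).2]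
  have haa : ∀ k, S.a k * conj (S.a k) = 1 := fun k => by
    rw [Complex.mul_conj, Complex.normSq_eq_norm_sq, S.norm_a]; simp
  rw [add_assoc _ (Finset.sum _ _) (Finset.sum _ _), add_sub_assoc]
  congr 1
  rw [Finset.mul_sum, ← Finset.sum_sub_distrib, ← Finset.sum_add_distrib]
  refine Finset.sum_congr rfl fun k _ => ?_
  simp only [map_sub, map_mul, Complex.conj_conj, Complex.conj_ofReal]
  linear_combination (S.β k * S.u n (S.a k) * S.F z * (1 - z * conj (S.a k))⁻¹) * haa k

end SingularSystem

/-- Summation by parts for a sequence which is asymptotically geometric with ratio `μ ≠ 1`. -/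
lemma exists_increment_of_ne_one {μ : ℂ} (hμ : μ ≠ 1) {t : ℕ → ℂ} (ht : UBigO 0 fun n _ => t n)
    (ht' : UBigO 1 fun n _ => t (n + 1) - μ * t n) :
    ∃ r : ℕ → ℂ, (UBigO 2 fun n _ => r n) ∧
      UBigO 3 fun n _ => ((n : ℂ) ^ 2)⁻¹ * t n - (r (n + 1) - r n) := by
  have hμ' : μ - 1 ≠ 0 := sub_ne_zero.mpr hμ
  refine ⟨fun n => (μ - 1)⁻¹ * (((n : ℂ) ^ 2)⁻¹ * t n), ?_, ?_⟩
  · simpa using ((UBigO.inv_natCast_pow 2).mul ht).const_mul (μ - 1)⁻¹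
  · have h1 : UBigO 3 fun n _ => (μ - 1)⁻¹ * (((n : ℂ) ^ 2)⁻¹ * (t (n + 1) - μ * t n)) := by
      simpa using ((UBigO.inv_natCast_pow 2).mul ht').const_mul (μ - 1)⁻¹
    have h2 : UBigO 3 fun n _ => (((n : ℂ) ^ 2)⁻¹ * ((n + 1 : ℕ) : ℂ)⁻¹) *
        ((μ - 1)⁻¹ * (2 * t (n + 1))) := by
      simpa using ((UBigO.inv_natCast_pow 2).mul UBigO.inv_natCast.succ).mul
        ((ht.succ.const_mul 2).const_mul (μ - 1)⁻¹)
    have h3 : UBigO 3 fun n _ => (((n : ℂ) ^ 2)⁻¹ * (((n + 1 : ℕ) : ℂ)⁻¹ * ((n + 1 : ℕ) : ℂ)⁻¹)) *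
        ((μ - 1)⁻¹ * t (n + 1)) := by
      have := ((UBigO.inv_natCast_pow 2).mul (UBigO.inv_natCast.succ.mul UBigO.inv_natCast.succ)).mul
        (ht.succ.const_mul (μ - 1)⁻¹)
      exact this.mono (by norm_num)
    refine ((h2.sub h1).sub h3).congr' ?_
    filter_upwards [eventually_gt_atTop 0] with n hn z _
    have h0 : (n : ℂ) ≠ 0 := by exact_mod_cast hn.ne'
    have h0' : (n : ℂ) + 1 ≠ 0 := by exact_mod_cast n.succ_ne_zero
    push_cast
    field_simp
    ring

lemma isO_inv_sq_sub_increment :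
    UBigO 3 fun n _ => ((n : ℂ) ^ 2)⁻¹ - (-((n + 1 : ℕ) : ℂ)⁻¹ - -(n : ℂ)⁻¹) := by
  have h2 : UBigO 3 fun n _ => ((n : ℂ) ^ 2)⁻¹ * ((n + 1 : ℕ) : ℂ)⁻¹ :=
    (UBigO.inv_natCast_pow 2).mul UBigO.inv_natCast.succ
  refine h2.congr' ?_
  filter_upwards [eventually_gt_atTop 0] with n hn z _
  have h0 : (n : ℂ) ≠ 0 := by exact_mod_cast hn.ne'
  have h0' : (n : ℂ) + 1 ≠ 0 := by exact_mod_cast n.succ_ne_zero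
  push_cast
  field_simp
  ring

namespace SingularSystem

variable {m : ℕ} (S : SingularSystem m)

lemma isO_u_succ_sub (k : Fin m) :
    UBigO 1 fun n _ => S.u (n + 1) (S.a k) - S.a k * S.u n (S.a k) := by
  have h : UBigO 1 fun n _ => S.b n -
      conj (S.b n) * (S.a k * (S.u n (S.a k) * S.u (n + 1) (S.a k))) := by
    refine S.isO_b.sub ?_
    simpa using S.isO_b.conj_scalar.mul
      (((S.isO_u k).mul (S.isO_u k).succ).const_mul (S.a k))
  refine h.congr fun n z _ => ?_
  have h0 := S.eval_Φs_ne_zero n _ (S.norm_a k)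
  have h1 := S.eval_Φs_ne_zero (n + 1) _ (S.norm_a k)
  have e : (S.Φs (n + 1)).eval (S.a k) =
      (S.Φs n).eval (S.a k) + conj (S.b n) * (S.a k * (S.Φ n).eval (S.a k)) := by
    rw [S.Φs_succ]; simp
  have e' : (S.Φ (n + 1)).eval (S.a k) =
      S.a k * (S.Φ n).eval (S.a k) + S.b n * (S.Φs n).eval (S.a k) := by
    rw [S.Φ_succ]; simp
  simp only [OrthoSystem.u]
  field_simp
  rw [e, e']
  ring

lemma conj_mul_self_u (n : ℕ) (k : Fin m) : conj (S.u n (S.a k)) * S.u n (S.a k) = 1 := by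
  rw [mul_comm, Complex.mul_conj, Complex.normSq_eq_norm_sq, S.norm_u n (S.norm_a k)]
  simp

lemma mul_conj_a (k : Fin m) : S.a k * conj (S.a k) = 1 := by
  rw [Complex.mul_conj, Complex.normSq_eq_norm_sq, S.norm_a]; simp

lemma exists_increment (l k : Fin m) : ∃ r : ℕ → ℂ,
    (UBigO 2 fun n _ => r n + (if l = k then 1 else 0) * (n : ℂ)⁻¹) ∧
    UBigO 3 fun n _ => ((n : ℂ) ^ 2)⁻¹ * (conj (S.u n (S.a l)) * S.u n (S.a k)) -
      (r (n + 1) - r n) := by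
  by_cases hlk : l = k
  · subst hlk
    refine ⟨fun n => -(n : ℂ)⁻¹, ?_, ?_⟩
    · simpa using UBigO.zero
    · simpa [S.conj_mul_self_u] using isO_inv_sq_sub_increment
  · have hμ : conj (S.a l) * S.a k ≠ 1 := by
      intro h
      apply hlk
      apply S.a_inj
      linear_combination (-S.a l) * h + S.a k * S.mul_conj_a l
    have ht : UBigO 0 fun n _ => conj (S.u n (S.a l)) * S.u n (S.a k) :=
      (S.isO_u l).conj_scalar.mul (S.isO_u k)
    have ht' : UBigO 1 fun n _ => conj (S.u (n + 1) (S.a l)) * S.u (n + 1) (S.a k) -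
        conj (S.a l) * S.a k * (conj (S.u n (S.a l)) * S.u n (S.a k)) := by
      have h1 := (S.isO_u_succ_sub l).conj_scalar.mul (S.isO_u k).succ
      have h2 := ((S.isO_u l).conj_scalar.const_mul (conj (S.a l))).mul (S.isO_u_succ_sub k)
      refine (h1.add (h2.mono (by norm_num))).congr fun n z _ => ?_
      simp only [map_sub, map_mul]
      ring
    obtain ⟨r, h1, h2⟩ := exists_increment_of_ne_one hμ ht ht'
    exact ⟨r, by simpa [hlk] using h1, h2⟩

lemma F_zero : S.F 0 = 1 := by
  have h := S.tendsto_Φs (z := 0) (by simp)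
  simp only [← coeff_zero_eq_eval_zero, S.Φs_coeff_zero] at h
  exact tendsto_nhds_unique h tendsto_const_nhds

lemma isO_natCast_mul_b_sub :
    UBigO 1 fun n _ => n * S.b n - ∑ l, S.β l * (S.a l * S.u n (S.a l)) := by
  have h1 := S.isO_natCast_mul_Φ_sub.succ.eval (w := 0) (by simp)
  have h2 : UBigO 1 fun n _ => ∑ l, S.β l * (S.u (n + 1) (S.a l) - S.a l * S.u n (S.a l)) :=
    UBigO.sum _ fun l _ => (S.isO_u_succ_sub l).const_mul _
  refine ((h1.add h2).sub S.isO_b).congr fun n z _ => ?_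
  simp only [F_zero, mul_sub, Finset.sum_sub_distrib, OrthoSystem.b]
  simp
  ring

lemma isO_increment_sub : UBigO 3 fun n z => ((S.Φs (n + 1)).eval z - (S.Φs n).eval z) -
    ∑ l, ∑ k, (S.β l * conj (S.a l) * S.β k * (z * S.F z * (1 - z * conj (S.a k))⁻¹)) *
      (((n : ℂ) ^ 2)⁻¹ * (conj (S.u n (S.a l)) * S.u n (S.a k))) := by
  have hP : UBigO 0 fun n z => S.F z * ∑ k, S.β k * S.u n (S.a k) * (1 - z * conj (S.a k))⁻¹ := by
    refine UBigO.fun_mul (UBigO.sum _ fun k _ => ?_) S.F_diff.continuousOn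
    refine (((S.isO_u k).fun_mul (S.continuousOn_pole k)).const_mul (S.β k)).congr
      fun n z _ => by ring
  have hn : UBigO 0 fun n z => n * (S.Φ n).eval z :=
    ((S.isO_natCast_mul_Φ_sub.mono zero_le_one).add hP).congr fun n z _ => by ring
  have hB : UBigO 0 fun n _ => ∑ l, S.β l * (S.a l * S.u n (S.a l)) :=
    UBigO.sum _ fun l _ => ((S.isO_u l).const_mul _).const_mul _
  have h1 : UBigO 1 fun n z => conj (n * S.b n - ∑ l, S.β l * (S.a l * S.u n (S.a l))) *
      (z * (n * (S.Φ n).eval z)) := by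
    simpa using S.isO_natCast_mul_b_sub.conj_scalar.mul (hn.fun_mul continuousOn_id)
  have h2 : UBigO 1 fun n z => conj (∑ l, S.β l * (S.a l * S.u n (S.a l))) *
      (z * (n * (S.Φ n).eval z -
        S.F z * ∑ k, S.β k * S.u n (S.a k) * (1 - z * conj (S.a k))⁻¹)) := by
    simpa using hB.conj_scalar.mul (S.isO_natCast_mul_Φ_sub.fun_mul continuousOn_id)
  refine ((UBigO.inv_natCast_pow 2).mul (h1.add h2)).congr' ?_
  filter_upwards [eventually_gt_atTop 0] with n hn z _
  have h0 : (n : ℂ) ≠ 0 := by exact_mod_cast hn.ne'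
  have e1 : ∑ l, ∑ k, (S.β l * conj (S.a l) * S.β k * (z * S.F z * (1 - z * conj (S.a k))⁻¹)) *
      (((n : ℂ) ^ 2)⁻¹ * (conj (S.u n (S.a l)) * S.u n (S.a k))) =
      ((n : ℂ) ^ 2)⁻¹ * (conj (∑ l, S.β l * (S.a l * S.u n (S.a l))) *
        (z * (S.F z * ∑ k, S.β k * S.u n (S.a k) * (1 - z * conj (S.a k))⁻¹))) := by
    simp only [map_sum, map_mul, Complex.conj_ofReal, Finset.mul_sum, Finset.sum_mul]
    rw [Finset.sum_comm]
    exact Finset.sum_congr rfl fun k _ => Finset.sum_congr rfl fun l _ => by ring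
  have e2 : (S.Φs (n + 1)).eval z - (S.Φs n).eval z =
      ((n : ℂ) ^ 2)⁻¹ * (conj (n * S.b n) * (z * (n * (S.Φ n).eval z))) := by
    rw [S.Φs_succ]
    simp
    field_simp
  rw [e1, e2]
  simp only [map_sub]
  ring

/-- Second order asymptotics of the reversed orthogonal polynomials inside the disk. -/
theorem isO_Φs_sub_expansion : UBigO 2 fun n z => (S.Φs n).eval z -
    S.F z * (1 - (n : ℂ)⁻¹ * ∑ k, (S.β k : ℂ) ^ 2 *
      (z * conj (S.a k) * (1 - z * conj (S.a k))⁻¹)) := by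
  choose r hr2 hr3 using S.exists_increment
  set κ : Fin m → Fin m → ℂ → ℂ := fun l k z =>
    S.β l * conj (S.a l) * S.β k * (z * S.F z * (1 - z * conj (S.a k))⁻¹) with hκ
  have hκc : ∀ l k, ContinuousOn (κ l k) (ball 0 1) := fun l k =>
    continuousOn_const.mul ((continuousOn_id.mul S.F_diff.continuousOn).mul (S.continuousOn_pole k))
  have hinc : UBigO 3 fun n z => ((S.Φs (n + 1)).eval z - ∑ l, ∑ k, κ l k z * r l k (n + 1)) -
      ((S.Φs n).eval z - ∑ l, ∑ k, κ l k z * r l k n) := by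
    have h1 : UBigO 3 fun n z => ∑ l, ∑ k, κ l k z *
        (((n : ℂ) ^ 2)⁻¹ * (conj (S.u n (S.a l)) * S.u n (S.a k)) -
          (r l k (n + 1) - r l k n)) :=
      UBigO.sum _ fun l _ => UBigO.sum _ fun k _ => (hr3 l k).fun_mul (hκc l k)
    refine (S.isO_increment_sub.add h1).congr fun n z _ => ?_
    simp only [mul_sub, Finset.sum_sub_distrib, hκ]
    ring
  have hrlim : ∀ l k, Tendsto (r l k) atTop (nhds 0) := by
    intro l k
    have h1 : UBigO 1 fun n _ => r l k n :=
      (((hr2 l k).mono one_le_two).sub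
        (UBigO.inv_natCast.const_mul (if l = k then 1 else 0))).congr fun n z _ => by ring
    obtain ⟨C, -, hC⟩ := h1.exists_scalar
    refine squeeze_zero_norm' hC ?_
    simpa using (tendsto_inv_atTop_nhds_zero_nat (𝕜 := ℝ)).const_mul C
  have hlim : ∀ z : ℂ, ‖z‖ < 1 → Tendsto
      (fun n => (S.Φs n).eval z - ∑ l, ∑ k, κ l k z * r l k n) atTop (nhds (S.F z)) := by
    intro z hz
    have := (S.tendsto_Φs hz).sub (tendsto_finsetSum Finset.univ fun l _ =>
      tendsto_finsetSum Finset.univ fun k _ => (hrlim l k).const_mul (κ l k z))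
    simpa using this
  have h1 := UBigO.of_increment (k := 1) hlim hinc
  have h2 : UBigO 2 fun n z => ∑ l, ∑ k, κ l k z *
      (r l k n + (if l = k then 1 else 0) * (n : ℂ)⁻¹) :=
    UBigO.sum _ fun l _ => UBigO.sum _ fun k _ => (hr2 l k).fun_mul (hκc l k)
  refine (h1.add h2).congr fun n z _ => ?_
  have e : ∑ l, ∑ k, κ l k z * ((if l = k then 1 else 0) * (n : ℂ)⁻¹) = S.F z *
      ((n : ℂ)⁻¹ * ∑ k, (S.β k : ℂ) ^ 2 * (z * conj (S.a k) * (1 - z * conj (S.a k))⁻¹)) := by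
    simp only [ite_mul, zero_mul, one_mul, mul_ite, mul_zero, Finset.sum_ite_eq,
      Finset.mem_univ, if_true, hκ, Finset.mul_sum]
    exact Finset.sum_congr rfl fun k _ => by ring
  simp only [mul_add, Finset.sum_add_distrib, e]
  ring

end SingularSystem

lemma circleIntegrable_of_continuousOn_ball {E : Type*} [NormedAddCommGroup E] {f : ℂ → E}
    (hf : ContinuousOn f (ball 0 1)) {R : ℝ} (hR0 : 0 ≤ R) (hR : R < 1) :
    CircleIntegrable f 0 R :=
  ContinuousOn.circleIntegrable hR0 (hf.mono (sphere_subset_closedBall.trans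
    (closedBall_subset_ball hR)))

lemma diffContOnCl_of_differentiableOn_ball {f : ℂ → ℂ} (hf : DifferentiableOn ℂ f (ball 0 1))
    {R : ℝ} (hR0 : 0 ≤ R) (hR : R < 1) : DiffContOnCl ℂ f (ball 0 |R|) := by
  rw [abs_of_nonneg hR0]
  exact (hf.mono (closure_ball_subset_closedBall.trans (closedBall_subset_ball hR))).diffContOnCl

lemma sq_norm_le_circleAverage {g : ℂ → ℂ} (hg : DifferentiableOn ℂ g (ball 0 1)) {R r : ℝ}
    (hr : 0 ≤ r) (hrR : r < R) (hR : R < 1) {w : ℂ} (hw : ‖w‖ ≤ r) :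
    ‖g w‖ ^ 2 ≤ R / (R - r) * Real.circleAverage (fun z => ‖g z‖ ^ 2) 0 R := by
  have hR0 : 0 ≤ R := hr.trans hrR.le
  have h1 := (diffContOnCl_of_differentiableOn_ball (hg.pow 2) hR0 hR).circleAverage_smul_div
    (w := w) (by rw [abs_of_nonneg hR0]; simpa using hw.trans_lt hrR)
  have hint : CircleIntegrable (fun z => R / (R - r) * ‖g z‖ ^ 2) 0 R :=
    circleIntegrable_of_continuousOn_ball
      (continuousOn_const.mul (hg.continuousOn.norm.pow 2)) hR0 hR
  have hint2 := circleIntegrable_of_continuousOn_ball (hg.continuousOn.norm.pow 2) hR0 hR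
  rw [← norm_pow, show g w ^ 2 = (g ^ 2) w from rfl, ← h1, Real.circleAverage_def,
    Real.circleAverage_def, norm_smul, smul_eq_mul, mul_left_comm, Real.norm_of_nonneg (by positivity)]
  refine mul_le_mul_of_nonneg_left ?_ (by positivity)
  rw [← intervalIntegral.integral_const_mul]
  refine (intervalIntegral.norm_integral_le_integral_norm Real.two_pi_pos.le).trans ?_
  have hb : ∀ θ : ℝ, ‖((circleMap 0 R θ - 0) / (circleMap 0 R θ - w)) • (g ^ 2) (circleMap 0 R θ)‖ ≤
      R / (R - r) * ‖g (circleMap 0 R θ)‖ ^ 2 := by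
    intro θ
    have h2 : ‖circleMap 0 R θ‖ = R := by simp [hR0]
    have h3 : R - r ≤ ‖circleMap 0 R θ - w‖ := by
      have := norm_sub_norm_le (circleMap 0 R θ) w
      rw [h2] at this
      linarith
    rw [norm_smul, norm_div, sub_zero, h2, Pi.pow_apply, norm_pow]
    have : 0 < R - r := sub_pos.mpr hrR
    gcongr
  refine intervalIntegral.integral_mono_on_of_le_Ioo Real.two_pi_pos.le ?_ hint fun θ _ => hb θ
  refine (IntervalIntegrable.mono_fun hint ?_ (Eventually.of_forall fun θ => ?_)).norm
  · have hc : Continuous fun θ : ℝ => ((circleMap 0 R θ - 0) / (circleMap 0 R θ - w)) •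
        (g ^ 2) (circleMap 0 R θ) := by
      refine Continuous.smul (Continuous.div ((continuous_circleMap 0 R).sub continuous_const)
        ((continuous_circleMap 0 R).sub continuous_const) fun θ => ?_) ?_
      · intro h
        have h2 : ‖circleMap 0 R θ‖ = R := by simp [hR0]
        rw [sub_eq_zero.mp h] at h2
        linarith
      · refine ((hg.pow 2).continuousOn).comp_continuous (by fun_prop) fun θ => ?_
        simpa [abs_of_nonneg hR0] using hR
    exact hc.aestronglyMeasurable
  · refine (hb θ).trans (le_abs_self _)

lemma circleAverage_sq_norm_sub {f : ℂ → ℂ} (hf : DifferentiableOn ℂ f (ball 0 1)) {R : ℝ}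
    (hR0 : 0 ≤ R) (hR : R < 1) : Real.circleAverage (fun z => ‖f z - f 0‖ ^ 2) 0 R =
      Real.circleAverage (fun z => ‖f z‖ ^ 2) 0 R - ‖f 0‖ ^ 2 := by
  have hm := (diffContOnCl_of_differentiableOn_ball
    (hf.const_mul (conj (f 0))) hR0 hR).circleAverage
  have hi := circleIntegrable_of_continuousOn_ball
    (hf.const_mul (conj (f 0))).continuousOn hR0 hR
  have hre := Complex.reCLM.circleAverage_comp_comm hi
  rw [hm] at hre
  have hf2 : CircleIntegrable (fun z => ‖f z‖ ^ 2) 0 R :=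
    circleIntegrable_of_continuousOn_ball (hf.continuousOn.norm.pow 2) hR0 hR
  have hir : CircleIntegrable (fun z => (conj (f 0) * f z).re) 0 R :=
    circleIntegrable_of_continuousOn_ball
      (Complex.continuous_re.comp_continuousOn (hf.const_mul (conj (f 0))).continuousOn) hR0 hR
  have e : (fun z => ‖f z - f 0‖ ^ 2) =
      fun z => (‖f z‖ ^ 2 - (2 : ℝ) • (conj (f 0) * f z).re) + ‖f 0‖ ^ 2 := by
    funext z
    rw [← Complex.normSq_eq_norm_sq, Complex.normSq_sub, Complex.normSq_eq_norm_sq,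
      Complex.normSq_eq_norm_sq, mul_comm (f z), smul_eq_mul]
    ring
  have e0 : (conj (f 0) * f 0).re = ‖f 0‖ ^ 2 := by
    rw [mul_comm, Complex.mul_conj, Complex.normSq_eq_norm_sq, Complex.ofReal_re]
  have hs : CircleIntegrable (fun z => (2 : ℝ) • (conj (f 0) * f z).re) 0 R := hir.const_smul
  have hd : CircleIntegrable (fun z => ‖f z‖ ^ 2 - (2 : ℝ) • (conj (f 0) * f z).re) 0 R :=
    hf2.sub hs
  rw [e, Real.circleAverage_fun_add hd (circleIntegrable_const _ _ _),
    Real.circleAverage_fun_sub hf2 hs,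
    Real.circleAverage_fun_smul, Real.circleAverage_const]
  have : Real.circleAverage (fun z => (conj (f 0) * f z).re) 0 R = ‖f 0‖ ^ 2 := by
    rw [← e0]
    exact hre
  rw [this, smul_eq_mul]
  ring

namespace OrthoSystem

variable (S : OrthoSystem)

lemma N_eq_sq_nrm_Φs (n : ℕ) : S.N n = S.nrm (circleEval (S.Φs n)) ^ 2 := by
  rw [← sq_nrm_Φ, sq_nrm, sq_nrm, circleEval_Φs, ip_ζ_pow_mul, ip_star]

lemma N_le_sq_nrm {n : ℕ} {P : ℂ[X]} (hP : P.natDegree ≤ n) (h0 : P.coeff 0 = 1) :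
    S.N n ≤ S.nrm (circleEval P) ^ 2 := by
  have hdiv : (X : ℂ[X]) ∣ P - S.Φs n := by
    rw [X_dvd_iff, coeff_sub, h0, Φs_coeff_zero, sub_self]
  obtain ⟨Q, hQ⟩ := hdiv
  have hQd : Q.degree < n := by
    by_cases hQ0 : Q = 0
    · rw [hQ0, degree_zero]
      exact WithBot.bot_lt_coe n
    have h1 : (X * Q).natDegree ≤ n := by
      rw [← hQ]
      exact (natDegree_sub_le _ _).trans (max_le hP (S.natDegree_Φs_le n))
    rw [natDegree_X_mul hQ0] at h1
    rw [degree_eq_natDegree hQ0]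
    exact_mod_cast h1
  have e : circleEval P = circleEval (S.Φs n) + ζ * circleEval Q := by
    rw [← circleEval_X, ← circleEval_mul, ← hQ, circleEval_sub]
    ring
  have h2 := S.orth_Φs n Q hQd
  have h3 : S.ip (ζ * circleEval Q) (circleEval (S.Φs n)) = 0 := by
    rw [← conj_ip, h2, map_zero]
  rw [N_eq_sq_nrm_Φs, sq_nrm, sq_nrm, e, ip_add_left, ip_add_right, ip_add_right, h2, h3]
  have := S.nonneg (ζ * circleEval Q)
  simp only [add_zero, zero_add, Complex.add_re]
  unfold ip at this ⊢
  linarith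

lemma sq_nrm_sub_le_of_hardy {D : ℂ → ℂ} (hD : DifferentiableOn ℂ D (ball 0 1))
    (hlim : ∀ P : ℂ[X], Tendsto (fun R : ℝ =>
      2 * π * Real.circleAverage (fun z => ‖P.eval z * D z‖ ^ 2) 0 R) (nhdsWithin 1 (Iio 1))
        (nhds (S.nrm (circleEval P) ^ 2)))
    {r : ℝ} (hr0 : 0 ≤ r) (hr : r < 1) {w : ℂ} (hw : ‖w‖ ≤ r) (n : ℕ) :
    ‖(S.Φs n).eval w * D w - D 0‖ ^ 2 ≤ (1 - r)⁻¹ * ((2 * π)⁻¹ * S.N n - ‖D 0‖ ^ 2) := by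
  have hf : DifferentiableOn ℂ (fun z => (S.Φs n).eval z * D z) (ball 0 1) :=
    (S.Φs n).differentiable.differentiableOn.mul hD
  have hf0 : (S.Φs n).eval 0 * D 0 = D 0 := by
    rw [← coeff_zero_eq_eval_zero, Φs_coeff_zero, one_mul]
  have hev : ∀ᶠ R : ℝ in nhdsWithin 1 (Iio 1), ‖(S.Φs n).eval w * D w - D 0‖ ^ 2 ≤
      R / (R - r) * ((2 * π)⁻¹ * (2 * π * Real.circleAverage
        (fun z => ‖(S.Φs n).eval z * D z‖ ^ 2) 0 R) - ‖D 0‖ ^ 2) := by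
    filter_upwards [Ioo_mem_nhdsLT hr] with R hR
    have h1 := sq_norm_le_circleAverage (hf.sub_const (D 0)) hr0 hR.1 hR.2 hw
    have h2 := circleAverage_sq_norm_sub hf (hr0.trans hR.1.le) hR.2
    simp only [hf0] at h2
    rw [h2] at h1
    rwa [inv_mul_cancel_left₀ (by positivity)]
  refine ge_of_tendsto ?_ hev
  rw [S.N_eq_sq_nrm_Φs]
  have h3 : Tendsto (fun R : ℝ => R / (R - r)) (nhdsWithin 1 (Iio 1)) (nhds (1 - r)⁻¹) := by
    have : ContinuousAt (fun R : ℝ => R / (R - r)) 1 :=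
      ContinuousAt.div (by fun_prop) (by fun_prop) (by linarith)
    have h4 := this.tendsto
    rw [one_div] at h4
    exact h4.mono_left nhdsWithin_le_nhds
  exact h3.mul (((hlim (S.Φs n)).const_mul _).sub_const _)

/-- Szegő asymptotics inside the disk. -/
theorem tendstoUniformlyOn_Φs {D : ℂ → ℂ} (hD : DifferentiableOn ℂ D (ball 0 1))
    (hD0 : ∀ z : ℂ, ‖z‖ < 1 → D z ≠ 0)
    (hlim : ∀ P : ℂ[X], Tendsto (fun R : ℝ =>
      2 * π * Real.circleAverage (fun z => ‖P.eval z * D z‖ ^ 2) 0 R) (nhdsWithin 1 (Iio 1))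
        (nhds (S.nrm (circleEval P) ^ 2)))
    (hopt : ∀ c > 2 * π * ‖D 0‖ ^ 2, ∃ P : ℂ[X], P.coeff 0 = 1 ∧ S.nrm (circleEval P) ^ 2 < c) :
    (∀ n, 2 * π * ‖D 0‖ ^ 2 ≤ S.N n) ∧ ∀ r < (1 : ℝ),
      TendstoUniformlyOn (fun n z => (S.Φs n).eval z) (fun z => D 0 / D z) atTop
        (closedBall 0 r) := by
  have hlow : ∀ n, 2 * π * ‖D 0‖ ^ 2 ≤ S.N n := by
    intro n
    have h := S.sq_nrm_sub_le_of_hardy hD hlim le_rfl zero_lt_one (w := 0) (by simp) n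
    rw [sub_zero, inv_one, one_mul] at h
    have h1 := (sq_nonneg _).trans h
    rw [sub_nonneg, inv_mul_eq_div, le_div_iff₀ Real.two_pi_pos] at h1
    linarith
  refine ⟨hlow, fun r hr => ?_⟩
  rcases lt_or_ge r 0 with hr0 | hr0
  · rw [closedBall_eq_empty.mpr hr0]
    exact tendstoUniformlyOn_empty
  obtain ⟨M, hM⟩ := (isCompact_closedBall (0 : ℂ) r).exists_bound_of_continuousOn
    ((hD.continuousOn.mono (closedBall_subset_ball hr)).inv₀ fun z hz =>
      hD0 z (lt_of_le_of_lt (by simpa using hz) hr))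
  have hr1 : 0 < 1 - r := sub_pos.mpr hr
  rw [Metric.tendstoUniformlyOn_iff]
  intro ε hε
  set δ := (ε / (|M| + 1)) ^ 2 * (1 - r) * (2 * π) with hδ
  have hδ0 : 0 < δ := by positivity
  obtain ⟨P, hP0, hP⟩ := hopt (2 * π * ‖D 0‖ ^ 2 + δ) (by linarith)
  filter_upwards [eventually_ge_atTop P.natDegree] with n hn z hz
  have hz' : ‖z‖ ≤ r := by simpa using hz
  have hDz := hD0 z (hz'.trans_lt hr)
  have h1 := S.sq_nrm_sub_le_of_hardy hD hlim hr0 hr hz' n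
  have h2 : S.N n < 2 * π * ‖D 0‖ ^ 2 + δ := (S.N_le_sq_nrm hn hP0).trans_lt hP
  have h3 : (1 - r)⁻¹ * ((2 * π)⁻¹ * S.N n - ‖D 0‖ ^ 2) < (ε / (|M| + 1)) ^ 2 := by
    rw [inv_mul_lt_iff₀ hr1, inv_mul_eq_div, sub_lt_iff_lt_add, div_lt_iff₀ Real.two_pi_pos]
    rw [hδ] at h2
    linarith
  have h4 : ‖(S.Φs n).eval z * D z - D 0‖ < ε / (|M| + 1) :=
    lt_of_pow_lt_pow_left₀ 2 (by positivity) (h1.trans_lt h3)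
  have e : D 0 / D z - (S.Φs n).eval z = -((D z)⁻¹ * ((S.Φs n).eval z * D z - D 0)) := by
    field_simp
    ring
  rw [dist_eq_norm, e, norm_neg, norm_mul]
  calc ‖(D z)⁻¹‖ * ‖(S.Φs n).eval z * D z - D 0‖
      ≤ (|M| + 1) * ‖(S.Φs n).eval z * D z - D 0‖ := by
        gcongr
        exact (hM z hz).trans ((le_abs_self M).trans (by linarith))
    _ < (|M| + 1) * (ε / (|M| + 1)) := by gcongr
    _ = ε := by field_simp

end OrthoSystem

lemma abs_mul_le_norm_exp_sub_one {x : ℝ} (hx : |x| ≤ π) :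
    2 / π * |x| ≤ ‖Complex.exp (Complex.I * x) - 1‖ := by
  have h := Real.mul_abs_le_abs_sin (x := x / 2)
    (by rw [abs_div, abs_two]; linarith)
  rw [abs_div, abs_two] at h
  rw [Complex.norm_exp_I_mul_ofReal_sub_one, norm_mul, Real.norm_two, Real.norm_eq_abs]
  linarith

lemma intervalIntegrable_abs_rpow {γ : ℝ} (h : -1 < γ) (a b : ℝ) :
    IntervalIntegrable (fun x : ℝ => |x| ^ γ) volume a b := by
  have pos (c : ℝ) (hc : 0 ≤ c) : IntervalIntegrable (fun x : ℝ => |x| ^ γ) volume 0 c := by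
    refine (intervalIntegral.intervalIntegrable_rpow' h).congr ?_
    intro x hx
    rw [uIoc_of_le hc] at hx
    simp only [abs_of_pos hx.1]
  have all (c : ℝ) : IntervalIntegrable (fun x : ℝ => |x| ^ γ) volume 0 c := by
    rcases le_total 0 c with hc | hc
    · exact pos c hc
    · rw [IntervalIntegrable.iff_comp_neg]
      simpa using pos (-c) (by linarith)
  exact (all a).symm.trans (all b)

lemma intervalIntegrable_norm_circleMap_sub_rpow {γ : ℝ} (h : -1 < γ) (h0 : γ ≤ 0) {a : ℂ}
    (ha : ‖a‖ = 1) (s t : ℝ) :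
    IntervalIntegrable (fun θ : ℝ => ‖circleMap 0 1 θ - a‖ ^ γ) volume s t := by
  set G : ℝ → ℝ := fun θ => ‖Complex.exp (Complex.I * θ) - 1‖ ^ γ with hG
  have hper : Function.Periodic G (2 * π) := by
    intro θ
    simp only [hG]
    congr 3
    push_cast
    rw [mul_add, Complex.exp_add, show Complex.I * (2 * π) = 2 * π * Complex.I by ring,
      Complex.exp_two_pi_mul_I, mul_one]
  have hGi : IntervalIntegrable G volume (-π) (-π + 2 * π) := by
    have hle : -π ≤ -π + 2 * π := by linarith [Real.pi_pos]
    refine ((intervalIntegrable_abs_rpow h _ _).const_mul ((2 / π) ^ γ)).mono_fun' ?_ ?_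
    · have : Measurable G := by
        have : Continuous fun θ : ℝ => ‖Complex.exp (Complex.I * θ) - 1‖ := by fun_prop
        exact this.measurable.pow_const _
      exact this.aestronglyMeasurable
    · rw [uIoc_of_le hle]
      have h1 : ∀ᵐ x : ℝ ∂volume.restrict (Ioc (-π) (-π + 2 * π)), x ≠ 0 :=
        ae_restrict_of_ae (Measure.ae_ne volume (0 : ℝ))
      filter_upwards [h1, ae_restrict_mem measurableSet_Ioc] with x hx0 hx
      have hx' : |x| ≤ π := abs_le.mpr ⟨hx.1.le, by linarith [hx.2]⟩
      have hpi := Real.pi_pos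
      rw [Real.norm_of_nonneg (by positivity), ← Real.mul_rpow (by positivity) (abs_nonneg x)]
      exact Real.rpow_le_rpow_of_nonpos (by positivity) (abs_mul_le_norm_exp_sub_one hx') h0
  have hall := hper.intervalIntegrable (by positivity) hGi
  have h2 := (hall (s - a.arg) (t - a.arg)).comp_sub_right a.arg
  simp only [sub_add_cancel] at h2
  refine h2.congr ?_
  intro θ _
  simp only [hG]
  congr 1
  have ha' : a = Complex.exp (Complex.I * a.arg) := by
    have := Complex.norm_mul_exp_arg_mul_I a
    rw [ha, Complex.ofReal_one, one_mul] at this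
    rw [mul_comm, this]
  have : circleMap 0 1 θ - a = a * (Complex.exp (Complex.I * ((θ - a.arg : ℝ) : ℂ)) - 1) := by
    rw [mul_sub, mul_one]
    congr 1
    conv_rhs => rw [ha', ← Complex.exp_add]
    rw [← ha', circleMap_zero, Complex.ofReal_one, one_mul]
    congr 1
    push_cast
    ring
  rw [this, norm_mul, ha, one_mul]

lemma exists_pos_le_norm_sub {m : ℕ} {a : Fin m → ℂ} (ha : Function.Injective a) :
    ∃ δ > 0, ∀ j k, j ≠ k → δ ≤ ‖a j - a k‖ := by
  have : ∀ᶠ δ in nhdsWithin (0 : ℝ) (Ioi 0), ∀ j k, j ≠ k → δ ≤ ‖a j - a k‖ := by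
    refine eventually_all.mpr fun j => eventually_all.mpr fun k => ?_
    by_cases hjk : j = k
    · simp [hjk]
    · have : 0 < ‖a j - a k‖ := norm_pos_iff.mpr (sub_ne_zero.mpr fun h => hjk (ha h))
      filter_upwards [Ioo_mem_nhdsGT this] with δ hδ _
      exact hδ.2.le
  obtain ⟨δ, h, h'⟩ := (this.and self_mem_nhdsWithin).exists
  exact ⟨δ, h', h⟩

lemma prod_norm_sub_rpow_le {m : ℕ} {a : Fin m → ℂ} (ha : Function.Injective a) {γ : Fin m → ℝ}
    (hγ : ∀ k, γ k ≤ 0) :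
    ∃ C : ℝ, ∀ z, ∏ k, ‖z - a k‖ ^ γ k ≤ C * (1 + ∑ k, ‖z - a k‖ ^ γ k) := by
  obtain ⟨δ, hδ, hsep⟩ := exists_pos_le_norm_sub ha
  have hM (k) : 1 ≤ max 1 ((δ / 2) ^ γ k) := le_max_left _ _
  refine ⟨∏ k, max 1 ((δ / 2) ^ γ k), fun z => ?_⟩
  have hfac (k) (hk : δ / 2 ≤ ‖z - a k‖) : ‖z - a k‖ ^ γ k ≤ max 1 ((δ / 2) ^ γ k) :=
    (Real.rpow_le_rpow_of_nonpos (by positivity) hk (hγ k)).trans (le_max_right _ _)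
  have hsum : 0 ≤ ∑ k, ‖z - a k‖ ^ γ k := by positivity
  have hCpos : 0 ≤ ∏ k, max 1 ((δ / 2) ^ γ k) :=
    Finset.prod_nonneg fun k _ => zero_le_one.trans (hM k)
  by_cases h : ∀ k, δ / 2 ≤ ‖z - a k‖
  · calc ∏ k, ‖z - a k‖ ^ γ k ≤ ∏ k, max 1 ((δ / 2) ^ γ k) :=
          Finset.prod_le_prod (fun _ _ => by positivity) fun k _ => hfac k (h k)
      _ ≤ _ := by nlinarith
  · push Not at h
    obtain ⟨j, hj⟩ := h
    have hother (k) (hk : k ≠ j) : δ / 2 ≤ ‖z - a k‖ := by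
      have h1 := hsep k j hk
      have h2 := norm_sub_le_norm_sub_add_norm_sub (a k) z (a j)
      rw [norm_sub_rev (a k) z] at h2
      linarith
    rw [← Finset.mul_prod_erase _ _ (Finset.mem_univ j)]
    have h1 : ∏ k ∈ Finset.univ.erase j, ‖z - a k‖ ^ γ k ≤ ∏ k, max 1 ((δ / 2) ^ γ k) := by
      refine (Finset.prod_le_prod (fun _ _ => by positivity)
        fun k hk => hfac k (hother k (Finset.ne_of_mem_erase hk))).trans ?_
      rw [← Finset.mul_prod_erase Finset.univ _ (Finset.mem_univ j)]
      exact le_mul_of_one_le_left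
        (Finset.prod_nonneg fun k _ => zero_le_one.trans (hM k)) (hM j)
    have h2 : ‖z - a j‖ ^ γ j ≤ 1 + ∑ k, ‖z - a k‖ ^ γ k := by
      have := Finset.single_le_sum (f := fun k => ‖z - a k‖ ^ γ k) (fun _ _ => by positivity)
        (Finset.mem_univ j)
      linarith
    rw [mul_comm]
    exact mul_le_mul h1 h2 (by positivity) hCpos

lemma intervalIntegrable_prod_norm_circleMap_sub_rpow {m : ℕ} {a : Fin m → ℂ}
    (ha : Function.Injective a) (ha1 : ∀ k, ‖a k‖ = 1) {γ : Fin m → ℝ} (hγ : ∀ k, γ k ≤ 0)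
    (hγ' : ∀ k, -1 < γ k) (s t : ℝ) :
    IntervalIntegrable (fun θ : ℝ => ∏ k, ‖circleMap 0 1 θ - a k‖ ^ γ k) volume s t := by
  obtain ⟨C, hC⟩ := prod_norm_sub_rpow_le ha hγ
  have h1 : IntervalIntegrable (fun θ : ℝ => C * (1 + ∑ k, ‖circleMap 0 1 θ - a k‖ ^ γ k))
      volume s t := by
    refine (IntervalIntegrable.add intervalIntegrable_const ?_).const_mul C
    have h := IntervalIntegrable.sum Finset.univ fun k _ =>
      intervalIntegrable_norm_circleMap_sub_rpow (hγ' k) (hγ k) (ha1 k) s t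
    exact h.congr fun θ _ => by simp
  refine h1.mono_fun' ?_ (Eventually.of_forall fun θ => ?_)
  · refine (Finset.measurable_prod _ fun k _ => ?_).aestronglyMeasurable
    have : Continuous fun θ : ℝ => ‖circleMap 0 1 θ - a k‖ := by fun_prop
    exact this.measurable.pow_const _
  · dsimp only
    rw [Real.norm_of_nonneg (by positivity)]
    exact hC _

lemma norm_one_sub_mul_conj {z a : ℂ} (ha : ‖a‖ = 1) : ‖1 - z * conj a‖ = ‖z - a‖ := by
  have h : a * conj a = 1 := by simp [Complex.mul_conj, Complex.normSq_eq_norm_sq, ha]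
  have : z - a = -(a * (1 - z * conj a)) := by linear_combination (-z) * h
  rw [this, norm_neg, norm_mul, ha, one_mul]

lemma norm_one_sub_le_two_mul {u : ℂ} (hu : ‖u‖ = 1) {R : ℝ} (h0 : 0 ≤ R) (h1 : R ≤ 1) :
    ‖1 - u‖ ≤ 2 * ‖1 - R * u‖ := by
  have h2 : 1 - u = (1 - R * u) - (1 - R : ℝ) * u := by push_cast; ring
  have h3 : 1 - R ≤ ‖1 - R * u‖ := by
    have := norm_sub_norm_le (1 : ℂ) (R * u)
    simpa [hu, abs_of_nonneg h0] using this
  calc ‖1 - u‖ ≤ ‖1 - R * u‖ + ‖((1 - R : ℝ) : ℂ) * u‖ := by rw [h2]; exact norm_sub_le _ _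
    _ = ‖1 - R * u‖ + (1 - R) := by
      rw [norm_mul, hu, mul_one, Complex.norm_real, Real.norm_of_nonneg (by linarith)]
    _ ≤ _ := by linarith

lemma rpow_norm_one_sub_le {u : ℂ} (hu : ‖u‖ = 1) (hu1 : u ≠ 1) {R : ℝ} (h0 : 0 ≤ R) (h1 : R ≤ 1)
    (b : ℝ) :
    ‖1 - R * u‖ ^ (2 * b) ≤ 4 ^ |b| * ‖1 - u‖ ^ (2 * min b 0) := by
  have h2 : 0 < ‖1 - u‖ := norm_pos_iff.mpr (sub_ne_zero.mpr hu1.symm)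
  have h3 := norm_one_sub_le_two_mul hu h0 h1
  have h4 : (4 : ℝ) = 2 ^ (2 : ℝ) := by norm_num
  rcases le_total 0 b with hb | hb
  · rw [min_eq_right hb, mul_zero, Real.rpow_zero, mul_one, abs_of_nonneg hb, h4,
      ← Real.rpow_mul zero_le_two]
    refine Real.rpow_le_rpow (norm_nonneg _) ?_ (by positivity)
    refine (norm_sub_le _ _).trans ?_
    rw [norm_mul, hu, Complex.norm_real, Real.norm_of_nonneg h0, norm_one]
    linarith
  · rw [min_eq_left hb, abs_of_nonpos hb, h4, ← Real.rpow_mul zero_le_two]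
    calc ‖1 - R * u‖ ^ (2 * b) ≤ (2⁻¹ * ‖1 - u‖) ^ (2 * b) :=
          Real.rpow_le_rpow_of_nonpos (by positivity) (by linarith) (by linarith)
      _ = _ := by
        rw [Real.mul_rpow (by positivity) h2.le, Real.inv_rpow zero_le_two,
          ← Real.rpow_neg zero_le_two]
        ring_nf

lemma rpow_norm_one_sub_div_le {u : ℂ} (hu : ‖u‖ = 1) (hu1 : u ≠ 1) {R : ℝ} (h0 : 0 ≤ R)
    (h1 : R ≤ 1) (b : ℝ) :
    ‖1 - u‖ ^ (2 * b) / ‖1 - R * u‖ ^ (2 * b) ≤ 4 ^ |b| * ‖1 - u‖ ^ (2 * min b 0) := by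
  have h2 : 0 < ‖1 - u‖ := norm_pos_iff.mpr (sub_ne_zero.mpr hu1.symm)
  have h3 := norm_one_sub_le_two_mul hu h0 h1
  have h5 : 0 < ‖1 - R * u‖ := by linarith
  have h4 : (4 : ℝ) = 2 ^ (2 : ℝ) := by norm_num
  rcases le_total 0 b with hb | hb
  · rw [min_eq_right hb, mul_zero, Real.rpow_zero, mul_one, abs_of_nonneg hb, h4,
      ← Real.rpow_mul zero_le_two, ← Real.div_rpow h2.le h5.le]
    refine Real.rpow_le_rpow (by positivity) ?_ (by positivity)
    rw [div_le_iff₀ h5]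
    exact h3
  · rw [min_eq_left hb, abs_of_nonpos hb, h4, ← Real.rpow_mul zero_le_two,
      div_eq_mul_inv, ← Real.rpow_neg h5.le, mul_comm]
    gcongr
    rw [← mul_neg]
    refine Real.rpow_le_rpow h5.le ?_ (by linarith)
    refine (norm_sub_le _ _).trans ?_
    rw [norm_mul, hu, Complex.norm_real, Real.norm_of_nonneg h0, norm_one]
    linarith

lemma abs_log_norm_one_sub_le {u : ℂ} (hu : ‖u‖ = 1) (hu1 : u ≠ 1) {R : ℝ} (h0 : 0 ≤ R)
    (h1 : R ≤ 1) :
    |Real.log ‖1 - R * u‖| ≤ 2 * Real.log 2 + |Real.log ‖1 - u‖| := by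
  have h2 : 0 < ‖1 - u‖ := norm_pos_iff.mpr (sub_ne_zero.mpr hu1.symm)
  have h3 := norm_one_sub_le_two_mul hu h0 h1
  have h5 : 0 < ‖1 - R * u‖ := by linarith
  have h6 : ‖1 - R * u‖ ≤ 2 := by
    refine (norm_sub_le _ _).trans ?_
    rw [norm_mul, hu, Complex.norm_real, Real.norm_of_nonneg h0, norm_one]
    linarith
  have h7 := Real.log_le_log h5 h6
  have h8 := Real.log_le_log h2 h3
  rw [Real.log_mul two_ne_zero h5.ne'] at h8
  have h9 : 0 < Real.log 2 := Real.log_pos one_lt_two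
  have h10 := neg_abs_le (Real.log ‖1 - u‖)
  have h11 := abs_nonneg (Real.log ‖1 - u‖)
  exact abs_le.mpr ⟨by linarith, by linarith⟩

lemma circleMap_eq_mul (r θ : ℝ) : circleMap 0 r θ = r * circleMap 0 1 θ := by
  simp [circleMap]

lemma norm_circleMap_one (θ : ℝ) : ‖circleMap 0 1 θ‖ = 1 := by simp

/-- The data of a weight `exp (2 re g) ∏ |1 - z conj a_k| ^ (2 β_k)` on the unit circle, where `g`
is holomorphic on a disk of radius greater than one and `p` is its derivative, with Taylor
coefficients `c`. -/
structure SingularWeight (m : ℕ) where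
  a : Fin m → ℂ
  norm_a : ∀ k, ‖a k‖ = 1
  a_inj : Function.Injective a
  β : Fin m → ℝ
  β_gt : ∀ k, -(1 / 2 : ℝ) < β k
  R : ℝ
  one_lt_R : 1 < R
  g : ℂ → ℂ
  p : ℂ → ℂ
  hasDerivAt_g : ∀ z, ‖z‖ < R → HasDerivAt g (p z) z
  im_g_zero : (g 0).im = 0
  c : ℕ → ℂ
  Cv : ℝ
  s : ℝ
  s_nonneg : 0 ≤ s
  s_lt : s < 1
  c_le : ∀ m, ‖c m‖ ≤ Cv * s ^ m
  hasSum_p : ∀ z : ℂ, ‖z‖ < R → HasSum (fun m => c m * z ^ m) (p z)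

namespace SingularWeight

variable {m : ℕ} (S : SingularWeight m)

/-- The weight. -/
noncomputable def wt (z : ℂ) : ℝ :=
  Real.exp (2 * (S.g z).re) * ∏ k, ‖1 - z * conj (S.a k)‖ ^ (2 * S.β k)

/-- The holomorphic function in the unit disk with `2 re L = log wt`. -/
noncomputable def L (z : ℂ) : ℂ := S.g z + ∑ k, S.β k * Complex.log (1 - z * conj (S.a k))

/-- The inner Szegő function. -/
noncomputable def D (z : ℂ) : ℂ := Complex.exp (S.L z)

/-- An integrable function that dominates the weight. -/
noncomputable def dom (θ : ℝ) : ℝ := ∏ k, ‖circleMap 0 1 θ - S.a k‖ ^ (2 * min (S.β k) 0)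

/-- The arguments of the singularities. -/
def bad : Set ℝ := {θ | ∃ k, circleMap 0 1 θ = S.a k}

lemma countable_bad : S.bad.Countable := by
  have h : S.bad = circleMap 0 1 ⁻¹' Set.range S.a := by
    ext θ
    simp [bad, eq_comm]
  rw [h]
  exact (Set.finite_range S.a).countable.preimage_circleMap 0 one_ne_zero

lemma ae_notMem_bad : ∀ᵐ θ : ℝ, θ ∉ S.bad := S.countable_bad.ae_notMem volume

lemma wt_nonneg (z : ℂ) : 0 ≤ S.wt z :=
  mul_nonneg (Real.exp_pos _).le (Finset.prod_nonneg fun _ _ => by positivity)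

lemma intervalIntegrable_dom (s t : ℝ) : IntervalIntegrable S.dom volume s t := by
  refine intervalIntegrable_prod_norm_circleMap_sub_rpow S.a_inj S.norm_a (fun k => ?_)
    (fun k => ?_) s t
  · linarith [min_le_right (S.β k) 0]
  · have h1 := S.β_gt k
    rcases min_choice (S.β k) 0 with h | h <;> rw [h] <;> linarith

lemma mul_conj_a (k : Fin m) : S.a k * conj (S.a k) = 1 := by
  simp [Complex.mul_conj, Complex.normSq_eq_norm_sq, S.norm_a]

lemma one_sub_mem_slitPlane {z : ℂ} (hz : ‖z‖ < 1) (k : Fin m) :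
    1 - z * conj (S.a k) ∈ Complex.slitPlane := by
  have h := Complex.mem_slitPlane_of_norm_lt_one (z := -(z * conj (S.a k)))
    (by simpa [S.norm_a] using hz)
  rwa [← sub_eq_add_neg] at h

lemma one_sub_ne_zero {z : ℂ} (h : ∀ k, z ≠ S.a k) (k : Fin m) : 1 - z * conj (S.a k) ≠ 0 := by
  intro h'
  apply h k
  linear_combination (-(S.a k)) * h' + (-z) * S.mul_conj_a k

lemma ne_a_of_norm_lt {z : ℂ} (hz : ‖z‖ < 1) (k : Fin m) : z ≠ S.a k := by
  rintro rfl
  exact hz.ne (S.norm_a k)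

lemma norm_one_sub (z : ℂ) (k : Fin m) : ‖1 - z * conj (S.a k)‖ = ‖z - S.a k‖ :=
  norm_one_sub_mul_conj (S.norm_a k)

lemma norm_exp_mul_log {u : ℂ} (hu : u ≠ 0) (b : ℝ) :
    ‖Complex.exp (b * Complex.log u)‖ = ‖u‖ ^ b := by
  rw [Complex.norm_exp, Complex.re_ofReal_mul, Complex.log_re, Real.rpow_def_of_pos
    (norm_pos_iff.mpr hu), mul_comm]

lemma sq_norm_D {z : ℂ} (hz : ‖z‖ < 1) : ‖S.D z‖ ^ 2 = S.wt z := by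
  unfold D L wt
  rw [Complex.exp_add, Complex.exp_sum, norm_mul, norm_prod, mul_pow, ← Finset.prod_pow,
    Complex.norm_exp, ← Real.exp_nat_mul]
  push_cast
  congr 1
  refine Finset.prod_congr rfl fun k _ => ?_
  rw [norm_exp_mul_log (S.one_sub_ne_zero (S.ne_a_of_norm_lt hz) k), ← Real.rpow_natCast,
    ← Real.rpow_mul (norm_nonneg _), mul_comm (2 : ℝ)]
  norm_num

lemma D_ne_zero (z : ℂ) : S.D z ≠ 0 := Complex.exp_ne_zero _

lemma hasDerivAt_L {z : ℂ} (hz : ‖z‖ < 1) :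
    HasDerivAt S.L (S.p z - ∑ k, S.β k * conj (S.a k) / (1 - z * conj (S.a k))) z := by
  have h1 := S.hasDerivAt_g z (hz.trans S.one_lt_R)
  have h2 (k : Fin m) : HasDerivAt (fun z => S.β k * Complex.log (1 - z * conj (S.a k)))
      (-(S.β k * conj (S.a k) / (1 - z * conj (S.a k)))) z := by
    have h3 : HasDerivAt (fun z => 1 - z * conj (S.a k)) (-conj (S.a k)) z := by
      simpa using ((hasDerivAt_id z).mul_const (conj (S.a k))).const_sub 1
    refine ((h3.clog (S.one_sub_mem_slitPlane hz k)).const_mul (S.β k : ℂ)).congr_deriv ?_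
    ring
  refine (h1.add (HasDerivAt.fun_sum fun k (_ : k ∈ Finset.univ) => h2 k)).congr_deriv ?_
  rw [Finset.sum_neg_distrib, sub_eq_add_neg]

lemma hasDerivAt_D {z : ℂ} (hz : ‖z‖ < 1) :
    HasDerivAt S.D (S.D z * (S.p z - ∑ k, S.β k * conj (S.a k) / (1 - z * conj (S.a k)))) z :=
  (S.hasDerivAt_L hz).cexp

lemma differentiableOn_D : DifferentiableOn ℂ S.D (ball 0 1) := fun z hz =>
  (S.hasDerivAt_D (by simpa using hz)).differentiableAt.differentiableWithinAt

lemma differentiableOn_L : DifferentiableOn ℂ S.L (ball 0 1) := fun z hz =>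
  (S.hasDerivAt_L (by simpa using hz)).differentiableAt.differentiableWithinAt

lemma continuousAt_g {z : ℂ} (hz : ‖z‖ ≤ 1) : ContinuousAt S.g z :=
  (S.hasDerivAt_g z (hz.trans_lt S.one_lt_R)).continuousAt

lemma continuous_g_circleMap {r : ℝ} (h0 : 0 ≤ r) (h1 : r ≤ 1) :
    Continuous fun θ : ℝ => S.g (circleMap 0 r θ) := by
  refine continuous_iff_continuousAt.mpr fun θ => ?_
  exact ContinuousAt.comp (f := fun θ : ℝ => circleMap 0 r θ)
    (S.continuousAt_g (by simpa [abs_of_nonneg h0] using h1)) (continuous_circleMap 0 r).continuousAt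

lemma measurable_wt_circleMap {r : ℝ} (h0 : 0 ≤ r) (h1 : r ≤ 1) :
    Measurable fun θ : ℝ => S.wt (circleMap 0 r θ) := by
  unfold wt
  refine Measurable.mul ?_ (Finset.measurable_prod _ fun k _ => ?_)
  · have := S.continuous_g_circleMap h0 h1
    exact (by fun_prop : Continuous fun θ : ℝ => Real.exp (2 * (S.g (circleMap 0 r θ)).re)).measurable
  · have : Continuous fun θ : ℝ => ‖1 - circleMap 0 r θ * conj (S.a k)‖ := by fun_prop
    exact this.measurable.pow_const _

lemma continuousAt_wt {z : ℂ} (hz : ‖z‖ ≤ 1) (h : ∀ k, z ≠ S.a k) : ContinuousAt S.wt z := by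
  unfold wt
  have h1 := S.continuousAt_g hz
  refine ContinuousAt.mul (by fun_prop) (tendsto_finsetProd _ fun k _ => ?_)
  refine ContinuousAt.rpow_const (by fun_prop) (Or.inl ?_)
  exact norm_ne_zero_iff.mpr (S.one_sub_ne_zero h k)

lemma wt_pos {z : ℂ} (h : ∀ k, z ≠ S.a k) : 0 < S.wt z := by
  refine mul_pos (Real.exp_pos _) (Finset.prod_pos fun k _ => ?_)
  exact Real.rpow_pos_of_pos (norm_pos_iff.mpr (S.one_sub_ne_zero h k)) _

lemma circleMap_ne_of_notMem_bad {θ : ℝ} (hθ : θ ∉ S.bad) (k : Fin m) :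
    circleMap 0 1 θ ≠ S.a k := fun h => hθ ⟨k, h⟩

lemma tendsto_circleMap (θ : ℝ) :
    Tendsto (fun r : ℝ => circleMap 0 r θ) (nhdsWithin 1 (Iio 1)) (nhds (circleMap 0 1 θ)) := by
  have : Continuous fun r : ℝ => circleMap 0 r θ := by unfold circleMap; fun_prop
  exact (this.tendsto 1).mono_left nhdsWithin_le_nhds

lemma tendsto_wt {θ : ℝ} (hθ : θ ∉ S.bad) :
    Tendsto (fun r : ℝ => S.wt (circleMap 0 r θ)) (nhdsWithin 1 (Iio 1))
      (nhds (S.wt (circleMap 0 1 θ))) :=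
  (S.continuousAt_wt (by simp) (S.circleMap_ne_of_notMem_bad hθ)).tendsto.comp
    (tendsto_circleMap θ)

lemma exists_norm_g_le : ∃ G : ℝ, ∀ z, ‖z‖ ≤ 1 → ‖S.g z‖ ≤ G := by
  obtain ⟨G, hG⟩ := (isCompact_closedBall (0 : ℂ) 1).exists_bound_of_continuousOn (f := S.g)
    fun z hz => (S.continuousAt_g (by simpa using hz)).continuousWithinAt
  exact ⟨G, fun z hz => hG z (by simpa using hz)⟩

lemma circleMap_mul_conj_a (r θ : ℝ) (k : Fin m) :
    1 - circleMap 0 r θ * conj (S.a k) = 1 - r * (circleMap 0 1 θ * conj (S.a k)) := by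
  rw [circleMap_eq_mul, mul_assoc]

lemma norm_circleMap_mul_conj_a (θ : ℝ) (k : Fin m) :
    ‖circleMap 0 1 θ * conj (S.a k)‖ = 1 := by
  simp [S.norm_a]

lemma circleMap_mul_conj_a_ne_one {θ : ℝ} (hθ : θ ∉ S.bad) (k : Fin m) :
    circleMap 0 1 θ * conj (S.a k) ≠ 1 := by
  intro h
  exact S.one_sub_ne_zero (S.circleMap_ne_of_notMem_bad hθ) k (by rw [h, sub_self])

lemma exists_wt_le : ∃ C : ℝ, 0 ≤ C ∧ ∀ r θ : ℝ, 0 ≤ r → r ≤ 1 → θ ∉ S.bad →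
    S.wt (circleMap 0 r θ) ≤ C * S.dom θ ∧
    S.wt (circleMap 0 1 θ) / S.wt (circleMap 0 r θ) ≤ C * S.dom θ := by
  obtain ⟨G, hG⟩ := S.exists_norm_g_le
  refine ⟨Real.exp (4 * G) * ∏ k, 4 ^ |S.β k|, by positivity, fun r θ h0 h1 hθ => ?_⟩
  have hr := hG (circleMap 0 r θ) (by simpa [abs_of_nonneg h0] using h1)
  have hone := hG (circleMap 0 1 θ) (by simp)
  have hr' := abs_le.mp ((Complex.abs_re_le_norm _).trans hr)
  have hone' := abs_le.mp ((Complex.abs_re_le_norm _).trans hone)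
  have hG0 : 0 ≤ G := (norm_nonneg _).trans hone
  have key (k : Fin m) : ‖circleMap 0 1 θ - S.a k‖ = ‖1 - circleMap 0 1 θ * conj (S.a k)‖ :=
    (S.norm_one_sub _ k).symm
  constructor
  · unfold wt dom
    rw [mul_assoc, ← Finset.prod_mul_distrib]
    refine mul_le_mul (Real.exp_le_exp.mpr (by linarith [hr'.2]))
      (Finset.prod_le_prod (fun _ _ => by positivity) fun k _ => ?_)
      (Finset.prod_nonneg fun _ _ => by positivity) (by positivity)
    rw [circleMap_mul_conj_a, key]
    exact rpow_norm_one_sub_le (S.norm_circleMap_mul_conj_a θ k)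
      (S.circleMap_mul_conj_a_ne_one hθ k) h0 h1 _
  · unfold wt dom
    rw [mul_assoc, ← Finset.prod_mul_distrib, mul_div_mul_comm, ← Finset.prod_div_distrib,
      ← Real.exp_sub]
    refine mul_le_mul (Real.exp_le_exp.mpr (by linarith [hr'.1, hone'.2]))
      (Finset.prod_le_prod (fun _ _ => by positivity) fun k _ => ?_)
      (Finset.prod_nonneg fun _ _ => by positivity) (by positivity)
    rw [circleMap_mul_conj_a (r := r), key]
    exact rpow_norm_one_sub_div_le (S.norm_circleMap_mul_conj_a θ k)
      (S.circleMap_mul_conj_a_ne_one hθ k) h0 h1 _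

lemma intervalIntegrable_wt {r : ℝ} (h0 : 0 ≤ r) (h1 : r ≤ 1) (s t : ℝ) :
    IntervalIntegrable (fun θ : ℝ => S.wt (circleMap 0 r θ)) volume s t := by
  obtain ⟨C, hC, h⟩ := S.exists_wt_le
  refine ((S.intervalIntegrable_dom s t).const_mul C).mono_fun'
    (S.measurable_wt_circleMap h0 h1).aestronglyMeasurable ?_
  filter_upwards [ae_restrict_of_ae S.ae_notMem_bad] with θ hθ
  rw [Real.norm_of_nonneg (S.wt_nonneg _)]
  exact (h r θ h0 h1 hθ).1

end SingularWeight

lemma circle_exp_eq_circleMap (θ : ℝ) : (Circle.exp θ : ℂ) = circleMap 0 1 θ := by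
  simp [circleMap]

lemma exists_polynomial_tendsto_circle {q : ℂ → ℂ} {r : ℝ} (hr : 1 < r)
    (hq : DifferentiableOn ℂ q (ball 0 r)) (f : C(Circle, ℂ)) (hf : ∀ x : Circle, f x = q x) :
    ∃ P : ℕ → ℂ[X], (∀ n, (P n).coeff 0 = q 0) ∧
      Tendsto (fun n => circleEval (P n)) atTop (nhds f) := by
  obtain ⟨r1, hr1, hr1'⟩ := exists_between hr
  obtain ⟨r2, hr2, hr2'⟩ := exists_between hr1
  lift r1 to NNReal using by linarith
  lift r2 to NNReal using by linarith
  have h := (hq.mono (closedBall_subset_ball hr1')).hasFPowerSeriesOnBall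
    (by exact_mod_cast (zero_lt_one.trans hr1))
  set s := cauchyPowerSeries q 0 r1
  have hu := h.tendstoUniformlyOn (r' := r2) (by exact_mod_cast hr2')
  refine ⟨fun n => ∑ k ∈ Finset.range (n + 1), monomial k (s.coeff k), fun n => ?_, ?_⟩
  · rw [finsetSum_coeff, Finset.sum_eq_single 0]
    · rw [coeff_monomial, if_pos rfl]
      exact h.coeff_zero _
    · intro k _ hk
      rw [coeff_monomial, if_neg hk]
    · simp
  · rw [ContinuousMap.tendsto_iff_tendstoUniformly, Metric.tendstoUniformly_iff]
    intro ε hε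
    filter_upwards [(tendsto_add_atTop_nat 1).eventually
      (Metric.tendstoUniformlyOn_iff.mp hu ε hε)] with n hn x
    have := hn (x : ℂ) (by rw [mem_ball_zero_iff, Circle.norm_coe]; exact hr2)
    rw [zero_add, ← hf] at this
    convert this using 2
    rw [circleEval_apply, eval_finsetSum, FormalMultilinearSeries.partialSum]
    refine Finset.sum_congr rfl fun k _ => ?_
    rw [eval_monomial, FormalMultilinearSeries.apply_eq_pow_smul_coeff, smul_eq_mul, mul_comm]

namespace SingularWeight

variable {m : ℕ} (S : SingularWeight m)

lemma intervalIntegrable_mul_wt (f : C(Circle, ℂ)) :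
    IntervalIntegrable (fun θ : ℝ => f (Circle.exp θ) * (S.wt (circleMap 0 1 θ) : ℂ)) volume 0
      (2 * π) := by
  have h : IntervalIntegrable (fun θ : ℝ => (S.wt (circleMap 0 1 θ) : ℂ)) volume 0 (2 * π) :=
    ⟨(S.intervalIntegrable_wt zero_le_one le_rfl 0 (2 * π)).1.ofReal,
      (S.intervalIntegrable_wt zero_le_one le_rfl 0 (2 * π)).2.ofReal⟩
  exact h.continuousOn_mul (by fun_prop)

/-- Integration against the weight. -/
noncomputable def functional : C(Circle, ℂ) →ₗ[ℂ] ℂ where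
  toFun f := ∫ θ in (0 : ℝ)..(2 * π), f (Circle.exp θ) * (S.wt (circleMap 0 1 θ) : ℂ)
  map_add' f g := by
    simp only [ContinuousMap.add_apply, add_mul]
    exact intervalIntegral.integral_add (S.intervalIntegrable_mul_wt f)
      (S.intervalIntegrable_mul_wt g)
  map_smul' c f := by
    simp only [ContinuousMap.smul_apply, smul_eq_mul, mul_assoc, RingHom.id_apply]
    exact intervalIntegral.integral_const_mul c _

lemma functional_apply (f : C(Circle, ℂ)) : S.functional f =
    ∫ θ in (0 : ℝ)..(2 * π), f (Circle.exp θ) * (S.wt (circleMap 0 1 θ) : ℂ) := rfl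

lemma functional_mul_star (f : C(Circle, ℂ)) : S.functional (f * star f) =
    ((∫ θ in (0 : ℝ)..(2 * π), ‖f (Circle.exp θ)‖ ^ 2 * S.wt (circleMap 0 1 θ) : ℝ) : ℂ) := by
  rw [functional_apply, ← intervalIntegral.integral_ofReal]
  refine intervalIntegral.integral_congr fun θ _ => ?_
  simp [Complex.mul_conj, Complex.normSq_eq_norm_sq]

lemma intervalIntegrable_sq_norm_mul_wt (f : C(Circle, ℂ)) :
    IntervalIntegrable (fun θ : ℝ => ‖f (Circle.exp θ)‖ ^ 2 * S.wt (circleMap 0 1 θ)) volume 0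
      (2 * π) :=
  (S.intervalIntegrable_wt zero_le_one le_rfl 0 (2 * π)).continuousOn_mul (by fun_prop)

lemma two_pi_nonneg : (0 : ℝ) ≤ 2 * π := by positivity

lemma integral_sq_norm_mul_wt_pos {P : ℂ[X]} (hP : P ≠ 0) :
    0 < ∫ θ in (0 : ℝ)..(2 * π), ‖circleEval P (Circle.exp θ)‖ ^ 2 * S.wt (circleMap 0 1 θ) := by
  rw [intervalIntegral.integral_pos_iff_support_of_nonneg_ae
    (Eventually.of_forall fun θ => mul_nonneg (by positivity) (S.wt_nonneg _))
    (S.intervalIntegrable_sq_norm_mul_wt _)]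
  refine ⟨by positivity, ?_⟩
  set B : Set ℝ := circleMap 0 1 ⁻¹' (P.rootSet ℂ) ∪ S.bad with hB
  have hBc : B.Countable := by
    refine Countable.union ?_ S.countable_bad
    exact (P.rootSet_finite ℂ).countable.preimage_circleMap 0 one_ne_zero
  have h0 : volume (Ioc (0 : ℝ) (2 * π) \ B) = volume (Ioc (0 : ℝ) (2 * π)) :=
    measure_sdiff_null (hBc.measure_zero volume)
  refine lt_of_lt_of_le ?_ (measure_mono (?_ : Ioc (0 : ℝ) (2 * π) \ B ⊆ _))
  · rw [h0, Real.volume_Ioc]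
    simpa using Real.pi_pos
  · rintro θ ⟨hθ, hθB⟩
    refine ⟨?_, hθ⟩
    rw [hB, mem_union, not_or] at hθB
    have h1 : circleEval P (Circle.exp θ) ≠ 0 := by
      rw [circleEval_apply, circle_exp_eq_circleMap]
      intro h
      apply hθB.1
      rw [mem_preimage, mem_rootSet_of_ne hP]
      simpa using h
    have h2 := S.wt_pos (S.circleMap_ne_of_notMem_bad hθB.2)
    exact ne_of_gt (mul_pos (by positivity) h2)

/-- The orthogonal polynomials of the weight. -/
noncomputable def orthoSystem (Φ : ℕ → ℂ[X]) (hmonic : ∀ n, (Φ n).Monic)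
    (hdeg : ∀ n, (Φ n).natDegree = n)
    (horth : ∀ n, ∀ j < n, S.functional (circleEval (Φ n) * star (ζ ^ j)) = 0) :
    OrthoSystem where
  Λ := S.functional
  bd := ∫ θ in (0 : ℝ)..(2 * π), S.wt (circleMap 0 1 θ)
  norm_le f := by
    rw [functional_apply, mul_comm (intervalIntegral _ _ _ _), ← intervalIntegral.integral_const_mul]
    refine intervalIntegral.norm_integral_le_of_norm_le two_pi_nonneg
      (Eventually.of_forall fun θ _ => ?_)
      ((S.intervalIntegrable_wt zero_le_one le_rfl 0 (2 * π)).const_mul _)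
    rw [norm_mul, Complex.norm_real, Real.norm_of_nonneg (S.wt_nonneg _)]
    exact mul_le_mul_of_nonneg_right (f.norm_coe_le_norm _) (S.wt_nonneg _)
  map_star f := by
    rw [functional_apply, functional_apply, intervalIntegral.integral_of_le two_pi_nonneg,
      intervalIntegral.integral_of_le two_pi_nonneg, ← integral_conj]
    simp
  nonneg f := by
    rw [functional_mul_star, Complex.ofReal_re]
    exact intervalIntegral.integral_nonneg two_pi_nonneg fun θ _ =>
      mul_nonneg (by positivity) (S.wt_nonneg _)
  pos P hP := by
    rw [functional_mul_star, Complex.ofReal_re]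
    exact S.integral_sq_norm_mul_wt_pos hP
  Φ := Φ
  monic := hmonic
  natDegree_eq := hdeg
  orth := horth

lemma eventually_mem_Ioo : ∀ᶠ R in nhdsWithin (1 : ℝ) (Iio 1), R ∈ Ioo (0 : ℝ) 1 :=
  Ioo_mem_nhdsLT zero_lt_one

lemma tendsto_integral_wt_mul {f : ℂ → ℝ} (hf : Continuous f) :
    Tendsto (fun R : ℝ => ∫ θ in (0 : ℝ)..(2 * π), f (circleMap 0 R θ) * S.wt (circleMap 0 R θ))
      (nhdsWithin 1 (Iio 1))
      (nhds (∫ θ in (0 : ℝ)..(2 * π), f (circleMap 0 1 θ) * S.wt (circleMap 0 1 θ))) := by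
  obtain ⟨C, hC, hwt⟩ := S.exists_wt_le
  obtain ⟨M, hM⟩ := (isCompact_closedBall (0 : ℂ) 1).exists_bound_of_continuousOn hf.continuousOn
  have hM0 : 0 ≤ M := (norm_nonneg _).trans (hM 0 (by simp))
  refine intervalIntegral.tendsto_integral_filter_of_dominated_convergence
    (fun θ => M * (C * S.dom θ)) ?_ ?_
    (((S.intervalIntegrable_dom _ _).const_mul C).const_mul M) ?_
  · filter_upwards [eventually_mem_Ioo] with R hR
    refine Measurable.aestronglyMeasurable ?_
    exact (hf.comp (continuous_circleMap 0 R)).measurable.mul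
      (S.measurable_wt_circleMap hR.1.le hR.2.le)
  · filter_upwards [eventually_mem_Ioo] with R hR
    filter_upwards [S.ae_notMem_bad] with θ hθ _
    rw [norm_mul, Real.norm_of_nonneg (S.wt_nonneg _)]
    refine mul_le_mul (hM _ ?_) (hwt R θ hR.1.le hR.2.le hθ).1 (S.wt_nonneg _) hM0
    simpa [abs_of_pos hR.1] using hR.2.le
  · filter_upwards [S.ae_notMem_bad] with θ hθ _
    exact ((hf.tendsto _).comp (tendsto_circleMap θ)).mul (S.tendsto_wt hθ)

lemma tendsto_integral_wt_div :
    Tendsto (fun R : ℝ => ∫ θ in (0 : ℝ)..(2 * π),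
      S.wt (circleMap 0 1 θ) / S.wt (circleMap 0 R θ)) (nhdsWithin 1 (Iio 1)) (nhds (2 * π)) := by
  obtain ⟨C, hC, hwt⟩ := S.exists_wt_le
  have h : (2 * π : ℝ) = ∫ θ in (0 : ℝ)..(2 * π), (1 : ℝ) := by simp
  conv => enter [3, 1]; rw [h]
  refine intervalIntegral.tendsto_integral_filter_of_dominated_convergence
    (fun θ => C * S.dom θ) ?_ ?_ ((S.intervalIntegrable_dom _ _).const_mul C) ?_
  · filter_upwards [eventually_mem_Ioo] with R hR
    exact ((S.measurable_wt_circleMap zero_le_one le_rfl).div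
      (S.measurable_wt_circleMap hR.1.le hR.2.le)).aestronglyMeasurable
  · filter_upwards [eventually_mem_Ioo] with R hR
    filter_upwards [S.ae_notMem_bad] with θ hθ _
    rw [Real.norm_of_nonneg (div_nonneg (S.wt_nonneg _) (S.wt_nonneg _))]
    exact (hwt R θ hR.1.le hR.2.le hθ).2
  · filter_upwards [S.ae_notMem_bad] with θ hθ _
    have hne := (S.wt_pos (S.circleMap_ne_of_notMem_bad hθ)).ne'
    have := (tendsto_const_nhds (x := S.wt (circleMap 0 1 θ))).div (S.tendsto_wt hθ) hne
    rwa [div_self hne] at this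

variable (Φ : ℕ → ℂ[X]) (hmonic : ∀ n, (Φ n).Monic) (hdeg : ∀ n, (Φ n).natDegree = n)
  (horth : ∀ n, ∀ j < n, S.functional (circleEval (Φ n) * star (ζ ^ j)) = 0)

lemma sq_nrm_orthoSystem (f : C(Circle, ℂ)) :
    (S.orthoSystem Φ hmonic hdeg horth).nrm f ^ 2 =
      ∫ θ in (0 : ℝ)..(2 * π), ‖f (Circle.exp θ)‖ ^ 2 * S.wt (circleMap 0 1 θ) := by
  rw [OrthoSystem.sq_nrm, OrthoSystem.ip]
  change (S.functional (f * star f)).re = _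
  rw [functional_mul_star, Complex.ofReal_re]

lemma continuous_sq_nrm (T : OrthoSystem) : Continuous fun f => T.nrm f ^ 2 := by
  have h : Continuous T.Λ := (T.Λ.mkContinuous T.bd T.norm_le).continuous
  simp only [OrthoSystem.sq_nrm, OrthoSystem.ip]
  exact Complex.continuous_re.comp (h.comp (continuous_id.mul continuous_star))

lemma exists_polynomial_sq_nrm_lt {t : ℝ} (ht : 2 * π * ‖S.D 0‖ ^ 2 < t) :
    ∃ P : ℂ[X], P.coeff 0 = 1 ∧
      (S.orthoSystem Φ hmonic hdeg horth).nrm (circleEval P) ^ 2 < t := by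
  have hlim := S.tendsto_integral_wt_div.const_mul (‖S.D 0‖ ^ 2)
  rw [mul_comm] at ht
  obtain ⟨R, hRt, hR⟩ := ((hlim.eventually_lt_const ht).and eventually_mem_Ioo).exists
  have hball (z : ℂ) (hz : z ∈ ball (0 : ℂ) R⁻¹) : R * z ∈ ball (0 : ℂ) 1 := by
    rw [mem_ball_zero_iff] at hz ⊢
    rw [norm_mul, Complex.norm_real, Real.norm_of_nonneg hR.1.le]
    calc R * ‖z‖ < R * R⁻¹ := by gcongr; exact hR.1
      _ = 1 := mul_inv_cancel₀ hR.1.ne'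
  have hq : DifferentiableOn ℂ (fun z => S.D 0 / S.D (R * z)) (ball 0 R⁻¹) := by
    refine (differentiableOn_const _).div ?_ fun z _ => S.D_ne_zero _
    exact S.differentiableOn_D.comp (by fun_prop) hball
  have hR' : 1 < R⁻¹ := (one_lt_inv₀ hR.1).mpr hR.2
  have hqc : Continuous fun x : Circle => S.D 0 / S.D (R * (x : ℂ)) := by
    refine hq.continuousOn.comp_continuous (by fun_prop) fun x => ?_
    rwa [mem_ball_zero_iff, Circle.norm_coe]
  obtain ⟨P, hP0, hP⟩ := exists_polynomial_tendsto_circle hR' hq ⟨_, hqc⟩ fun _ => rfl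
  have hP2 := ((continuous_sq_nrm (S.orthoSystem Φ hmonic hdeg horth)).tendsto _).comp hP
  have hval : (S.orthoSystem Φ hmonic hdeg horth).nrm
      ⟨fun x : Circle => S.D 0 / S.D (R * (x : ℂ)), hqc⟩ ^ 2 < t := by
    rw [sq_nrm_orthoSystem]
    refine lt_of_eq_of_lt ?_ hRt
    rw [← intervalIntegral.integral_const_mul]
    refine intervalIntegral.integral_congr fun θ _ => ?_
    have : ‖circleMap 0 R θ‖ < 1 := by simpa [abs_of_pos hR.1] using hR.2
    simp only [ContinuousMap.coe_mk, circle_exp_eq_circleMap, ← circleMap_eq_mul, norm_div,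
      div_pow, S.sq_norm_D this]
    ring
  obtain ⟨n, hn⟩ := (hP2.eventually_lt_const hval).exists
  exact ⟨P n, by rw [hP0, mul_zero, div_self (S.D_ne_zero 0)], hn⟩

lemma tendsto_circleAverage_sq_norm (P : ℂ[X]) :
    Tendsto (fun R : ℝ => 2 * π * Real.circleAverage (fun z => ‖P.eval z * S.D z‖ ^ 2) 0 R)
      (nhdsWithin 1 (Iio 1))
      (nhds ((S.orthoSystem Φ hmonic hdeg horth).nrm (circleEval P) ^ 2)) := by
  rw [sq_nrm_orthoSystem]
  simp only [circleEval_apply, circle_exp_eq_circleMap]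
  refine (S.tendsto_integral_wt_mul (f := fun z => ‖P.eval z‖ ^ 2)
    (P.continuous.norm.pow 2)).congr' ?_
  filter_upwards [eventually_mem_Ioo] with R hR
  rw [Real.circleAverage_def, smul_eq_mul, ← mul_assoc, mul_inv_cancel₀ (by positivity), one_mul]
  refine intervalIntegral.integral_congr fun θ _ => ?_
  have : ‖circleMap 0 R θ‖ < 1 := by simpa [abs_of_pos hR.1] using hR.2
  simp only [norm_mul, mul_pow, S.sq_norm_D this]

end SingularWeight

lemma circleAverage_conj (f : ℂ → ℂ) (c : ℂ) (R : ℝ) :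
    Real.circleAverage (fun z => conj (f z)) c R = conj (Real.circleAverage f c R) := by
  rw [Real.circleAverage_def, Real.circleAverage_def,
    intervalIntegral.integral_of_le (by positivity), intervalIntegral.integral_of_le (by positivity),
    integral_conj, Complex.real_smul, Complex.real_smul, map_mul, Complex.conj_ofReal]

/-- The Schwarz integral formula on a circle inside the unit disk. -/
lemma circleAverage_re_mul_schwarz {f : ℂ → ℂ} (hf : DifferentiableOn ℂ f (ball 0 1))
    (hf0 : (f 0).im = 0) {R : ℝ} (hR : R ∈ Ioo (0 : ℝ) 1) {x : ℂ} (hx : ‖x‖ < R) :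
    Real.circleAverage (fun z => ((2 * (f z).re : ℝ) : ℂ) * ((z + x) / (z - x))) 0 R
      = 2 * f x := by
  have hR1 : |R| < 1 := by rw [abs_of_pos hR.1]; exact hR.2
  have hne (z : ℂ) (hz : z ∈ sphere (0 : ℂ) |R|) : z - x ≠ 0 := by
    rw [mem_sphere_zero_iff_norm, abs_of_pos hR.1] at hz
    rw [sub_ne_zero]
    rintro rfl
    exact hx.ne hz
  have hsub : closedBall (0 : ℂ) |R| ⊆ ball 0 1 := closedBall_subset_ball hR1
  have hden (z : ℂ) (hz : z ∈ closedBall (0 : ℂ) |R|) : (R : ℂ) ^ 2 - conj x * z ≠ 0 := by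
    intro h
    rw [mem_closedBall_zero_iff, abs_of_pos hR.1] at hz
    have h1 : ‖(R : ℂ) ^ 2‖ = ‖conj x * z‖ := by rw [sub_eq_zero.mp h]
    rw [norm_pow, Complex.norm_real, Real.norm_of_nonneg hR.1.le, norm_mul, RCLike.norm_conj] at h1
    have h2 := hR.1
    nlinarith [norm_nonneg x, norm_nonneg z]
  have hfc : ContinuousOn f (sphere 0 |R|) :=
    hf.continuousOn.mono (sphere_subset_closedBall.trans hsub)
  have hk : DifferentiableOn ℂ
      (fun z => f z * (((R : ℂ) ^ 2 + conj x * z) / ((R : ℂ) ^ 2 - conj x * z)))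
      (closedBall 0 |R|) := by
    refine (hf.mono hsub).mul (DifferentiableOn.div (by fun_prop) (by fun_prop) hden)
  have e1 : Real.circleAverage (fun z => (2 : ℂ) • ((z - 0) / (z - x)) • f z) 0 R = 2 * f x := by
    rw [Real.circleAverage_fun_smul, smul_eq_mul,
      (diffContOnCl_of_differentiableOn_ball hf hR.1.le hR.2).circleAverage_smul_div]
    rw [mem_ball_zero_iff, abs_of_pos hR.1]
    exact hx
  have e2 : Real.circleAverage f 0 R = f 0 :=
    (diffContOnCl_of_differentiableOn_ball hf hR.1.le hR.2).circleAverage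
  have e3 : Real.circleAverage (fun z => conj (f z * (((R : ℂ) ^ 2 + conj x * z) /
      ((R : ℂ) ^ 2 - conj x * z)))) 0 R = f 0 := by
    rw [circleAverage_conj, DiffContOnCl.circleAverage]
    · have : (R : ℂ) ≠ 0 := by exact_mod_cast hR.1.ne'
      rw [mul_zero, add_zero, sub_zero, div_self (pow_ne_zero 2 this), mul_one]
      exact Complex.conj_eq_iff_im.mpr hf0
    · exact (hk.mono closure_ball_subset_closedBall).diffContOnCl
  have i1 : CircleIntegrable (fun z => (2 : ℂ) • ((z - 0) / (z - x)) • f z) 0 R := by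
    refine ContinuousOn.circleIntegrable' ?_
    have h1 : ContinuousOn (fun z : ℂ => (z - 0) / (z - x)) (sphere 0 |R|) :=
      ContinuousOn.div (by fun_prop) (by fun_prop) hne
    exact (h1.smul hfc).const_smul (2 : ℂ)
  have i2 : CircleIntegrable f 0 R := hfc.circleIntegrable'
  have i3 : CircleIntegrable (fun z => conj (f z * (((R : ℂ) ^ 2 + conj x * z) /
      ((R : ℂ) ^ 2 - conj x * z)))) 0 R := by
    refine ContinuousOn.circleIntegrable' ?_
    exact Complex.continuous_conj.comp_continuousOn
      (hk.continuousOn.mono sphere_subset_closedBall)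
  have i12 : CircleIntegrable (fun z => (2 : ℂ) • ((z - 0) / (z - x)) • f z - f z) 0 R :=
    i1.sub i2
  calc Real.circleAverage (fun z => ((2 * (f z).re : ℝ) : ℂ) * ((z + x) / (z - x))) 0 R
      = Real.circleAverage (fun z => ((2 : ℂ) • ((z - 0) / (z - x)) • f z - f z) +
          conj (f z * (((R : ℂ) ^ 2 + conj x * z) / ((R : ℂ) ^ 2 - conj x * z)))) 0 R := by
        refine Real.circleAverage_congr_sphere fun z hz => ?_
        have h1 := hne z hz
        have h2 := hden z (sphere_subset_closedBall hz)
        rw [mem_sphere_zero_iff_norm, abs_of_pos hR.1] at hz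
        have hzz : (R : ℂ) ^ 2 = z * conj z := by
          rw [Complex.mul_conj, Complex.normSq_eq_norm_sq, hz]
          push_cast
          rfl
        have h4 : conj ((R : ℂ) ^ 2 + conj x * z) / conj ((R : ℂ) ^ 2 - conj x * z) =
            (z + x) / (z - x) := by
          have h3 : conj z ≠ 0 := by
            intro h0
            rw [h0, mul_zero] at hzz
            exact pow_ne_zero 2 (by exact_mod_cast hR.1.ne') hzz
          have hc : conj ((R : ℂ) ^ 2) = z * conj z := by rw [hzz, map_mul, Complex.conj_conj]; ring
          rw [map_add, map_sub, hc, map_mul, Complex.conj_conj, ← add_mul, ← sub_mul,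
            mul_div_mul_right _ _ h3]
        have h5 : ((2 * (f z).re : ℝ) : ℂ) = f z + conj (f z) := (Complex.add_conj _).symm
        simp only [map_mul, map_div₀, h4, h5, smul_eq_mul, sub_zero]
        field_simp
        ring
    _ = _ := by
      rw [Real.circleAverage_fun_add i12 i3, Real.circleAverage_fun_sub i1 i2, e1, e2, e3]
      ring

namespace SingularWeight

variable {m : ℕ} (S : SingularWeight m)

lemma log_wt {z : ℂ} (h : ∀ k, z ≠ S.a k) : Real.log (S.wt z) =
    2 * (S.g z).re + ∑ k, 2 * S.β k * Real.log ‖1 - z * conj (S.a k)‖ := by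
  have h1 (k : Fin m) : 0 < ‖1 - z * conj (S.a k)‖ := norm_pos_iff.mpr (S.one_sub_ne_zero h k)
  unfold wt
  rw [Real.log_mul (Real.exp_pos _).ne', Real.log_exp, Real.log_prod]
  · congr 1
    exact Finset.sum_congr rfl fun k _ => Real.log_rpow (h1 k) _
  · exact fun k _ => (Real.rpow_pos_of_pos (h1 k) _).ne'
  · exact Finset.prod_ne_zero_iff.mpr fun k _ => (Real.rpow_pos_of_pos (h1 k) _).ne'

lemma log_wt_eq_re_L {z : ℂ} (hz : ‖z‖ < 1) : Real.log (S.wt z) = 2 * (S.L z).re := by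
  rw [← S.sq_norm_D hz, D, Complex.norm_exp, Real.log_pow, Real.log_exp]
  norm_num

lemma im_L_zero : (S.L 0).im = 0 := by
  simp [L, S.im_g_zero]

lemma exists_abs_log_wt_le : ∃ C : ℝ, 0 ≤ C ∧ ∀ r θ : ℝ, 0 ≤ r → r ≤ 1 → θ ∉ S.bad →
    |Real.log (S.wt (circleMap 0 r θ))| ≤
      C + ∑ k, 2 * |S.β k| * |Real.log ‖circleMap 0 1 θ - S.a k‖| := by
  obtain ⟨G, hG⟩ := S.exists_norm_g_le
  have hG0 : 0 ≤ G := (norm_nonneg _).trans (hG 0 (by simp))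
  have hlog : 0 < Real.log 2 := Real.log_pos one_lt_two
  refine ⟨2 * G + ∑ k, 2 * |S.β k| * (2 * Real.log 2), by positivity, fun r θ h0 h1 hθ => ?_⟩
  have hr := (Complex.abs_re_le_norm _).trans
    (hG (circleMap 0 r θ) (by simpa [abs_of_nonneg h0] using h1))
  have hne (k : Fin m) : circleMap 0 r θ ≠ S.a k := by
    intro h
    rcases h1.lt_or_eq with h1 | h1
    · exact S.ne_a_of_norm_lt (by simpa [abs_of_nonneg h0] using h1) k h
    · exact S.circleMap_ne_of_notMem_bad hθ k (h1 ▸ h)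
  rw [S.log_wt hne, add_assoc, ← Finset.sum_add_distrib]
  refine (abs_add_le _ _).trans (add_le_add ?_ ?_)
  · rw [abs_mul, abs_two]
    linarith
  · refine (Finset.abs_sum_le_sum_abs _ _).trans (Finset.sum_le_sum fun k _ => ?_)
    rw [← mul_add, abs_mul, abs_mul, abs_two, ← S.norm_one_sub, circleMap_mul_conj_a]
    exact mul_le_mul_of_nonneg_left (abs_log_norm_one_sub_le (S.norm_circleMap_mul_conj_a θ k)
      (S.circleMap_mul_conj_a_ne_one hθ k) h0 h1) (by positivity)

/-- The Schwarz integral formula for the logarithm of the Szegő function. -/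
lemma integral_log_wt_mul_schwarz {x : ℂ} (hx : ‖x‖ < 1) :
    ∫ θ in (0 : ℝ)..(2 * π), (Real.log (S.wt (circleMap 0 1 θ)) : ℂ) *
      ((circleMap 0 1 θ + x) / (circleMap 0 1 θ - x)) = 4 * π * S.L x := by
  obtain ⟨C, hC, hlog⟩ := S.exists_abs_log_wt_le
  obtain ⟨r0, hr0, hr0'⟩ := exists_between hx
  have hev : ∀ᶠ R in nhdsWithin (1 : ℝ) (Iio 1), R ∈ Ioo r0 1 := Ioo_mem_nhdsLT hr0'
  have hr0pos : 0 < r0 := (norm_nonneg x).trans_lt hr0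
  have hgap (R θ : ℝ) (hR : R ∈ Ioo r0 1) : r0 - ‖x‖ ≤ ‖circleMap 0 R θ - x‖ := by
    have h1 := norm_sub_norm_le (circleMap 0 R θ) x
    rw [norm_circleMap_zero, abs_of_pos (hr0pos.trans hR.1)] at h1
    linarith [hR.1]
  have hlim : Tendsto (fun R : ℝ => ∫ θ in (0 : ℝ)..(2 * π),
      (Real.log (S.wt (circleMap 0 R θ)) : ℂ) * ((circleMap 0 R θ + x) / (circleMap 0 R θ - x)))
      (nhdsWithin 1 (Iio 1)) (nhds (∫ θ in (0 : ℝ)..(2 * π),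
      (Real.log (S.wt (circleMap 0 1 θ)) : ℂ) *
        ((circleMap 0 1 θ + x) / (circleMap 0 1 θ - x)))) := by
    refine intervalIntegral.tendsto_integral_filter_of_dominated_convergence
      (fun θ => (C + ∑ k, 2 * |S.β k| * |Real.log ‖circleMap 0 1 θ - S.a k‖|) *
        (2 / (r0 - ‖x‖))) ?_ ?_ ?_ ?_
    · filter_upwards [hev] with R hR
      have hR0 := hr0pos.trans hR.1
      have h1 := (S.measurable_wt_circleMap hR0.le hR.2.le).log
      have h2 : Measurable fun θ : ℝ => (circleMap 0 R θ + x) / (circleMap 0 R θ - x) :=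
        ((continuous_circleMap 0 R).measurable.add_const x).div
          ((continuous_circleMap 0 R).measurable.sub_const x)
      exact ((Complex.measurable_ofReal.comp h1).mul h2).aestronglyMeasurable
    · filter_upwards [hev] with R hR
      filter_upwards [S.ae_notMem_bad] with θ hθ _
      have hR0 := hr0pos.trans hR.1
      have h1 := hlog R θ hR0.le hR.2.le hθ
      rw [norm_mul, Complex.norm_real, norm_div]
      refine mul_le_mul h1 ?_ (by positivity) ((abs_nonneg _).trans h1)
      refine div_le_div₀ zero_le_two ?_ (sub_pos.mpr hr0) (hgap R θ hR)
      refine (norm_add_le _ _).trans ?_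
      rw [norm_circleMap_zero, abs_of_pos hR0]
      linarith [hR.2]
    · refine IntervalIntegrable.mul_const (intervalIntegrable_const.add ?_) _
      have h1 (k : Fin m) : IntervalIntegrable
          (fun θ => 2 * |S.β k| * |Real.log ‖circleMap 0 1 θ - S.a k‖|) volume 0 (2 * π) :=
        (IntervalIntegrable.abs (circleIntegrable_log_norm_sub_const (a := S.a k) (c := 0) 1)).const_mul _
      exact (IntervalIntegrable.sum Finset.univ fun k _ => h1 k).congr fun θ _ => by simp
    · filter_upwards [S.ae_notMem_bad] with θ hθ _
      have hne := (S.wt_pos (S.circleMap_ne_of_notMem_bad hθ)).ne'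
      have h1 := ((Real.continuousAt_log hne).tendsto.comp (S.tendsto_wt hθ)).ofReal
      have h2 := tendsto_circleMap θ
      refine h1.mul ((h2.add_const x).div (h2.sub_const x) ?_)
      rw [sub_ne_zero]
      intro h
      rw [← h, norm_circleMap_one] at hx
      exact lt_irrefl _ hx
  refine tendsto_nhds_unique hlim (tendsto_const_nhds.congr' ?_)
  filter_upwards [hev] with R hR
  have hR0 : R ∈ Ioo (0 : ℝ) 1 := ⟨hr0pos.trans hR.1, hR.2⟩
  have h1 := circleAverage_re_mul_schwarz S.differentiableOn_L S.im_L_zero hR0 (hr0.trans hR.1)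
  rw [Real.circleAverage_def] at h1
  have h2 : ∫ θ in (0 : ℝ)..(2 * π), (Real.log (S.wt (circleMap 0 R θ)) : ℂ) *
      ((circleMap 0 R θ + x) / (circleMap 0 R θ - x)) =
      ∫ θ in (0 : ℝ)..(2 * π), ((2 * (S.L (circleMap 0 R θ)).re : ℝ) : ℂ) *
      ((circleMap 0 R θ + x) / (circleMap 0 R θ - x)) := by
    refine intervalIntegral.integral_congr fun θ _ => ?_
    have : ‖circleMap 0 R θ‖ < 1 := by simpa [abs_of_pos hR0.1] using hR.2
    simp only [S.log_wt_eq_re_L this]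
  rw [h2]
  have h3 : (2 * π : ℝ) ≠ 0 := by positivity
  rw [inv_smul_eq_iff₀ h3] at h1
  rw [h1, Complex.real_smul]
  push_cast
  ring

end SingularWeight

lemma HasDerivAt.re_of_real {f : ℝ → ℂ} {f' : ℂ} {x : ℝ} (h : HasDerivAt f f' x) :
    HasDerivAt (fun t => (f t).re) f'.re x :=
  Complex.reCLM.hasFDerivAt.comp_hasDerivAt x h

lemma HasDerivAt.comp_circleMap {f : ℂ → ℂ} {f' : ℂ} {θ : ℝ}
    (h : HasDerivAt f f' (circleMap 0 1 θ)) :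
    HasDerivAt (fun t => f (circleMap 0 1 t)) (f' * (circleMap 0 1 θ * Complex.I)) θ :=
  HasDerivAt.comp θ h (hasDerivAt_circleMap 0 1 θ)

lemma HasDerivAt.log_norm {f : ℝ → ℂ} {f' : ℂ} {x : ℝ} (h : HasDerivAt f f' x) (h0 : f x ≠ 0) :
    HasDerivAt (fun t => Real.log ‖f t‖) (f' / f x).re x := by
  have h1 := (h.norm_sq.log (pow_ne_zero 2 (norm_ne_zero_iff.mpr h0))).const_mul (1 / 2 : ℝ)
  have h2 : (fun t => (1 / 2 : ℝ) * Real.log (‖f t‖ ^ 2)) = fun t => Real.log ‖f t‖ := by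
    funext t
    rw [Real.log_pow]
    push_cast
    ring
  rw [h2] at h1
  refine h1.congr_deriv ?_
  have h3 : ‖f x‖ ≠ 0 := norm_ne_zero_iff.mpr h0
  have h4 : f' / f x = ((‖f x‖ ^ 2)⁻¹ : ℝ) * (conj (f x) * f') := by
    have h5 : f x * conj (f x) = (‖f x‖ ^ 2 : ℝ) := by
      rw [Complex.mul_conj, Complex.normSq_eq_norm_sq]
    have h6 : conj (f x) ≠ 0 := (_root_.map_ne_zero _).mpr h0
    rw [Complex.ofReal_inv, ← h5]
    field_simp
  rw [h4, Complex.re_ofReal_mul, Complex.inner]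
  ring_nf

lemma continuous_rpow_norm_mul_conj {b : ℝ} (hb : -1 < b) :
    Continuous fun u : ℂ => ((‖u‖ ^ b : ℝ) : ℂ) * conj u := by
  refine continuous_iff_continuousAt.mpr fun u => ?_
  by_cases hu : u = 0
  · subst hu
    have h1 : ContinuousAt (fun u : ℂ => ‖u‖ ^ (b + 1)) 0 :=
      continuous_norm.continuousAt.rpow_const (Or.inr (by linarith))
    have h2 : Tendsto (fun u : ℂ => ‖u‖ ^ (b + 1)) (nhds 0) (nhds 0) := by
      have := h1.tendsto
      rwa [norm_zero, Real.zero_rpow (by linarith)] at this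
    have h3 : Tendsto (fun u : ℂ => ((‖u‖ ^ b : ℝ) : ℂ) * conj u) (nhds 0) (nhds 0) := by
      refine squeeze_zero_norm (fun u => ?_) h2
      rw [norm_mul, Complex.norm_real, Real.norm_of_nonneg (by positivity), RCLike.norm_conj]
      by_cases hu : u = 0
      · simp [hu, Real.zero_rpow (show b + 1 ≠ 0 by linarith)]
      · rw [Real.rpow_add_one (norm_ne_zero_iff.mpr hu)]
    unfold ContinuousAt
    simpa using h3
  · have h1 : ContinuousAt (fun u : ℂ => ‖u‖ ^ b) u :=
      continuous_norm.continuousAt.rpow_const (Or.inl (norm_ne_zero_iff.mpr hu))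
    exact (Complex.continuous_ofReal.continuousAt.comp h1).mul Complex.continuous_conj.continuousAt

lemma conj_eq_inv_of_norm_eq_one {z : ℂ} (hz : ‖z‖ = 1) : conj z = z⁻¹ :=
  (Complex.inv_eq_conj hz).symm

lemma conj_add_div_sub {z a : ℂ} (hz : ‖z‖ = 1) (ha : ‖a‖ = 1) (hza : z ≠ a) :
    conj ((z + a) / (z - a)) = -((z + a) / (z - a)) := by
  have h1 : z ≠ 0 := by rintro rfl; simp at hz
  have h2 : a ≠ 0 := by rintro rfl; simp at ha
  have h3 : z - a ≠ 0 := sub_ne_zero.mpr hza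
  have h4 : z⁻¹ - a⁻¹ = -(z - a) * (z⁻¹ * a⁻¹) := by field_simp; ring
  have h5 : z⁻¹ + a⁻¹ = (z + a) * (z⁻¹ * a⁻¹) := by field_simp; ring
  rw [map_div₀, map_add, map_sub, conj_eq_inv_of_norm_eq_one hz, conj_eq_inv_of_norm_eq_one ha,
    h4, h5, mul_div_mul_right _ _ (by positivity), div_neg]

namespace SingularWeight

variable {m : ℕ} (S : SingularWeight m)

lemma continuousOn_p : ContinuousOn S.p (ball 0 S.R) := by
  have h1 : DifferentiableOn ℂ S.g (ball 0 S.R) := fun z hz =>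
    (S.hasDerivAt_g z (by simpa using hz)).differentiableAt.differentiableWithinAt
  refine (h1.deriv isOpen_ball).continuousOn.congr fun z hz => ?_
  exact (S.hasDerivAt_g z (by simpa using hz)).deriv.symm

/-- The logarithmic derivative of the smooth part of the weight. -/
noncomputable def v : C(Circle, ℂ) where
  toFun x := x * S.p x - conj (x * S.p x)
  continuous_toFun := by
    have h : Continuous fun x : Circle => S.p x := by
      refine S.continuousOn_p.comp_continuous (by fun_prop) fun x => ?_
      rw [mem_ball_zero_iff, Circle.norm_coe]
      exact S.one_lt_R
    fun_prop

lemma v_apply (x : Circle) : S.v x = x * S.p x - conj (x * S.p x) := rfl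

lemma star_v : star S.v = -S.v := by
  ext x
  simp [v_apply]

lemma Cv_nonneg : 0 ≤ S.Cv := by simpa using (norm_nonneg _).trans (S.c_le 0)

lemma hasSum_v : HasSum (fun m : ℕ => S.c m • ζ ^ (m + 1) - conj (S.c m) • star (ζ ^ (m + 1)))
    S.v := by
  have hsum : Summable fun m : ℕ =>
      S.c m • ζ ^ (m + 1) - conj (S.c m) • star (ζ ^ (m + 1)) := by
    refine Summable.of_norm_bounded (g := fun m => 2 * S.Cv * S.s ^ m)
      ((summable_geometric_of_lt_one S.s_nonneg S.s_lt).mul_left _) fun m => ?_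
    rw [ContinuousMap.norm_le _
      (mul_nonneg (mul_nonneg zero_le_two S.Cv_nonneg) (pow_nonneg S.s_nonneg _))]
    intro x
    refine (norm_sub_le _ _).trans ?_
    simp only [ContinuousMap.smul_apply, ContinuousMap.star_apply, ContinuousMap.pow_apply,
      circleCoord_apply, smul_eq_mul, norm_mul, norm_star, norm_pow, Circle.norm_coe,
      RCLike.norm_conj, one_pow, mul_one]
    linarith [S.c_le m]
  convert hsum.hasSum
  ext x
  have h1 := ContinuousMap.hasSum_apply hsum.hasSum x
  refine HasSum.unique ?_ h1
  have h2 := (S.hasSum_p x (by rw [Circle.norm_coe]; exact S.one_lt_R)).mul_left (x : ℂ)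
  have h3 := h2.sub (Complex.hasSum_conj'.mpr h2)
  rw [v_apply]
  refine Eq.subst (motive := fun f => HasSum f _) (funext fun n => Eq.symm ?_) h3
  simp only [ContinuousMap.sub_apply, ContinuousMap.smul_apply, ContinuousMap.star_apply,
    ContinuousMap.pow_apply, circleCoord_apply, smul_eq_mul, map_mul, map_pow, star_pow]
  simp only [starRingEnd_apply]
  ring

lemma isOpen_compl_bad : IsOpen S.badᶜ := by
  have h : S.bad = circleMap 0 1 ⁻¹' Set.range S.a := by
    ext θ
    simp [bad, eq_comm]
  rw [h]
  exact ((Set.finite_range S.a).isClosed.preimage (continuous_circleMap 0 1)).isOpen_compl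

lemma hasDerivAt_wt {θ : ℝ} (hθ : θ ∉ S.bad) :
    HasDerivAt (fun t => (S.wt (circleMap 0 1 t) : ℂ))
      (S.wt (circleMap 0 1 θ) * (Complex.I * (S.v (Circle.exp θ) +
        ∑ k, S.β k * ((circleMap 0 1 θ + S.a k) / (circleMap 0 1 θ - S.a k))))) θ := by
  set z := circleMap 0 1 θ with hz
  have hz1 : ‖z‖ = 1 := by simp [hz]
  have hne := S.circleMap_ne_of_notMem_bad hθ
  have hg : HasDerivAt (fun t => 2 * (S.g (circleMap 0 1 t)).re)
      (2 * (S.p z * (z * Complex.I)).re) θ :=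
    (S.hasDerivAt_g z (hz1.trans_lt S.one_lt_R)).comp_circleMap.re_of_real.const_mul 2
  have hk (k : Fin m) : HasDerivAt
      (fun t => 2 * S.β k * Real.log ‖1 - circleMap 0 1 t * conj (S.a k)‖)
      (2 * S.β k * (Complex.I * z / (z - S.a k)).re) θ := by
    have h1 := (((hasDerivAt_circleMap 0 1 θ).mul_const (conj (S.a k))).const_sub 1)
    have h2 := (h1.log_norm (S.one_sub_ne_zero hne k)).const_mul (2 * S.β k)
    refine h2.congr_deriv ?_
    congr 2
    rw [← hz, div_eq_div_iff (S.one_sub_ne_zero hne k) (sub_ne_zero.mpr (hne k))]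
    linear_combination (z * Complex.I) * S.mul_conj_a k
  have hlog : HasDerivAt (fun t => Real.log (S.wt (circleMap 0 1 t)))
      (2 * (S.p z * (z * Complex.I)).re + ∑ k, 2 * S.β k * (Complex.I * z / (z - S.a k)).re) θ := by
    refine (hg.add (HasDerivAt.fun_sum fun k _ => hk k)).congr_of_eventuallyEq ?_
    filter_upwards [S.isOpen_compl_bad.mem_nhds hθ] with t ht
    exact S.log_wt (S.circleMap_ne_of_notMem_bad ht)
  have hexp := hlog.exp.ofReal_comp
  have hev : (fun t => ((Real.exp (Real.log (S.wt (circleMap 0 1 t))) : ℝ) : ℂ)) =ᶠ[nhds θ]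
      fun t => (S.wt (circleMap 0 1 t) : ℂ) := by
    filter_upwards [S.isOpen_compl_bad.mem_nhds hθ] with t ht
    rw [Real.exp_log (S.wt_pos (S.circleMap_ne_of_notMem_bad ht))]
  refine (hexp.congr_of_eventuallyEq hev.symm).congr_deriv ?_
  rw [Real.exp_log (S.wt_pos hne), ← hz]
  push_cast
  congr 1
  rw [mul_add, v_apply, circle_exp_eq_circleMap, ← hz, Finset.mul_sum]
  have htwo (u : ℂ) : 2 * (u.re : ℂ) = u + conj u := by
    rw [Complex.add_conj]
    push_cast
    ring
  congr 1
  · rw [htwo]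
    simp only [map_mul, Complex.conj_I]
    ring
  · refine Finset.sum_congr rfl fun k _ => ?_
    have h1 := conj_add_div_sub hz1 (S.norm_a k) (hne k)
    have h2 : z - S.a k ≠ 0 := sub_ne_zero.mpr (hne k)
    have h3 : Complex.I * z / (z - S.a k) =
        Complex.I / 2 * ((z + S.a k) / (z - S.a k)) + Complex.I / 2 := by
      field_simp
      ring
    have h5 : conj (2 : ℂ) = 2 := map_ofNat _ 2
    have h6 : Complex.I * z / (z - S.a k) + conj (Complex.I * z / (z - S.a k)) =
        Complex.I * ((z + S.a k) / (z - S.a k)) := by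
      rw [h3, map_add, map_mul, h1, map_div₀, Complex.conj_I, h5]
      ring
    rw [mul_comm (2 : ℂ), mul_assoc, htwo, h6]
    ring

end SingularWeight

lemma Polynomial.exists_eq_prod_X_sub_C_mul {m : ℕ} {a : Fin m → ℂ} (ha : Function.Injective a)
    {Q : ℂ[X]} (hQ : ∀ k, Q.eval (a k) = 0) : ∃ q, Q = (∏ k, (X - C (a k))) * q := by
  refine Finset.prod_dvd_of_coprime ?_ fun k _ => dvd_iff_isRoot.mpr (hQ k)
  exact (pairwise_coprime_X_sub_C ha).set_pairwise _

lemma Polynomial.hasDerivAt_eval_circleMap (P : ℂ[X]) (θ : ℝ) :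
    HasDerivAt (fun t => P.eval (circleMap 0 1 t))
      (P.derivative.eval (circleMap 0 1 θ) * (circleMap 0 1 θ * Complex.I)) θ :=
  (P.hasDerivAt (circleMap 0 1 θ)).comp_circleMap

lemma HasDerivAt.conj_of_real {f : ℝ → ℂ} {f' : ℂ} {x : ℝ} (h : HasDerivAt f f' x) :
    HasDerivAt (fun t => conj (f t)) (conj f') x :=
  Complex.conjCLE.toContinuousLinearMap.hasFDerivAt.comp_hasDerivAt x h

namespace SingularWeight

variable {m : ℕ} (S : SingularWeight m)

lemma continuous_wt_mul_conj {Q : ℂ[X]} (hQ : ∀ k, Q.eval (S.a k) = 0) :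
    Continuous fun θ : ℝ =>
      (S.wt (circleMap 0 1 θ) : ℂ) * conj (Q.eval (circleMap 0 1 θ)) := by
  obtain ⟨q, rfl⟩ := exists_eq_prod_X_sub_C_mul S.a_inj hQ
  have h1 (k : Fin m) : Continuous fun θ : ℝ =>
      ((‖circleMap 0 1 θ - S.a k‖ ^ (2 * S.β k) : ℝ) : ℂ) * conj (circleMap 0 1 θ - S.a k) :=
    (continuous_rpow_norm_mul_conj (b := 2 * S.β k) (by linarith [S.β_gt k])).comp
      ((continuous_circleMap 0 1).sub continuous_const)
  have h2 := S.continuous_g_circleMap zero_le_one le_rfl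
  have h3 : Continuous fun θ : ℝ => ((Real.exp (2 * (S.g (circleMap 0 1 θ)).re) : ℝ) : ℂ) *
      conj (q.eval (circleMap 0 1 θ)) * ∏ k, (((‖circleMap 0 1 θ - S.a k‖ ^ (2 * S.β k) : ℝ) : ℂ) *
        conj (circleMap 0 1 θ - S.a k)) := by
    refine Continuous.mul (Continuous.mul ?_ ?_) (continuous_finsetProd _ fun k _ => h1 k)
    · exact Complex.continuous_ofReal.comp (Real.continuous_exp.comp
        (continuous_const.mul (Complex.continuous_re.comp h2)))
    · exact Complex.continuous_conj.comp (q.continuous.comp (continuous_circleMap 0 1))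
  refine h3.congr fun θ => ?_
  rw [Finset.prod_mul_distrib, wt]
  simp only [norm_one_sub, eval_mul, eval_prod, eval_sub, eval_X, eval_C, map_mul, map_prod,
    Complex.ofReal_mul, Complex.ofReal_prod]
  ring

lemma functional_ibp (P : ℂ[X]) {Q : ℂ[X]} (hQ : ∀ k, Q.eval (S.a k) = 0) {q : Fin m → ℂ[X]}
    (hq : ∀ k, Q = (X - C (S.a k)) * q k) :
    S.functional ((ζ * circleEval (derivative P) + S.v * circleEval P) * star (circleEval Q) -
      circleEval P * star (circleEval (X * derivative Q +
        ∑ k, C (S.β k : ℂ) * (q k * (X + C (S.a k)))))) = 0 := by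
  set f := (ζ * circleEval (derivative P) + S.v * circleEval P) * star (circleEval Q) -
      circleEval P * star (circleEval (X * derivative Q +
        ∑ k, C (S.β k : ℂ) * (q k * (X + C (S.a k))))) with hf
  have hB : Continuous fun θ : ℝ => P.eval (circleMap 0 1 θ) *
      ((S.wt (circleMap 0 1 θ) : ℂ) * conj (Q.eval (circleMap 0 1 θ))) :=
    (P.continuous.comp (continuous_circleMap 0 1)).mul (S.continuous_wt_mul_conj hQ)
  have hderiv (θ : ℝ) (hθ : θ ∉ S.bad) : HasDerivAt (fun θ : ℝ => P.eval (circleMap 0 1 θ) *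
      ((S.wt (circleMap 0 1 θ) : ℂ) * conj (Q.eval (circleMap 0 1 θ))))
      ((Complex.I • f) (Circle.exp θ) * S.wt (circleMap 0 1 θ)) θ := by
    have h1 := (P.hasDerivAt_eval_circleMap θ).mul
      ((S.hasDerivAt_wt hθ).mul (Q.hasDerivAt_eval_circleMap θ).conj_of_real)
    refine h1.congr_deriv ?_
    have hne := S.circleMap_ne_of_notMem_bad hθ
    have h2 (k : Fin m) : (circleMap 0 1 θ + S.a k) / (circleMap 0 1 θ - S.a k) *
        conj (Q.eval (circleMap 0 1 θ)) =
        -conj ((q k).eval (circleMap 0 1 θ) * (circleMap 0 1 θ + S.a k)) := by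
      have h3 : (q k).eval (circleMap 0 1 θ) * (circleMap 0 1 θ + S.a k) =
          (circleMap 0 1 θ + S.a k) / (circleMap 0 1 θ - S.a k) * Q.eval (circleMap 0 1 θ) := by
        have h4 := sub_ne_zero.mpr (hne k)
        rw [hq k]
        simp only [eval_mul, eval_sub, eval_X, eval_C]
        field_simp
      rw [h3, map_mul, conj_add_div_sub (by simp) (S.norm_a k) (hne k)]
      ring
    have h5 : (∑ k, S.β k * ((circleMap 0 1 θ + S.a k) / (circleMap 0 1 θ - S.a k))) *
        conj (Q.eval (circleMap 0 1 θ)) =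
        -conj (∑ k, S.β k * ((q k).eval (circleMap 0 1 θ) * (circleMap 0 1 θ + S.a k))) := by
      rw [Finset.sum_mul, map_sum, ← Finset.sum_neg_distrib]
      refine Finset.sum_congr rfl fun k _ => ?_
      rw [mul_assoc, h2, map_mul conj (S.β k : ℂ), Complex.conj_ofReal]
      ring
    simp only [hf, ContinuousMap.smul_apply, ContinuousMap.sub_apply, ContinuousMap.mul_apply,
      ContinuousMap.add_apply, ContinuousMap.star_apply, circleEval_apply, circleCoord_apply,
      smul_eq_mul, circle_exp_eq_circleMap, eval_add, eval_mul, eval_X, eval_finsetSum, eval_C]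
    rw [← starRingEnd_apply, ← starRingEnd_apply, map_add, ← neg_eq_iff_eq_neg.mpr h5]
    simp only [Pi.mul_apply, map_mul, Complex.conj_I]
    ring
  have h0 := integral_eq_of_hasDerivAt_off_countable _ _ S.countable_bad hB.continuousOn
    (fun θ hθ => hderiv θ hθ.2) (S.intervalIntegrable_mul_wt (Complex.I • f))
  have h1 : S.functional (Complex.I • f) = 0 := by
    rw [functional_apply, h0]
    simp [circleMap]
  rw [map_smul, smul_eq_zero] at h1
  exact h1.resolve_left Complex.I_ne_zero

lemma ip_eq_zero_of_degree_lt (Φ : ℕ → ℂ[X]) (hmonic : ∀ n, (Φ n).Monic)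
    (hdeg : ∀ n, (Φ n).natDegree = n)
    (horth : ∀ n, ∀ j < n, S.functional (circleEval (Φ n) * star (ζ ^ j)) = 0)
    (n : ℕ) (Q : ℂ[X]) (hdQ : Q.degree < n)
    (hQ : ∀ k, Q.eval (S.a k) = 0) :
    (S.orthoSystem Φ hmonic hdeg horth).ip
      (ζ * circleEval (derivative (Φ n)) + S.v * circleEval (Φ n)) (circleEval Q) = 0 := by
  choose q hq using fun k => dvd_iff_isRoot.mpr (hQ k)
  have h1 := S.functional_ibp (Φ n) hQ hq
  rw [map_sub, sub_eq_zero] at h1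
  refine h1.trans ?_
  refine (S.orthoSystem Φ hmonic hdeg horth).orth_of_degree_lt n _ ?_
  rw [← mem_degreeLT]
  refine Submodule.add_mem _ ?_ (Submodule.sum_mem _ fun k _ => ?_)
  · rw [mem_degreeLT, degree_lt_iff_coeff_zero] at *
    rintro (_ | j) hj
    · simp
    · rw [coeff_X_mul, coeff_derivative, hdQ _ hj, zero_mul]
  · rw [mem_degreeLT]
    refine (degree_C_mul_le' _ _).trans_lt ?_
    rwa [degree_mul, degree_X_add_C, ← degree_X_sub_C (S.a k), add_comm, ← degree_mul, ← hq k]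

/-- The singular system of a weight and its orthogonal polynomials. -/
noncomputable def singularSystem (Φ : ℕ → ℂ[X]) (hmonic : ∀ n, (Φ n).Monic)
    (hdeg : ∀ n, (Φ n).natDegree = n)
    (horth : ∀ n, ∀ j < n, S.functional (circleEval (Φ n) * star (ζ ^ j)) = 0)
    : SingularSystem m where
  toOrthoSystem := S.orthoSystem Φ hmonic hdeg horth
  a := S.a
  norm_a := S.norm_a
  a_inj := S.a_inj
  β := S.β
  ν := 2 * π * ‖S.D 0‖ ^ 2
  ν_pos := by
    have := S.D_ne_zero 0
    positivity
  ν_le := ((S.orthoSystem Φ hmonic hdeg horth).tendstoUniformlyOn_Φs S.differentiableOn_D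
    (fun z _ => S.D_ne_zero z) (S.tendsto_circleAverage_sq_norm Φ hmonic hdeg horth)
    fun _ h => S.exists_polynomial_sq_nrm_lt Φ hmonic hdeg horth h).1
  F z := S.D 0 / S.D z
  F_diff := (differentiableOn_const _).div S.differentiableOn_D fun z _ => S.D_ne_zero z
  F_ne z _ := div_ne_zero (S.D_ne_zero 0) (S.D_ne_zero z)
  F_lim := ((S.orthoSystem Φ hmonic hdeg horth).tendstoUniformlyOn_Φs S.differentiableOn_D
    (fun z _ => S.D_ne_zero z) (S.tendsto_circleAverage_sq_norm Φ hmonic hdeg horth)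
    fun _ h => S.exists_polynomial_sq_nrm_lt Φ hmonic hdeg horth h).2
  c := S.c
  v := S.v
  hasSum_v := S.hasSum_v
  star_v := S.star_v
  Cv := S.Cv
  s := S.s
  s_nonneg := S.s_nonneg
  s_lt := S.s_lt
  c_le := S.c_le
  p := S.p
  p_cont := S.continuousOn_p.mono (ball_subset_ball S.one_lt_R.le)
  hasSum_p z hz := S.hasSum_p z (hz.trans S.one_lt_R)
  deriv_F z hz := by
    have h := (hasDerivAt_const z (S.D 0)).div (S.hasDerivAt_D hz) (S.D_ne_zero z)
    refine h.deriv.trans ?_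
    have := S.D_ne_zero z
    generalize ∑ k, S.β k * conj (S.a k) / (1 - z * conj (S.a k)) = u
    field_simp
    ring
  ibp := S.ip_eq_zero_of_degree_lt Φ hmonic hdeg horth

lemma isO_Φs_sub_expansion (Φ : ℕ → ℂ[X]) (hmonic : ∀ n, (Φ n).Monic)
    (hdeg : ∀ n, (Φ n).natDegree = n)
    (horth : ∀ n, ∀ j < n, S.functional (circleEval (Φ n) * star (ζ ^ j)) = 0) :
    UBigO 2 fun n z => (conjReverse n (Φ n)).eval z -
    S.D 0 / S.D z * (1 - (n : ℂ)⁻¹ * ∑ k, (S.β k : ℂ) ^ 2 *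
      (z * conj (S.a k) * (1 - z * conj (S.a k))⁻¹)) :=
  (S.singularSystem Φ hmonic hdeg horth).isO_Φs_sub_expansion

end SingularWeight

lemma fourierCoeff_neg_of_conj_eq_neg {T : ℝ} [Fact (0 < T)] {f : AddCircle T → ℂ}
    (hf : ∀ t, conj (f t) = -f t) (n : ℤ) : fourierCoeff f (-n) = -conj (fourierCoeff f n) := by
  unfold fourierCoeff
  rw [← integral_conj, ← integral_neg]
  congr 1
  ext t
  rw [smul_eq_mul, smul_eq_mul, map_mul, hf, ← fourier_neg, mul_neg, neg_neg, neg_neg]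

lemma eq_sub_conj_of_fourierCoeff {T : ℝ} [Fact (0 < T)] {f : C(AddCircle T, ℂ)}
    (hf : ∀ t, conj (f t) = -f t) (h0 : fourierCoeff f 0 = 0) {c : ℕ → ℂ}
    (hc : ∀ n : ℕ, fourierCoeff f (n + 1) = c n) (hsum : Summable c) (t : AddCircle T) {P : ℂ}
    (hP : HasSum (fun n => c n * (AddCircle.toCircle t : ℂ) ^ n) P) :
    f t = AddCircle.toCircle t * P - conj (AddCircle.toCircle t * P) := by
  have hneg (n : ℕ) : fourierCoeff f (-(n + 1)) = -conj (c n) := by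
    rw [fourierCoeff_neg_of_conj_eq_neg hf, hc]
  have hs : Summable (fourierCoeff f) := by
    refine Summable.of_nat_of_neg_add_one ?_ ?_
    · rw [← summable_nat_add_iff 1]
      simpa [hc] using hsum
    · simp only [hneg]
      exact (Complex.hasSum_conj'.mpr hsum.hasSum).summable.neg
  refine (has_pointwise_sum_fourier_series_of_summable hs t).unique ?_
  have h1 := hP.mul_left (AddCircle.toCircle t : ℂ)
  rw [sub_eq_add_neg]
  refine HasSum.of_nat_of_neg_add_one ?_ ?_
  · rw [← hasSum_nat_add_iff' 1]
    simp only [Finset.range_one, Finset.sum_singleton, Nat.cast_zero, h0, zero_smul, sub_zero]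
    refine Eq.subst (motive := fun f => HasSum f _) (funext fun n => ?_) h1
    push_cast
    rw [hc, fourier_apply, smul_eq_mul]
    norm_cast
    simp only [AddCircle.toCircle_nsmul, Circle.coe_mul, Circle.coe_pow, pow_succ]
    ring
  · refine Eq.subst (motive := fun f => HasSum f _) (funext fun n => ?_)
      (Complex.hasSum_conj'.mpr h1).neg
    rw [hneg, smul_eq_mul, fourier_neg, fourier_apply]
    norm_cast
    simp only [AddCircle.toCircle_nsmul, Circle.coe_mul, Circle.coe_pow, pow_succ, map_mul, map_pow]
    ring

/-- A function on the annulus that is holomorphic and positive on the unit circle is the squared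
modulus, on the circle, of the exponential of a function that is holomorphic in a larger disk. -/
lemma exists_exp_re_eq {ρ : ℝ} (hρ0 : 0 < ρ) (hρ1 : ρ < 1) {w : ℂ → ℂ}
    (hw_an : DifferentiableOn ℂ w {z : ℂ | ρ < ‖z‖ ∧ ‖z‖ < 1 / ρ})
    (hw_ne : ∀ z : ℂ, ρ < ‖z‖ → ‖z‖ < 1 / ρ → w z ≠ 0)
    (hw_pos : ∀ z : ℂ, ‖z‖ = 1 → 0 < (w z).re ∧ (w z).im = 0) :
    ∃ (R : ℝ) (g p : ℂ → ℂ) (c : ℕ → ℂ) (Cv s : ℝ), 1 < R ∧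
      (∀ z, ‖z‖ < R → HasDerivAt g (p z) z) ∧ (g 0).im = 0 ∧ 0 ≤ s ∧ s < 1 ∧
      (∀ n, ‖c n‖ ≤ Cv * s ^ n) ∧ (∀ z : ℂ, ‖z‖ < R → HasSum (fun n => c n * z ^ n) (p z)) ∧
      ∀ z, ‖z‖ = 1 → Real.exp (2 * (g z).re) = (w z).re := by
  have hopen : IsOpen {z : ℂ | ρ < ‖z‖ ∧ ‖z‖ < 1 / ρ} :=
    (isOpen_lt continuous_const continuous_norm).inter (isOpen_lt continuous_norm continuous_const)
  have h1ρ : 1 < 1 / ρ := by rwa [lt_div_iff₀ hρ0, one_mul]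
  obtain ⟨R, hR1, hRρ⟩ := exists_between h1ρ
  have hR0 : 0 < R := by linarith
  set q : ℂ → ℂ := fun z => deriv w z / w z with hq
  have hqd : DifferentiableOn ℂ q {z : ℂ | ρ < ‖z‖ ∧ ‖z‖ < 1 / ρ} :=
    (hw_an.deriv hopen).div hw_an fun z hz => hw_ne z hz.1 hz.2
  have hqc : CircleIntegrable q 0 R := by
    refine ContinuousOn.circleIntegrable hR0.le (hqd.continuousOn.mono fun z hz => ?_)
    rw [mem_sphere_zero_iff_norm] at hz
    exact ⟨by linarith, by linarith⟩
  set c : ℕ → ℂ := (cauchyPowerSeries q 0 R).coeff with hc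
  set p : ℂ → ℂ := fun w => (2 * π * Complex.I : ℂ)⁻¹ • ∮ z in C(0, R), (z - w)⁻¹ • q z with hp
  have hsum (z : ℂ) (hz : ‖z‖ < R) : HasSum (fun n => c n * z ^ n) (p z) := by
    have h := hasSum_cauchyPowerSeries_integral hqc hz
    simp only [FormalMultilinearSeries.apply_eq_pow_smul_coeff, zero_add] at h
    rw [hc, hp]
    simpa only [smul_eq_mul, mul_comm (z ^ _)] using h
  have hpd : DifferentiableOn ℂ p (ball 0 R) := by
    set R' : NNReal := ⟨R, hR0.le⟩
    have h := (hasFPowerSeriesOn_cauchy_integral (R := R') hqc hR0).differentiableOn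
    have h2 : eball (0 : ℂ) (R' : ENNReal) = ball 0 R := Metric.eball_coe
    rwa [h2] at h
  set s : ℝ := R⁻¹ with hs
  set Cv := (2 * π)⁻¹ * ∫ θ : ℝ in 0..2 * π, ‖q (circleMap 0 R θ)‖ with hCv
  have hcle (n : ℕ) : ‖c n‖ ≤ Cv * s ^ n := by
    have h := norm_cauchyPowerSeries_le q 0 R n
    rwa [FormalMultilinearSeries.norm_apply_eq_norm_coef, abs_of_pos hR0] at h
  have hs1 : s < 1 := inv_lt_one_of_one_lt₀ hR1
  have hcsum : Summable c := by
    simpa using (hsum 1 (by simpa using hR1)).summable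
  set ℓ : ℝ → ℂ := fun θ => Complex.log (w (circleMap 0 1 θ)) with hℓ
  have hmem (θ : ℝ) : circleMap 0 1 θ ∈ {z : ℂ | ρ < ‖z‖ ∧ ‖z‖ < 1 / ρ} := by
    simp only [mem_ofPred_eq, norm_circleMap_one]
    exact ⟨hρ1, h1ρ⟩
  have hℓd (θ : ℝ) : HasDerivAt ℓ (Complex.I * (circleMap 0 1 θ * q (circleMap 0 1 θ))) θ := by
    have h1 := ((hw_an.differentiableAt (hopen.mem_nhds (hmem θ))).hasDerivAt.comp_circleMap).clog_real
      (Or.inl (hw_pos _ (norm_circleMap_one θ)).1)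
    refine h1.congr_deriv ?_
    rw [hq]
    ring
  have hℓr (θ : ℝ) : conj (ℓ θ) = ℓ θ := by
    have h1 := hw_pos _ (norm_circleMap_one θ)
    have h2 : w (circleMap 0 1 θ) = ((w (circleMap 0 1 θ)).re : ℂ) :=
      Complex.ext rfl (by simpa using h1.2)
    rw [hℓ]
    simp only
    rw [h2, ← Complex.ofReal_log h1.1.le, Complex.conj_ofReal]
  have hu (θ : ℝ) : conj (circleMap 0 1 θ * q (circleMap 0 1 θ)) =
      -(circleMap 0 1 θ * q (circleMap 0 1 θ)) := by
    have h1 := (hℓd θ).conj_of_real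
    simp only [hℓr] at h1
    have h2 := h1.unique (hℓd θ)
    rw [map_mul, Complex.conj_I] at h2
    refine mul_left_cancel₀ Complex.I_ne_zero ?_
    linear_combination -h2
  have : Fact (0 < 2 * π) := ⟨by positivity⟩
  set f : C(AddCircle (2 * π), ℂ) :=
    ⟨fun t => AddCircle.toCircle t * q (AddCircle.toCircle t), by
      have h1 : Continuous fun t : AddCircle (2 * π) => ((AddCircle.toCircle t : Circle) : ℂ) :=
        continuous_subtype_val.comp AddCircle.continuous_toCircle
      refine h1.mul (hqd.continuousOn.comp_continuous h1 fun t => ?_)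
      simp only [mem_ofPred_eq, Circle.norm_coe]
      exact ⟨hρ1, h1ρ⟩⟩ with hf
  have hcoe (θ : ℝ) : ((AddCircle.toCircle (θ : AddCircle (2 * π)) : Circle) : ℂ) =
      circleMap 0 1 θ := by
    rw [AddCircle.toCircle_apply_mk, div_self (by positivity), one_mul, circle_exp_eq_circleMap]
  have hf_apply (θ : ℝ) : f (θ : AddCircle (2 * π)) = circleMap 0 1 θ * q (circleMap 0 1 θ) := by
    rw [hf, ContinuousMap.coe_mk, hcoe]
  have hf_conj (t : AddCircle (2 * π)) : conj (f t) = -f t := by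
    induction t using QuotientAddGroup.induction_on with
    | H θ => rw [hf_apply, hu]
  have hf0 : fourierCoeff f 0 = 0 := by
    rw [fourierCoeff_eq_intervalIntegral f 0 0]
    have h1 : ∫ θ in (0 : ℝ)..2 * π, Complex.I * (circleMap 0 1 θ * q (circleMap 0 1 θ)) = 0 := by
      have h2 : Continuous fun θ : ℝ => circleMap 0 1 θ * q (circleMap 0 1 θ) :=
        (continuous_circleMap 0 1).mul
          (hqd.continuousOn.comp_continuous (continuous_circleMap 0 1) hmem)
      rw [intervalIntegral.integral_eq_sub_of_hasDerivAt (fun θ _ => hℓd θ)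
        ((continuous_const.mul h2).intervalIntegrable _ _)]
      simp [hℓ, circleMap]
    rw [intervalIntegral.integral_const_mul, mul_eq_zero, or_iff_right Complex.I_ne_zero] at h1
    simp [hf_apply, h1]
  have hfc (n : ℕ) : fourierCoeff f (n + 1) = c n := by
    have h1 : c n = (2 * π * Complex.I : ℂ)⁻¹ * ∮ z in C(0, R), (z - 0)⁻¹ • (z⁻¹ ^ n * q z) := by
      have h := cauchyPowerSeries_apply q 0 R n 1
      rw [FormalMultilinearSeries.apply_eq_pow_smul_coeff, one_pow, one_smul] at h
      rw [hc, h, smul_eq_mul]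
      congr 2
      ext z
      simp only [smul_eq_mul, sub_zero, one_div]
      ring
    have hd : DifferentiableOn ℂ (fun z => z⁻¹ ^ n * q z) {z : ℂ | ρ < ‖z‖ ∧ ‖z‖ < 1 / ρ} := by
      refine DifferentiableOn.mul (DifferentiableOn.pow ?_ n) hqd
      refine differentiableOn_id.inv fun z hz h => ?_
      rw [mem_ofPred_eq, show z = 0 from h, norm_zero] at hz
      linarith [hz.1]
    rw [h1, Complex.circleIntegral_sub_center_inv_smul_eq_of_differentiable_on_annulus_off_countable
      zero_lt_one hR1.le (s := ∅) countable_empty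
      (hd.continuousOn.mono fun z hz => ?_) fun z hz => hd.differentiableAt (hopen.mem_nhds ?_),
      fourierCoeff_eq_intervalIntegral f _ 0, circleIntegral, zero_add, Complex.real_smul,
      mul_inv, mul_assoc, ← intervalIntegral.integral_const_mul Complex.I⁻¹]
    · push_cast
      rw [one_div]
      congr 1
      refine intervalIntegral.integral_congr fun θ _ => ?_
      have h2 : circleMap 0 1 θ ≠ 0 := by simp
      simp only [hf_apply, fourier_neg, deriv_circleMap, smul_eq_mul, sub_zero]
      rw [fourier_apply]
      norm_cast
      rw [AddCircle.toCircle_nsmul, Circle.coe_pow, hcoe, map_pow,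
        conj_eq_inv_of_norm_eq_one (norm_circleMap_one θ)]
      field_simp
      rw [pow_succ]
      field_simp
    · simp only [Set.mem_sdiff, mem_closedBall_zero_iff, mem_ball_zero_iff, not_lt] at hz
      exact ⟨by linarith, by linarith⟩
    · simp only [Set.mem_sdiff, mem_closedBall_zero_iff, mem_ball_zero_iff, not_le] at hz
      exact ⟨by linarith, by linarith⟩
  have hfinal (θ : ℝ) : circleMap 0 1 θ * q (circleMap 0 1 θ) =
      circleMap 0 1 θ * p (circleMap 0 1 θ) - conj (circleMap 0 1 θ * p (circleMap 0 1 θ)) := by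
    have h1 := eq_sub_conj_of_fourierCoeff hf_conj hf0 hfc hcsum (θ : AddCircle (2 * π))
      (P := p (circleMap 0 1 θ)) (by
        rw [hcoe]
        exact hsum _ (by rwa [norm_circleMap_one]))
    rwa [hf_apply, hcoe] at h1
  obtain ⟨h, hh0, hh⟩ := hpd.isExactOn_ball.with_val_at 0 0
  have hconst : ∃ K : ℂ, ∀ θ, ℓ θ - (h (circleMap 0 1 θ) + conj (h (circleMap 0 1 θ))) = K := by
    have hd (θ : ℝ) : HasDerivAt
        (fun θ => ℓ θ - (h (circleMap 0 1 θ) + conj (h (circleMap 0 1 θ)))) 0 θ := by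
      have h1 := (hh _ (by simpa using hR1 : circleMap 0 1 θ ∈ ball 0 R)).comp_circleMap
      refine ((hℓd θ).sub (h1.add h1.conj_of_real)).congr_deriv ?_
      rw [hfinal]
      simp only [map_mul, Complex.conj_I]
      ring
    exact ⟨_, fun θ => is_const_of_deriv_eq_zero (fun θ => (hd θ).differentiableAt)
      (fun θ => (hd θ).deriv) θ 0⟩
  obtain ⟨K, hK⟩ := hconst
  refine ⟨R, fun z => (K.re / 2 : ℝ) + h z, p, c, Cv, s, hR1, fun z hz => ?_, ?_,
    inv_nonneg.mpr hR0.le, hs1, hcle, hsum, fun z hz => ?_⟩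
  · exact (hh z (by simpa using hz)).const_add _
  · simp [hh0]
  · have hz' : z = circleMap 0 1 z.arg := by
      rw [circleMap, Complex.ofReal_one, one_mul, zero_add]
      simpa [hz] using (Complex.norm_mul_exp_arg_mul_I z).symm
    have h1 := hK z.arg
    rw [← hz', Complex.add_conj, sub_eq_iff_eq_add] at h1
    have h2 := congrArg Complex.re h1
    rw [hℓ] at h2
    simp only [← hz', Complex.add_re, Complex.ofReal_re, Complex.log_re] at h2 ⊢
    have h3 := hw_pos z hz
    have h4 : ‖w z‖ = (w z).re := by
      rw [show w z = ((w z).re : ℂ) from Complex.ext rfl (by simpa using h3.2), Complex.norm_real,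
        Complex.ofReal_re, Real.norm_of_nonneg h3.1.le]
    rw [h4] at h2
    rw [← Real.exp_log h3.1, h2]
    congr 1
    ring

namespace SingularWeight

variable {m : ℕ} (S : SingularWeight m)

lemma exp_schwarz_integral_of_one_lt_norm {z : ℂ} (hz : 1 < ‖z‖) :
    Complex.exp ((4 * π : ℂ)⁻¹ * ∫ θ in (0 : ℝ)..(2 * π),
      (Real.log (S.wt (circleMap 0 1 θ)) : ℂ) *
        ((circleMap 0 1 θ + z) / (circleMap 0 1 θ - z))) = (conj (S.D (conj z)⁻¹))⁻¹ := by
  have hz0 : z ≠ 0 := by rintro rfl; simp at hz; linarith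
  have hx : ‖(conj z)⁻¹‖ < 1 := by
    rw [norm_inv, RCLike.norm_conj]
    exact inv_lt_one_of_one_lt₀ hz
  have h1 : ∫ θ in (0 : ℝ)..(2 * π), (Real.log (S.wt (circleMap 0 1 θ)) : ℂ) *
      ((circleMap 0 1 θ + z) / (circleMap 0 1 θ - z)) = -conj (4 * π * S.L (conj z)⁻¹) := by
    rw [← S.integral_log_wt_mul_schwarz hx, intervalIntegral.integral_of_le (by positivity),
      intervalIntegral.integral_of_le (by positivity), ← integral_conj, ← integral_neg]
    congr 1
    ext θ
    have he : circleMap 0 1 θ ≠ 0 := by simp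
    have hne : circleMap 0 1 θ - z ≠ 0 := by
      intro h
      rw [sub_eq_zero] at h
      rw [← h, norm_circleMap_one] at hz
      exact lt_irrefl _ hz
    have h4 : (circleMap 0 1 θ)⁻¹ - z⁻¹ = -(circleMap 0 1 θ - z) * ((circleMap 0 1 θ)⁻¹ * z⁻¹) := by
      field_simp
      ring
    have h5 : (circleMap 0 1 θ)⁻¹ + z⁻¹ = (circleMap 0 1 θ + z) * ((circleMap 0 1 θ)⁻¹ * z⁻¹) := by
      field_simp
      ring
    rw [map_mul, Complex.conj_ofReal, map_div₀, map_add, map_sub, map_inv₀, Complex.conj_conj,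
      conj_eq_inv_of_norm_eq_one (norm_circleMap_one θ), h4, h5,
      mul_div_mul_right _ _ (mul_ne_zero (inv_ne_zero he) (inv_ne_zero hz0)), div_neg, mul_neg,
      neg_neg]
  have hπ : (π : ℂ) ≠ 0 := by exact_mod_cast Real.pi_ne_zero
  rw [h1, D, ← Complex.exp_conj, ← Complex.exp_neg]
  congr 1
  simp only [map_mul, Complex.conj_ofReal, map_ofNat]
  field_simp

lemma tendsto_inv_conj_D : Tendsto (fun z : ℂ => (conj (S.D (conj z)⁻¹))⁻¹)
    (Bornology.cobounded ℂ) (nhds (conj (S.D 0))⁻¹) := by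
  have h1 : Tendsto (fun z : ℂ => conj (z⁻¹)) (Bornology.cobounded ℂ) (nhds 0) := by
    have h := (Complex.continuous_conj.tendsto 0).comp (tendsto_inv₀_cobounded (α := ℂ))
    rwa [map_zero] at h
  have h2 : ContinuousAt S.D 0 :=
    (S.differentiableOn_D.continuousOn).continuousAt (ball_mem_nhds 0 one_pos)
  have h3 := (Complex.continuous_conj.tendsto _).comp (h2.tendsto.comp h1)
  have h4 := h3.inv₀ (by simpa using S.D_ne_zero 0)
  refine h4.congr fun z => ?_
  simp [map_inv₀]

/-- The asymptotic expansion of the orthogonal polynomials outside of the closed unit disk. -/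
lemma exists_exterior_expansion (Φ : ℕ → ℂ[X]) (hmonic : ∀ n, (Φ n).Monic)
    (hdeg : ∀ n, (Φ n).natDegree = n)
    (horth : ∀ n, ∀ j < n, S.functional (circleEval (Φ n) * star (ζ ^ j)) = 0)
    {K : Set ℂ} (hK : IsCompact K) (hK1 : K ⊆ {z : ℂ | 1 < ‖z‖}) :
    ∃ C : ℝ, 0 < C ∧ ∃ N : ℕ, ∃ E : ℕ → ℂ → ℂ,
      (∀ n : ℕ, N ≤ n → ∀ z ∈ K, ‖E n z‖ ≤ C / (n : ℝ) ^ 2) ∧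
      ∀ n : ℕ, N ≤ n → ∀ z ∈ K, (Φ n).eval z =
        z ^ n * ((conj (S.D (conj z)⁻¹))⁻¹ / (conj (S.D 0))⁻¹) *
          (1 + (n : ℂ)⁻¹ * (∑ k, S.a k * (S.β k : ℂ) ^ 2 / (S.a k - z)) + E n z) := by
  rcases K.eq_empty_or_nonempty with rfl | hne
  · exact ⟨1, one_pos, 0, fun _ _ => 0, by simp, by simp⟩
  obtain ⟨z0, hz0, hmin⟩ := hK.exists_isMinOn hne continuous_norm.continuousOn
  have hz01 : 1 < ‖z0‖ := hK1 hz0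
  set r := ‖z0‖⁻¹ with hr
  have hr1 : r < 1 := inv_lt_one_of_one_lt₀ hz01
  have hnorm (z : ℂ) (hz : z ∈ K) : ‖(conj z)⁻¹‖ ≤ r := by
    rw [norm_inv, RCLike.norm_conj]
    exact inv_anti₀ (by linarith) (hmin hz)
  obtain ⟨C, hC, hev⟩ := S.isO_Φs_sub_expansion Φ hmonic hdeg horth r hr1
  obtain ⟨N, hN⟩ := eventually_atTop.mp hev
  obtain ⟨B, hB⟩ := (isCompact_closedBall (0 : ℂ) r).exists_bound_of_continuousOn
    (S.differentiableOn_D.continuousOn.mono (closedBall_subset_ball hr1))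
  have hD0 : S.D 0 ≠ 0 := S.D_ne_zero 0
  have hDx (x : ℂ) : S.D x ≠ 0 := S.D_ne_zero x
  set M := ‖(S.D 0)⁻¹‖ with hM
  refine ⟨C * (|B| * M) + 1, by positivity, N, fun n z => conj (((conjReverse n (Φ n)).eval
    (conj z)⁻¹ - S.D 0 / S.D (conj z)⁻¹ * (1 - (n : ℂ)⁻¹ * ∑ k, (S.β k : ℂ) ^ 2 *
      ((conj z)⁻¹ * conj (S.a k) * (1 - (conj z)⁻¹ * conj (S.a k))⁻¹))) *
      (S.D (conj z)⁻¹ * (S.D 0)⁻¹)), fun n hn z hz => ?_, fun n hn z hz => ?_⟩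
  · have h1 := hN n hn _ (hnorm z hz)
    have h2 : ‖S.D (conj z)⁻¹‖ ≤ |B| :=
      (hB _ (mem_closedBall_zero_iff.mpr (hnorm z hz))).trans (le_abs_self B)
    rw [RCLike.norm_conj, norm_mul, norm_mul]
    calc _ ≤ C * ((n : ℝ) ^ 2)⁻¹ * (|B| * M) := by gcongr
      _ = C * (|B| * M) / (n : ℝ) ^ 2 := by ring
      _ ≤ _ := by gcongr; linarith
  · have hz1 : 1 < ‖z‖ := hK1 hz
    have hzne : z ≠ 0 := by rintro rfl; simp at hz1; linarith
    have hcz : conj z ≠ 0 := by simpa using hzne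
    have hsum : ∑ k, S.a k * (S.β k : ℂ) ^ 2 / (S.a k - z) = -∑ k, (S.β k : ℂ) ^ 2 *
        (z⁻¹ * S.a k * (1 - z⁻¹ * S.a k)⁻¹) := by
      rw [← Finset.sum_neg_distrib]
      refine Finset.sum_congr rfl fun k _ => ?_
      have h1 : z - S.a k ≠ 0 := by
        intro h
        rw [sub_eq_zero] at h
        rw [h, S.norm_a] at hz1
        exact lt_irrefl _ hz1
      have h2 : 1 - z⁻¹ * S.a k = (z - S.a k) * z⁻¹ := by field_simp
      have h3 : S.a k - z ≠ 0 := fun h => h1 (by linear_combination -h)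
      rw [h2, div_eq_iff h3]
      field_simp
      ring
    have hrev := congrArg conj (eval_conjReverse n (Φ n) (hdeg n).le (conj z)⁻¹ (inv_ne_zero hcz))
    simp only [map_mul, map_pow, map_inv₀, Complex.conj_conj, inv_inv] at hrev
    have hc0 : conj (S.D 0) ≠ 0 := by simpa using hD0
    have hcx : conj (S.D (conj z)⁻¹) ≠ 0 := by simpa using hDx _
    simp only [map_mul, map_sub, map_div₀, map_inv₀, map_sum, map_pow, map_one, map_natCast,
      Complex.conj_conj, Complex.conj_ofReal, hrev, hsum]
    generalize (∑ k, (S.β k : ℂ) ^ 2 * (z⁻¹ * S.a k * (1 - z⁻¹ * S.a k)⁻¹)) = T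
    generalize conj (S.D 0) = d0 at *
    generalize conj (S.D (conj z)⁻¹) = dx at *
    generalize (n : ℂ)⁻¹ = u
    generalize (Φ n).eval z = y
    have hzn : z ^ n ≠ 0 := pow_ne_zero _ hzne
    rw [inv_pow]
    field_simp
    ring

end SingularWeight

end

theorem stmt2
    (ρ : ℝ) (hρ0 : 0 < ρ) (hρ1 : ρ < 1)
    (m : ℕ) (hm : 0 < m)
    (a : Fin m → ℂ) (ha : ∀ k, ‖a k‖ = 1) (ha' : Function.Injective a)
    (β : Fin m → ℝ) (hβ : ∀ k, -(1/2 : ℝ) < β k)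
    (w : ℂ → ℂ)
    (hw_an : AnalyticOn ℂ w {z : ℂ | ρ < ‖z‖ ∧ ‖z‖ < 1/ρ})
    (hw_ne : ∀ z : ℂ, ρ < ‖z‖ → ‖z‖ < 1/ρ → w z ≠ 0)
    (hw_pos : ∀ z : ℂ, ‖z‖ = 1 → 0 < (w z).re ∧ (w z).im = 0)
    (W : ℂ → ℝ)
    (hW : ∀ z : ℂ, ‖z‖ = 1 → W z = (w z).re * ∏ k, ‖z - a k‖ ^ (2 * β k))
    (Φ : ℕ → Polynomial ℂ)
    (hΦmonic : ∀ n, (Φ n).Monic) (hΦdeg : ∀ n, (Φ n).natDegree = n)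
    (hΦorth : ∀ n : ℕ, ∀ j < n,
      (∫ θ in (0:ℝ)..(2 * π),
        (Φ n).eval (Complex.exp (θ * Complex.I)) *
          (starRingEnd ℂ) (Complex.exp (θ * Complex.I)) ^ j *
          (W (Complex.exp (θ * Complex.I)) : ℂ)) = 0)
    (Di De : ℂ → ℂ)
    (hDi_def : ∀ z : ℂ, ‖z‖ < 1 → Di z =
      Complex.exp (((4 * π : ℝ)⁻¹ : ℂ) * ∫ θ in (0:ℝ)..(2 * π),
        (Real.log (W (Complex.exp (θ * Complex.I))) : ℂ) *
          ((Complex.exp (θ * Complex.I) + z) / (Complex.exp (θ * Complex.I) - z))))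
    (hDe_def : ∀ z : ℂ, 1 < ‖z‖ → De z =
      Complex.exp (((4 * π : ℝ)⁻¹ : ℂ) * ∫ θ in (0:ℝ)..(2 * π),
        (Real.log (W (Complex.exp (θ * Complex.I))) : ℂ) *
          ((Complex.exp (θ * Complex.I) + z) / (Complex.exp (θ * Complex.I) - z))))
    (hDi_an : AnalyticOn ℂ Di
      ({z : ℂ | ‖z‖ < 1/ρ} \ ⋃ k, (fun t : ℝ => (t : ℂ) * a k) '' Set.Ico 1 (1/ρ)))
    (hDe_an : AnalyticOn ℂ De
      ({z : ℂ | ρ < ‖z‖} \ ⋃ k, (fun t : ℝ => (t : ℂ) * a k) '' Set.Ioc ρ 1))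
    (τ : ℂ) (hτ : Filter.Tendsto De (Bornology.cobounded ℂ) (nhds τ))
    (hτ_pos : 0 < τ.re ∧ τ.im = 0)
    :
    ∀ K : Set ℂ, IsCompact K → K ⊆ {z : ℂ | 1 < ‖z‖} →
      ∃ C : ℝ, 0 < C ∧ ∃ N : ℕ, ∃ E : ℕ → ℂ → ℂ,
        (∀ n : ℕ, N ≤ n → ∀ z ∈ K, ‖E n z‖ ≤ C / (n : ℝ) ^ 2) ∧
        (∀ n : ℕ, N ≤ n → ∀ z ∈ K,
          (Φ n).eval z =
            z ^ n * (De z / τ) *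
              (1 + ((n : ℂ))⁻¹ * (∑ k, (a k) * (β k : ℂ) ^ 2 / (a k - z)) + E n z)) := by
  obtain ⟨R, g, p, c, Cv, s, hR, hg, hg0, hs0, hs1, hc, hp, hw⟩ :=
    exists_exp_re_eq hρ0 hρ1 hw_an.differentiableOn hw_ne hw_pos
  let S : SingularWeight m :=
    ⟨a, ha, ha', β, hβ, R, hR, g, p, hg, hg0, c, Cv, s, hs0, hs1, hc, hp⟩
  have hexp (θ : ℝ) : Complex.exp (θ * Complex.I) = circleMap 0 1 θ := by simp [circleMap]
  have hWS (θ : ℝ) : W (circleMap 0 1 θ) = S.wt (circleMap 0 1 θ) := by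
    have h1 := norm_circleMap_one θ
    rw [hW _ h1, SingularWeight.wt]
    congr 1
    · exact (hw _ h1).symm
    · exact Finset.prod_congr rfl fun k _ => by rw [S.norm_one_sub]
  have horth : ∀ n, ∀ j < n, S.functional (circleEval (Φ n) * star (circleCoord ^ j)) = 0 := by
    intro n j hj
    rw [S.functional_apply]
    refine Eq.trans ?_ (hΦorth n j hj)
    refine intervalIntegral.integral_congr fun θ _ => ?_
    simp [hexp, hWS]
  have hDe (z : ℂ) (hz : 1 < ‖z‖) : De z =
      (starRingEnd ℂ (S.D (starRingEnd ℂ z)⁻¹))⁻¹ := by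
    rw [hDe_def z hz, ← S.exp_schwarz_integral_of_one_lt_norm hz]
    simp only [hexp, hWS]
    push_cast
    rfl
  have hev : ∀ᶠ z in Bornology.cobounded ℂ, 1 < ‖z‖ :=
    tendsto_norm_cobounded_atTop.eventually_gt_atTop 1
  have hτ' : τ = (starRingEnd ℂ (S.D 0))⁻¹ :=
    tendsto_nhds_unique hτ
      (S.tendsto_inv_conj_D.congr' (hev.mono fun z hz => (hDe z hz).symm))
  intro K hK hK1
  obtain ⟨C, hC, N, E, hE, hΦ⟩ := S.exists_exterior_expansion Φ hΦmonic hΦdeg horth hK hK1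
  refine ⟨C, hC, N, E, hE, fun n hn z hz => ?_⟩
  rw [hΦ n hn z hz, hDe z (hK1 hz), hτ']
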